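/- Let d ≥ 1 and let Γ ≤ GL_d(ℂ) be a group generated by a finite symmetric set X. If Γ is mixed identity free, then there exists a constant C > 0 such that for every nontrivial mixed word w ∈ Γ∗⟨x⟩ there is an element γ ∈ Γ with ‖γ‖_X ≤ C·log(‖w‖ + 1) and w(γ) ≠ 1. -/

import Mathlib

open Matrix

/-- The free product `Γ ∗ ⟨x⟩` of a group `Γ` with an infinite cyclic group `⟨x⟩`. -/
abbrev MixedWordGroup (G : Type*) [Group G] : Type _ :=
  Monoid.Coprod G (Multiplicative ℤ)

/-- The distinguished generator `x` of the free factor `⟨x⟩` in `Γ ∗ ⟨x⟩`. -/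
def xGen (G : Type*) [Group G] : MixedWordGroup G :=
  Monoid.Coprod.inr (Multiplicative.ofAdd (1 : ℤ))

/-- Evaluation of a mixed word: the unique homomorphism `Γ ∗ ⟨x⟩ → Γ` restricting to the
identity on `Γ` and sending `x` to `γ`. -/
def evalWord {G : Type*} [Group G] (γ : G) : MixedWordGroup G →* G :=
  Monoid.Coprod.lift (MonoidHom.id G) (zpowersHom G γ)

/-- Word length of `g` with respect to the set `S`. -/
noncomputable def wordLength {G : Type*} [Group G] (S : Set G) (g : G) : ℕ :=
  sInf {n | ∃ l : List G, (∀ a ∈ l, a ∈ S) ∧ l.length = n ∧ l.prod = g}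

/-- The generating set `X ∪ {x, x⁻¹}` of `Γ ∗ ⟨x⟩`. -/
def mixedGenSet {G : Type*} [Group G] (X : Set G) : Set (MixedWordGroup G) :=
  (Monoid.Coprod.inl '' X) ∪ {xGen G, (xGen G)⁻¹}

namespace MixedIdentity

section Words

open Monoid

/-- The two factors of `G ∗ ⟨x⟩`, as a family indexed by `Bool`. -/
abbrev factor (G : Type) (b : Bool) : Type := cond b (Multiplicative ℤ) G

instance (G : Type) [Group G] : (b : Bool) → Group (factor G b)
  | true => inferInstanceAs (Group (Multiplicative ℤ))
  | false => inferInstanceAs (Group G)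

variable {G : Type} [Group G]

/-- The inclusion of `G` in the indexed free product. -/
def inG : G →* CoprodI (factor G) := CoprodI.of (M := factor G) (i := false)

/-- The inclusion of `⟨x⟩` in the indexed free product. -/
def inZ : Multiplicative ℤ →* CoprodI (factor G) := CoprodI.of (M := factor G) (i := true)

/-- The comparison map from the binary to the indexed free product. -/
def toCoprodI (G : Type) [Group G] : MixedWordGroup G →* CoprodI (factor G) :=
  Coprod.lift inG inZ

/-- The homomorphisms from the two factors given by one from `G` and an element. -/
def factorHom {P : Type*} [Group P] (f : G →* P) (u : P) : (b : Bool) → factor G b →* P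
  | true => zpowersHom P u
  | false => f

lemma toCoprodI_comp {P : Type*} [Group P] (f : G →* P) (u : P) :
    (CoprodI.lift (factorHom f u)).comp (toCoprodI G) = Coprod.lift f (zpowersHom P u) := by
  apply Coprod.hom_ext
  · ext g
    simp only [toCoprodI, MonoidHom.comp_apply, Coprod.lift_apply_inl]
    exact CoprodI.lift_of (factorHom f u) (i := false) g
  · refine MonoidHom.ext fun g => ?_
    simp only [toCoprodI, MonoidHom.comp_apply, Coprod.lift_apply_inr]
    exact CoprodI.lift_of (factorHom f u) (i := true) g

lemma toCoprodI_injective : Function.Injective (toCoprodI G) := by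
  have h := toCoprodI_comp (G := G) (P := MixedWordGroup G) Coprod.inl (xGen G)
  have h2 : Coprod.lift (Coprod.inl) (zpowersHom (MixedWordGroup G) (xGen G))
      = MonoidHom.id (MixedWordGroup G) := by
    apply Coprod.hom_ext
    · ext; simp
    · refine MonoidHom.ext fun g => ?_
      simp only [MonoidHom.comp_apply, Coprod.lift_apply_inr, MonoidHom.id_apply, zpowersHom_apply,
        xGen]
      rw [← map_zpow]
      congr 1
      rw [← ofAdd_zsmul]; simp
  rw [h2] at h
  intro a b hab
  have := congrArg (CoprodI.lift (factorHom Coprod.inl (xGen G))) hab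
  simpa [← MonoidHom.comp_apply, h] using this

/-- Reduced words in the free product `G ∗ ⟨x⟩`. -/
abbrev RWord (G : Type) [Group G] := CoprodI.Word (factor G)

open scoped Classical in
noncomputable instance : MulAction (CoprodI (factor G)) (RWord G) := inferInstance

lemma fstIdx_inG_smul {g : G} (hg : g ≠ 1) {w : RWord G} (hw : w.fstIdx ≠ some false) :
    (inG g • w).fstIdx = some false := by
  classical
  have h := CoprodI.Word.fstIdx_cons (M := factor G) (i := false) g w hw hg
  have e : inG g • w = CoprodI.Word.cons (M := factor G) (i := false) g w hw hg := by
    rw [CoprodI.Word.cons_eq_smul]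
    change (CoprodI.of (M := factor G) (i := false) g) • w = _
    congr!
  rw [e, h]

lemma fstIdx_inZ_smul {g : Multiplicative ℤ} (hg : g ≠ 1) {w : RWord G}
    (hw : w.fstIdx ≠ some true) : (inZ (G := G) g • w).fstIdx = some true := by
  classical
  have h := CoprodI.Word.fstIdx_cons (M := factor G) (i := true) g w hw hg
  have e : inZ (G := G) g • w = CoprodI.Word.cons (M := factor G) (i := true) g w hw hg := by
    rw [CoprodI.Word.cons_eq_smul]
    change (CoprodI.of (M := factor G) (i := true) g) • w = _
    congr!
  rw [e, h]

lemma ofAdd_ne_one {k : ℤ} (hk : k ≠ 0) : Multiplicative.ofAdd k ≠ 1 := by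
  simpa using hk

/-- The power `x ^ k` in the indexed free product. -/
def xPow (G : Type) [Group G] (k : ℤ) : CoprodI (factor G) := inZ (Multiplicative.ofAdd k)

lemma xPow_mul (j k : ℤ) : xPow G j * xPow G k = xPow G (j + k) := by
  rw [xPow, xPow, xPow, ← map_mul, ofAdd_add]

lemma xPow_inv (k : ℤ) : (xPow G k)⁻¹ = xPow G (-k) := by
  rw [xPow, xPow, ← map_inv, ofAdd_neg]

lemma fstIdx_xPow_smul {k : ℤ} (hk : k ≠ 0) {w : RWord G}
    (hw : w.fstIdx ≠ some true) : (xPow G k • w).fstIdx = some true :=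
  fstIdx_inZ_smul (ofAdd_ne_one hk) hw

lemma toCoprodI_inl (g : G) : toCoprodI G (Coprod.inl g) = inG g := by simp [toCoprodI]

lemma toCoprodI_xGen_zpow (k : ℤ) : toCoprodI G (xGen G ^ k) = xPow G k := by
  simp only [toCoprodI, xGen, map_zpow, Coprod.lift_apply_inr, xPow]
  rw [← map_zpow, ← ofAdd_zsmul]; simp

lemma xGen_zpow_ne_one {k : ℤ} (hk : k ≠ 0) : xGen G ^ k ≠ 1 := by
  intro h
  have h1 : xPow G k = 1 := by rw [← toCoprodI_xGen_zpow, h, map_one]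
  have h2 := fstIdx_xPow_smul (G := G) hk (w := CoprodI.Word.empty) (by simp [CoprodI.Word.fstIdx, CoprodI.Word.empty])
  rw [h1, one_smul] at h2
  simp [CoprodI.Word.fstIdx, CoprodI.Word.empty] at h2

lemma commutator_conj_ne_one {a b : G} (ha : a ≠ 1) (hb : b ≠ 1) {k : ℤ} (hk : k ≠ 0) :
    (xGen G ^ k * Coprod.inl a * (xGen G ^ k)⁻¹) * Coprod.inl b *
      (xGen G ^ k * Coprod.inl a * (xGen G ^ k)⁻¹)⁻¹ * (Coprod.inl b)⁻¹ ≠ 1 := by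
  intro h
  have h1 := congrArg (toCoprodI G) h
  simp only [map_mul, map_inv, toCoprodI_xGen_zpow, toCoprodI_inl,
    map_one, _root_.mul_inv_rev, inv_inv] at h1
  rw [← map_inv, ← map_inv, xPow_inv] at h1
  have h2 := congrArg (fun g => (g • (CoprodI.Word.empty : RWord G)).fstIdx) h1
  simp only [mul_smul, one_smul] at h2
  rw [fstIdx_xPow_smul hk] at h2
  · simp [CoprodI.Word.fstIdx, CoprodI.Word.empty] at h2
  have e0 : (CoprodI.Word.empty : RWord G).fstIdx ≠ some false := by
    simp [CoprodI.Word.fstIdx, CoprodI.Word.empty]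
  have e1 := fstIdx_inG_smul (inv_ne_one.2 hb) e0
  have e2 := fstIdx_xPow_smul (neg_ne_zero.2 hk) (w := inG b⁻¹ • (CoprodI.Word.empty : RWord G)) (by rw [e1]; simp)
  have e3 := fstIdx_inG_smul (inv_ne_one.2 ha) (w := xPow G (-k) • inG b⁻¹ • (CoprodI.Word.empty : RWord G)) (by rw [e2]; simp)
  have e4 := fstIdx_xPow_smul hk (w := inG a⁻¹ • xPow G (-k) • inG b⁻¹ • (CoprodI.Word.empty : RWord G)) (by rw [e3]; simp)
  have e5 := fstIdx_inG_smul hb (by rw [e4]; simp)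
  have e6 := fstIdx_xPow_smul (neg_ne_zero.2 hk) (by rw [e5]; simp)
  have e7 := fstIdx_inG_smul ha (by rw [e6]; simp)
  rw [e7]; simp

/-- Reduced words beginning with the syllable `x ^ k`. -/
def startX (G : Type) [Group G] (k : ℤ) : Set (RWord G) :=
  {w | ∃ v : RWord G, v.fstIdx ≠ some true ∧ w = xPow G k • v}

lemma fstIdx_of_mem_startX {k : ℤ} (hk : k ≠ 0) {w : RWord G} (hw : w ∈ startX G k) :
    w.fstIdx = some true := by
  obtain ⟨v, hv, rfl⟩ := hw
  exact fstIdx_xPow_smul hk hv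

/-- The word `x b x c x⁻²`. -/
def pingWord (b c : G) : CoprodI (factor G) :=
  xPow G 1 * inG b * xPow G 1 * inG c * xPow G (-2)

lemma pingWord_smul {b c : G} (hb : b ≠ 1) (hc : c ≠ 1) {w : RWord G}
    (hw : w.fstIdx = some false ∨ w ∈ startX G 1) : pingWord b c • w ∈ startX G 1 := by
  have key : ∃ k : ℤ, k ≠ 0 ∧ ∃ v : RWord G, v.fstIdx ≠ some true ∧ xPow G (-2) • w = xPow G k • v := by
    rcases hw with hw | ⟨v, hv, rfl⟩
    · exact ⟨-2, by simp, w, by simp [hw], rfl⟩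
    · exact ⟨-1, by simp, v, hv, by rw [← mul_smul, xPow_mul]; norm_num⟩
  obtain ⟨k, hk, v, hv, e⟩ := key
  simp only [pingWord, mul_smul]
  rw [e]
  refine ⟨_, ?_, rfl⟩
  have e1 := fstIdx_xPow_smul hk hv
  have e2 := fstIdx_inG_smul hc (w := xPow G k • v) (by rw [e1]; simp)
  have e3 := fstIdx_xPow_smul one_ne_zero (by rw [e2]; simp)
  rw [fstIdx_inG_smul hb (by rw [e3]; simp)]; simp

lemma pingWord_inv_smul {b c : G} (hb : b ≠ 1) (hc : c ≠ 1) {w : RWord G}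
    (hw : w.fstIdx = some false ∨ w ∈ startX G 2) : (pingWord b c)⁻¹ • w ∈ startX G 2 := by
  have key : ∃ k : ℤ, k ≠ 0 ∧ ∃ v : RWord G, v.fstIdx ≠ some true ∧ xPow G (-1) • w = xPow G k • v := by
    rcases hw with hw | ⟨v, hv, rfl⟩
    · exact ⟨-1, by simp, w, by simp [hw], rfl⟩
    · exact ⟨1, by simp, v, hv, by rw [← mul_smul, xPow_mul]; norm_num⟩
  obtain ⟨k, hk, v, hv, e⟩ := key
  simp only [pingWord, _root_.mul_inv_rev, mul_smul, xPow_inv, ← map_inv, neg_neg]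
  rw [e]
  refine ⟨_, ?_, rfl⟩
  have e1 := fstIdx_xPow_smul hk hv
  have e2 := fstIdx_inG_smul (inv_ne_one.2 hb) (w := xPow G k • v) (by rw [e1]; simp)
  have e3 := fstIdx_xPow_smul (k := -1) (by simp) (by rw [e2]; simp)
  rw [fstIdx_inG_smul (inv_ne_one.2 hc) (by rw [e3]; simp)]; simp

lemma pingWord_pow_smul {b c : G} (hb : b ≠ 1) (hc : c ≠ 1) {w : RWord G}
    (hw : w.fstIdx = some false) (n : ℕ) : pingWord b c ^ (n + 1) • w ∈ startX G 1 := by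
  induction n with
  | zero => rw [zero_add, pow_one]; exact pingWord_smul hb hc (.inl hw)
  | succ n ih => rw [pow_succ', mul_smul]; exact pingWord_smul hb hc (.inr ih)

lemma pingWord_inv_pow_smul {b c : G} (hb : b ≠ 1) (hc : c ≠ 1) {w : RWord G}
    (hw : w.fstIdx = some false) (n : ℕ) : (pingWord b c)⁻¹ ^ (n + 1) • w ∈ startX G 2 := by
  induction n with
  | zero => rw [zero_add, pow_one]; exact pingWord_inv_smul hb hc (.inl hw)
  | succ n ih => rw [pow_succ', mul_smul]; exact pingWord_inv_smul hb hc (.inr ih)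

lemma pingWord_zpow_smul {b c : G} (hb : b ≠ 1) (hc : c ≠ 1) {w : RWord G}
    (hw : w.fstIdx = some false) {k : ℤ} (hk : k ≠ 0) :
    pingWord b c ^ k • w ∈ startX G 1 ∪ startX G 2 := by
  rcases lt_or_gt_of_ne hk with h | h
  · obtain ⟨n, hn⟩ : ∃ n : ℕ, k = -((n + 1 : ℕ) : ℤ) := ⟨(-k - 1).toNat, by omega⟩
    rw [hn, _root_.zpow_neg, zpow_natCast, ← inv_pow]
    exact .inr (pingWord_inv_pow_smul hb hc hw n)
  · obtain ⟨n, hn⟩ : ∃ n : ℕ, k = ((n + 1 : ℕ) : ℤ) := ⟨(k - 1).toNat, by omega⟩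
    rw [hn, zpow_natCast]
    exact .inl (pingWord_pow_smul hb hc hw n)

lemma lift_pingWord_injective [Nontrivial G] {b c : G} (hb : b ≠ 1) (hc : c ≠ 1) :
    Function.Injective (CoprodI.lift (factorHom inG (pingWord b c))) := by
  let X : Bool → Set (RWord G) := fun i => cond i (startX G 1 ∪ startX G 2) {w | w.fstIdx = some false}
  have hX : ∀ w ∈ X true, w.fstIdx = some true := by
    rintro w (hw | hw)
    exacts [fstIdx_of_mem_startX one_ne_zero hw, fstIdx_of_mem_startX two_ne_zero hw]
  have e0 : ∀ i, (CoprodI.Word.empty : RWord G).fstIdx ≠ some i := by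
    simp [CoprodI.Word.fstIdx, CoprodI.Word.empty]
  refine CoprodI.lift_injective_of_ping_pong (factorHom inG (pingWord b c)) ?_ X ?_ ?_ ?_
  · right
    refine ⟨true, ?_⟩
    have : Infinite (factor G true) := inferInstanceAs (Infinite (Multiplicative ℤ))
    exact (Cardinal.natCast_le_aleph0 (n := 3)).trans (Cardinal.aleph0_le_mk _)
  · rintro (_ | _)
    · exact ⟨inG b • CoprodI.Word.empty, fstIdx_inG_smul hb (e0 _)⟩
    · exact ⟨xPow G 1 • CoprodI.Word.empty, .inl ⟨_, e0 _, rfl⟩⟩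
  · have h1 : Disjoint (X false) (X true) := by
      rw [Set.disjoint_left]
      intro w hw hw'
      have := hX w hw'
      have h2 : w.fstIdx = some false := hw
      rw [h2] at this; simp at this
    rintro (_ | _) (_ | _) hij
    · exact absurd rfl hij
    · exact h1
    · exact h1.symm
    · exact absurd rfl hij
  · rintro (_ | _) (_ | _) hij h hh
    · exact absurd rfl hij
    · rintro _ ⟨w, hw, rfl⟩
      exact fstIdx_inG_smul (g := h) hh (by rw [hX w hw]; simp)
    · rintro _ ⟨w, hw, rfl⟩
      exact pingWord_zpow_smul hb hc hw (k := Multiplicative.toAdd h) (fun h0 => hh (Multiplicative.toAdd.injective h0))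
    · exact absurd rfl hij

/-- Substituting `x b x c x⁻²` for `x` is injective on mixed words. -/
lemma substitution_injective {b c : G} (hb : b ≠ 1) (hc : c ≠ 1) :
    Function.Injective (Coprod.lift (Coprod.inl : G →* MixedWordGroup G)
      (zpowersHom (MixedWordGroup G) (xGen G * Coprod.inl b * xGen G * Coprod.inl c *
        (xGen G ^ 2)⁻¹))) := by
  have : Nontrivial G := ⟨b, 1, hb⟩
  have h1 := (lift_pingWord_injective hb hc).comp (toCoprodI_injective (G := G))
  rw [← MonoidHom.coe_comp, toCoprodI_comp] at h1
  refine Function.Injective.of_comp (f := toCoprodI G) ?_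
  rw [← MonoidHom.coe_comp]
  convert h1 using 2
  apply Coprod.hom_ext
  · ext g; simp [toCoprodI_inl]
  · refine MonoidHom.ext fun g => ?_
    simp only [MonoidHom.comp_apply, Coprod.lift_apply_inr, zpowersHom_apply, map_zpow]
    congr 1
    have hx : toCoprodI G (xGen G) = xPow G 1 := by rw [← toCoprodI_xGen_zpow, zpow_one]
    simp only [map_mul, map_inv, map_pow, toCoprodI_inl, hx, pingWord]
    rw [pow_two, xPow_mul, xPow_inv]
    norm_num

@[simp] lemma evalWord_inl (γ g : G) : evalWord γ (Coprod.inl g) = g := by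
  simp [evalWord]

@[simp] lemma evalWord_xGen (γ : G) : evalWord γ (xGen G) = γ := by
  simp [evalWord, xGen]

/-- A group without mixed identities. -/
def IsMIF (G : Type) [Group G] : Prop :=
  ∀ w : MixedWordGroup G, w ≠ 1 → ∃ γ : G, evalWord γ w ≠ 1

lemma IsMIF.exists_pow_ne_one (h : IsMIF G) {k : ℕ} (hk : k ≠ 0) : ∃ γ : G, γ ^ k ≠ 1 := by
  obtain ⟨γ, hγ⟩ := h (xGen G ^ (k : ℤ)) (xGen_zpow_ne_one (by exact_mod_cast hk))
  exact ⟨γ, by simpa using hγ⟩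

lemma IsMIF.exists_conj_not_commute (h : IsMIF G) {k : ℕ} (hk : k ≠ 0) {a b : G} (ha : a ≠ 1)
    (hb : b ≠ 1) : ∃ γ : G, ¬ Commute (γ ^ k * a * (γ ^ k)⁻¹) b := by
  obtain ⟨γ, hγ⟩ := h _ (commutator_conj_ne_one ha hb (k := (k : ℤ)) (by exact_mod_cast hk))
  refine ⟨γ, fun hc => hγ ?_⟩
  simp only [map_mul, map_inv, map_pow, evalWord_inl, evalWord_xGen, zpow_natCast]
  rw [hc.eq]; group

lemma IsMIF.exists_substitution (h : IsMIF G) {b c : G} (hb : b ≠ 1) (hc : c ≠ 1)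
    {w : MixedWordGroup G} (hw : w ≠ 1) :
    ∃ γ : G, evalWord (γ * b * γ * c * (γ ^ 2)⁻¹) w ≠ 1 := by
  obtain ⟨γ, hγ⟩ := h _ ((map_ne_one_iff _ (substitution_injective hb hc)).2 hw)
  refine ⟨γ, fun h1 => hγ ?_⟩
  rw [← h1, ← MonoidHom.comp_apply]
  congr 1
  apply Coprod.hom_ext
  · ext g; simp
  · refine MonoidHom.ext fun g => ?_
    have hx := evalWord_xGen γ
    have hx' := fun a : G => evalWord_inl γ a
    simp only [MonoidHom.comp_apply, Coprod.lift_apply_inr, zpowersHom_apply, map_zpow, map_mul,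
      map_inv, map_pow, hx, hx']
    simp [evalWord]

end Words
end MixedIdentity

namespace MixedIdentity

section Amenability

open Filter Topology

/-- A real function with bounded absolute value. -/
def IsBdd {Y : Type*} (f : Y → ℝ) : Prop := ∃ C, ∀ y, |f y| ≤ C

section IsBdd
variable {Y Z : Type*} {f g : Y → ℝ}

lemma IsBdd.add (hf : IsBdd f) (hg : IsBdd g) : IsBdd (fun y => f y + g y) := by
  obtain ⟨C, hC⟩ := hf
  obtain ⟨D, hD⟩ := hg
  exact ⟨C + D, fun y => (abs_add_le _ _).trans (add_le_add (hC y) (hD y))⟩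

lemma IsBdd.const_mul (hf : IsBdd f) (c : ℝ) : IsBdd (fun y => c * f y) := by
  obtain ⟨C, hC⟩ := hf
  exact ⟨|c| * C, fun y => by rw [abs_mul]; exact mul_le_mul_of_nonneg_left (hC y) (abs_nonneg c)⟩

lemma IsBdd.comp (hf : IsBdd f) (φ : Z → Y) : IsBdd (fun z => f (φ z)) := by
  obtain ⟨C, hC⟩ := hf
  exact ⟨C, fun z => hC _⟩

lemma isBdd_const (c : ℝ) : IsBdd (fun _ : Y => c) := ⟨|c|, fun _ => le_rfl⟩

end IsBdd

/-- An invariant mean on a `G`-set: a positive normalized invariant linear functional on the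
bounded real functions. -/
structure InvMean (G Y : Type*) [Group G] [MulAction G Y] where
  /-- The underlying functional. -/
  toFun : (Y → ℝ) → ℝ
  add' : ∀ f g, IsBdd f → IsBdd g → toFun (fun y => f y + g y) = toFun f + toFun g
  smul' : ∀ (c : ℝ) f, IsBdd f → toFun (fun y => c * f y) = c * toFun f
  nonneg' : ∀ f, IsBdd f → (∀ y, 0 ≤ f y) → 0 ≤ toFun f
  one' : toFun (fun _ => 1) = 1
  inv' : ∀ (s : G) f, IsBdd f → toFun (fun y => f (s • y)) = toFun f

/-- A (discrete) group is amenable if it carries an invariant mean. -/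
def Amenable (G : Type*) [Group G] : Prop := Nonempty (InvMean G G)

namespace InvMean

variable {G Y Z : Type*} [Group G] [MulAction G Y] [MulAction G Z] (M : InvMean G Y)
  {f g : Y → ℝ}

lemma mono (hf : IsBdd f) (hg : IsBdd g) (h : ∀ y, f y ≤ g y) : M.toFun f ≤ M.toFun g := by
  have h1 : IsBdd (fun y => g y + -1 * f y) := hg.add (hf.const_mul _)
  have h2 := M.add' _ _ hf h1
  have h3 := M.nonneg' _ h1 (fun y => by linarith [h y])
  have h4 : (fun y => f y + (g y + -1 * f y)) = g := by ext y; ring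
  rw [h4] at h2
  linarith

lemma const (c : ℝ) : M.toFun (fun _ => c) = c := by
  have := M.smul' c (fun _ => 1) (isBdd_const _)
  simpa [M.one'] using this

lemma abs_le {C : ℝ} (h : ∀ y, |f y| ≤ C) : |M.toFun f| ≤ C := by
  rw [_root_.abs_le]
  constructor
  · rw [← M.const (-C)]
    exact M.mono (isBdd_const _) ⟨C, h⟩ fun y => (_root_.abs_le.1 (h y)).1
  · rw [← M.const C]
    exact M.mono ⟨C, h⟩ (isBdd_const _) fun y => (_root_.abs_le.1 (h y)).2

/-- Push an invariant mean forward along an equivariant map. -/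
def map (φ : Y → Z) (hφ : ∀ (s : G) y, φ (s • y) = s • φ y) : InvMean G Z where
  toFun f := M.toFun fun y => f (φ y)
  add' f g hf hg := M.add' _ _ (hf.comp φ) (hg.comp φ)
  smul' c f hf := M.smul' c _ (hf.comp φ)
  nonneg' f hf h := M.nonneg' _ (hf.comp φ) fun y => h _
  one' := M.one'
  inv' s f hf := by
    simp only [← hφ]
    exact M.inv' s _ (hf.comp φ)

end InvMean

variable {G : Type*} [Group G]

lemma Amenable.subgroup (h : Amenable G) (H : Subgroup G) : Amenable H := by
  obtain ⟨M⟩ := h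
  let M' : InvMean H G :=
    { toFun := M.toFun
      add' := M.add'
      smul' := M.smul'
      nonneg' := M.nonneg'
      one' := M.one'
      inv' := fun s f hf => M.inv' (s : G) f hf }
  let q : G → Quotient (QuotientGroup.rightRel H) := Quotient.mk _
  have hq : ∀ g, g * (q g).out⁻¹ ∈ H := fun g => by
    have := Quotient.exact ((q g).out_eq)
    exact QuotientGroup.rightRel_apply.1 this
  refine ⟨M'.map (fun g => ⟨g * (q g).out⁻¹, hq g⟩) fun s g => ?_⟩
  have : q (s • g) = q g := by
    apply Quotient.sound
    apply QuotientGroup.rightRel_apply.2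
    rw [Subgroup.smul_def, smul_eq_mul, _root_.mul_inv_rev, ← mul_assoc, mul_inv_cancel, one_mul]
    exact H.inv_mem s.2
  ext
  simp only [this]
  simp [Subgroup.smul_def, mul_assoc]

lemma Amenable.of_mulEquiv {H : Type*} [Group H] (h : Amenable G) (e : G ≃* H) : Amenable H := by
  obtain ⟨M⟩ := h
  exact ⟨{ toFun := fun f => M.toFun fun g => f (e g)
           add' := fun f g hf hg => M.add' _ _ (hf.comp e) (hg.comp e)
           smul' := fun c f hf => M.smul' c _ (hf.comp e)
           nonneg' := fun f hf h => M.nonneg' _ (hf.comp e) fun y => h _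
           one' := M.one'
           inv' := fun s f hf => by
            have := M.inv' (e.symm s) _ (hf.comp e)
            simpa using this }⟩

/-- A group acting with an invariant mean and amenable stabilizers is amenable. -/
lemma InvMean.amenable {Y : Type*} [MulAction G Y] (M : InvMean G Y)
    (h : ∀ y : Y, Amenable (MulAction.stabilizer G y)) : Amenable G := by
  let m : ∀ y, InvMean (MulAction.stabilizer G y) (MulAction.stabilizer G y) := fun y => (h y).some
  let r : Y → Y := fun y => (Quotient.mk (MulAction.orbitRel G Y) y).out
  have hr : ∀ y, ∃ g : G, g • r y = y := fun y => by
    have := Quotient.exact (Quotient.out_eq (Quotient.mk (MulAction.orbitRel G Y) y))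
    exact MulAction.orbitRel_apply.1 ((MulAction.orbitRel G Y).symm this)
  choose t ht using hr
  have hrs : ∀ (s : G) y, r (s • y) = r y := fun s y => by
    have : Quotient.mk (MulAction.orbitRel G Y) (s • y) = Quotient.mk (MulAction.orbitRel G Y) y :=
      Quotient.sound (MulAction.orbitRel_apply.2 ⟨s, rfl⟩)
    simp only [r, this]
  let A : (G → ℝ) → Y → G → ℝ := fun f y g => (m y).toFun fun k => f (g * k)
  have hA : ∀ f, IsBdd f → ∀ y g g', g • y = g' • y → A f y g = A f y g' := by
    intro f hf y g g' hg
    let k : MulAction.stabilizer G y := ⟨g'⁻¹ * g, by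
      rw [MulAction.mem_stabilizer_iff, mul_smul, hg, inv_smul_smul]⟩
    have := (m y).inv' k _ (hf.comp fun x : MulAction.stabilizer G y => g' * (x : G))
    simp only [A]
    rw [← this]
    congr 1
    ext x
    simp [k, mul_assoc]
  have hb : ∀ f, IsBdd f → IsBdd (fun y => A f (r y) (t y)) := by
    rintro f ⟨C, hC⟩
    exact ⟨C, fun y => (m _).abs_le fun k => hC _⟩
  refine ⟨{ toFun := fun f => M.toFun fun y => A f (r y) (t y), add' := ?_, smul' := ?_,
            nonneg' := ?_, one' := ?_, inv' := ?_ }⟩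
  · intro f g hf hg
    rw [← M.add' _ _ (hb f hf) (hb g hg)]
    congr 1; ext y
    exact (m _).add' _ _ (hf.comp _) (hg.comp _)
  · intro c f hf
    rw [← M.smul' _ _ (hb f hf)]
    congr 1; ext y
    exact (m _).smul' _ _ (hf.comp _)
  · intro f hf h
    exact M.nonneg' _ (hb f hf) fun y => (m _).nonneg' _ (hf.comp _) fun _ => h _
  · simp only [A, InvMean.one']
  · intro s f hf
    rw [← M.inv' s _ (hb f hf)]
    congr 1; ext y
    have e1 : A (fun g => f (s • g)) (r y) (t y) = A f (r y) (s * t y) := by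
      simp only [A, smul_eq_mul, mul_assoc]
    rw [e1, hrs]
    apply hA f hf
    rw [mul_smul, ht]
    have := ht (s • y)
    rw [hrs] at this
    exact this.symm

/-- Almost invariant finite sets produce an invariant mean. -/
lemma exists_invMean {Y : Type*} [DecidableEq Y] [MulAction G Y]
    (h : ∀ (S : Finset G) (ε : ℝ), 0 < ε → ∃ B : Finset Y, B.Nonempty ∧
      ∀ s ∈ S, (((B.image (s • ·)) \ B).card : ℝ) ≤ ε * B.card) : Nonempty (InvMean G Y) := by
  classical
  choose! B hBne hB using h
  let b : Finset G × ℕ → Finset Y := fun i => B i.1 (1 / (i.2 + 1))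
  have hpos : ∀ i : Finset G × ℕ, (0 : ℝ) < 1 / (i.2 + 1) := fun i => by positivity
  have hbne : ∀ i, (b i).Nonempty := fun i => hBne _ _ (hpos i)
  have hcard : ∀ i, (0 : ℝ) < (b i).card := fun i => by exact_mod_cast (hbne i).card_pos
  let avg : (Y → ℝ) → Finset G × ℕ → ℝ := fun f i => (∑ y ∈ b i, f y) / (b i).card
  let U : Ultrafilter (Finset G × ℕ) := Ultrafilter.of atTop
  have hU : (U : Filter (Finset G × ℕ)) ≤ atTop := Ultrafilter.of_le _
  have havg : ∀ f C, (∀ y, |f y| ≤ C) → ∀ i, |avg f i| ≤ C := by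
    intro f C hC i
    rw [abs_div, abs_of_pos (hcard i), div_le_iff₀ (hcard i)]
    calc |∑ y ∈ b i, f y| ≤ ∑ y ∈ b i, |f y| := Finset.abs_sum_le_sum_abs _ _
      _ ≤ ∑ y ∈ b i, C := Finset.sum_le_sum fun y _ => hC y
      _ = C * (b i).card := by rw [Finset.sum_const, nsmul_eq_mul, mul_comm]
  have hlim : ∀ f, IsBdd f → Tendsto (avg f) U (𝓝 (limUnder (U : Filter _) (avg f))) := by
    rintro f ⟨C, hC⟩
    apply tendsto_nhds_limUnder
    have hc : IsCompact (Set.Icc (-C) C) := isCompact_Icc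
    obtain ⟨x, -, hx⟩ := isCompact_iff_ultrafilter_le_nhds.1 hc (U.map (avg f)) (by
      rw [le_principal_iff]
      exact Filter.mem_map.2 <| Filter.univ_mem' fun i => Set.mem_Icc.2 (abs_le.1 (havg f C hC i)))
    exact ⟨x, hx⟩
  refine ⟨{ toFun := fun f => limUnder (U : Filter _) (avg f), add' := ?_, smul' := ?_,
            nonneg' := ?_, one' := ?_, inv' := ?_ }⟩
  · intro f g hf hg
    refine tendsto_nhds_unique (hlim _ (hf.add hg)) (((hlim f hf).add (hlim g hg)).congr fun i => ?_)
    simp only [avg, Finset.sum_add_distrib, add_div]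
  · intro c f hf
    refine tendsto_nhds_unique (hlim _ (hf.const_mul c)) (((hlim f hf).const_mul c).congr fun i => ?_)
    simp only [avg, ← Finset.mul_sum, mul_div_assoc]
  · intro f hf h0
    exact ge_of_tendsto' (hlim f hf) fun i => div_nonneg (Finset.sum_nonneg fun y _ => h0 y)
      (hcard i).le
  · refine tendsto_nhds_unique (hlim _ (isBdd_const _)) (tendsto_const_nhds.congr fun i => ?_)
    have := (hcard i).ne'
    simp [avg, this]
  · intro s f hf
    obtain ⟨C, hC⟩ := id hf
    have h1 := (hlim _ (hf.comp (s • ·))).sub (hlim f hf)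
    have h2 : Tendsto (fun i : Finset G × ℕ => 2 * C * (1 / ((i.2 : ℝ) + 1))) U (𝓝 0) := by
      have : Tendsto (fun i : Finset G × ℕ => 2 * C * (1 / ((i.2 : ℝ) + 1))) atTop (𝓝 (2 * C * 0)) := by
        refine Tendsto.const_mul _ ?_
        refine tendsto_one_div_add_atTop_nhds_zero_nat.comp ?_
        rw [← prod_atTop_atTop_eq]; exact tendsto_snd
      rw [mul_zero] at this
      exact this.mono_left hU
    have h3 : Tendsto (fun i => avg (fun y => f (s • y)) i - avg f i) U (𝓝 0) := by
      refine squeeze_zero_norm' ?_ h2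
      have hev : ∀ᶠ i in (U : Filter (Finset G × ℕ)), s ∈ i.1 := by
        apply hU
        filter_upwards [eventually_ge_atTop (({s} : Finset G), 0)] with i hi
        exact hi.1 (Finset.mem_singleton_self s)
      filter_upwards [hev] with i hi
      have hB' := hB i.1 _ (hpos i) s hi
      set D := b i with hD
      have e1 : ∑ y ∈ D, f (s • y) = ∑ y ∈ D.image (s • ·), f y := by
        rw [Finset.sum_image fun x _ y _ hxy => MulAction.injective s hxy]
      have e2 : ∑ y ∈ D.image (s • ·), f y - ∑ y ∈ D, f y
          = ∑ y ∈ D.image (s • ·) \ D, f y - ∑ y ∈ D \ D.image (s • ·), f y := by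
        rw [← Finset.sum_sdiff_sub_sum_sdiff]
      have hce : (D.image (s • ·)).card = D.card :=
        Finset.card_image_of_injective _ (MulAction.injective s)
      have e3 : (D \ D.image (s • ·)).card = (D.image (s • ·) \ D).card :=
        Finset.card_sdiff_comm hce.symm
      have e4 : ∀ T : Finset Y, |∑ y ∈ T, f y| ≤ C * T.card := fun T =>
        calc |∑ y ∈ T, f y| ≤ ∑ y ∈ T, |f y| := Finset.abs_sum_le_sum_abs _ _
          _ ≤ ∑ y ∈ T, C := Finset.sum_le_sum fun y _ => hC y
          _ = C * T.card := by rw [Finset.sum_const, nsmul_eq_mul, mul_comm]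
      have hC0 : 0 ≤ C := (abs_nonneg _).trans (hC (hbne i).choose)
      simp only [avg]
      rw [← sub_div, Real.norm_eq_abs, abs_div, abs_of_pos (hcard i), div_le_iff₀ (hcard i), ← hD,
        e1, e2]
      calc _ ≤ C * (D.image (s • ·) \ D).card + C * (D \ D.image (s • ·)).card :=
            (abs_sub _ _).trans (add_le_add (e4 _) (e4 _))
        _ = 2 * C * (D.image (s • ·) \ D).card := by rw [e3]; ring
        _ ≤ 2 * C * (1 / (i.2 + 1) * D.card) := by gcongr
        _ = _ := by ring
    have h4 := tendsto_nhds_unique h1 h3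
    linarith

open scoped Classical in
/-- A nonamenable group uniformly expands finite sets of points with amenable stabilizers. -/
lemma exists_expansion {Y : Type*} [MulAction G Y] (hG : ¬ Amenable G) :
    ∃ (S : Finset G) (ε : ℝ), 0 < ε ∧ ∀ B : Finset Y, B.Nonempty →
      (∀ y ∈ B, Amenable (MulAction.stabilizer G y)) →
      ∃ s ∈ S, ε * B.card < ((B.image (s • ·)) \ B).card := by
  by_contra! hcon
  let Z : SubMulAction G Y :=
    { carrier := {y | Amenable (MulAction.stabilizer G y)}
      smul_mem' := fun g y hy => by
        refine Amenable.of_mulEquiv hy (MulAction.stabilizerEquivStabilizer (g := g) rfl) }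
  refine hG ?_
  have hZ : Nonempty (InvMean G Z) := by
    apply exists_invMean
    intro S ε hε
    obtain ⟨B, hBne, hB, hS⟩ := hcon S ε hε
    refine ⟨B.attach.image fun y => ⟨y.1, hB y.1 y.2⟩, by simpa using hBne, fun s hs => ?_⟩
    set B' : Finset Z := B.attach.image fun y => ⟨y.1, hB y.1 y.2⟩ with hB'
    have hmem : ∀ z : Z, z ∈ B' ↔ (z : Y) ∈ B := fun z => by
      rw [hB', Finset.mem_image]
      constructor
      · rintro ⟨a, -, rfl⟩; exact a.2
      · intro hz; exact ⟨⟨z, hz⟩, Finset.mem_attach _ _, rfl⟩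
    have e1 : B'.card = B.card := by
      rw [hB', Finset.card_image_of_injective, Finset.card_attach]
      intro x y hxy
      exact Subtype.ext (congrArg (fun z : Z => (z : Y)) hxy)
    have e2 : ((B'.image (s • ·)) \ B').card ≤ ((B.image (s • ·)) \ B).card := by
      apply Finset.card_le_card_of_injOn (fun z : Z => (z : Y))
      · intro z hz
        rw [Finset.mem_coe, Finset.mem_sdiff, Finset.mem_image] at hz ⊢
        obtain ⟨⟨y, hy, rfl⟩, hz⟩ := hz
        exact ⟨⟨y, (hmem y).1 hy, rfl⟩, fun h => hz ((hmem _).2 h)⟩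
      · exact fun a _ b _ hab => Subtype.ext hab
    calc (((B'.image (s • ·)) \ B').card : ℝ) ≤ ((B.image (s • ·)) \ B).card := by exact_mod_cast e2
      _ ≤ ε * B.card := hS s hs
      _ = ε * B'.card := by rw [e1]
  obtain ⟨M⟩ := hZ
  refine M.amenable fun z => ?_
  have : MulAction.stabilizer G z = MulAction.stabilizer G (z : Y) := SubMulAction.stabilizer_of_subMul z
  rw [this]
  exact z.2

end Amenability
end MixedIdentity

namespace MixedIdentity

section Mass

open Filter Topology Module

namespace InvMean
variable {G Y : Type*} [Group G] [MulAction G Y] (M : InvMean G Y)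

/-- The mass of a set under an invariant mean. -/
noncomputable def mass (S : Set Y) : ℝ := M.toFun (S.indicator fun _ => 1)

lemma isBdd_indicator (S : Set Y) : IsBdd (S.indicator fun _ => (1 : ℝ)) := by
  refine ⟨1, fun y => ?_⟩
  by_cases h : y ∈ S <;> simp [h]

lemma mass_mono {S T : Set Y} (h : S ⊆ T) : M.mass S ≤ M.mass T :=
  M.mono (isBdd_indicator S) (isBdd_indicator T)
    (Set.indicator_le_indicator_of_subset h fun _ => zero_le_one)

lemma mass_empty : M.mass ∅ = 0 := by
  simp [mass, M.const]

lemma mass_preimage (s : G) (S : Set Y) : M.mass {y | s • y ∈ S} = M.mass S :=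
  M.inv' s _ (isBdd_indicator S)

lemma mass_compl (S : Set Y) : M.mass Sᶜ = 1 - M.mass S := by
  have h := M.add' _ _ (isBdd_indicator S) (isBdd_indicator Sᶜ)
  have : (fun y => S.indicator (fun _ => (1 : ℝ)) y + Sᶜ.indicator (fun _ => 1) y)
      = fun _ => 1 := by
    ext y
    by_cases hy : y ∈ S <;> simp [hy]
  rw [this, M.one'] at h
  simp only [mass]
  linarith

lemma isBdd_sum {ι : Type*} (s : Finset ι) (f : ι → Y → ℝ) (hf : ∀ i, IsBdd (f i)) :
    IsBdd (fun y => ∑ i ∈ s, f i y) := by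
  classical
  induction s using Finset.induction_on with
  | empty => simpa using isBdd_const 0
  | insert i s hi ih =>
    simp only [Finset.sum_insert hi]
    exact (hf i).add ih

lemma toFun_sum {ι : Type*} (s : Finset ι) (f : ι → Y → ℝ) (hf : ∀ i, IsBdd (f i)) :
    M.toFun (fun y => ∑ i ∈ s, f i y) = ∑ i ∈ s, M.toFun (f i) := by
  classical
  induction s using Finset.induction_on with
  | empty => simpa using M.const 0
  | insert i s hi ih =>
    simp only [Finset.sum_insert hi]
    rw [M.add' _ _ (hf i) (isBdd_sum s f hf), ih]

/-- A second moment bound for almost disjoint sets of large mass. -/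
lemma card_mul_le {ι : Type*} (s : Finset ι) (A : ι → Set Y) {c δ : ℝ}
    (hδ : 0 ≤ δ) (hA : ∀ i ∈ s, c ≤ M.mass (A i))
    (hAA : ∀ i ∈ s, ∀ j ∈ s, i ≠ j → M.mass (A i ∩ A j) ≤ δ) :
    s.card * c ≤ 1 + s.card ^ 2 * δ := by
  classical
  let f : ι → Y → ℝ := fun i => (A i).indicator fun _ => 1
  have hf : ∀ i, IsBdd (f i) := fun i => isBdd_indicator _
  let g : ι → ι → Y → ℝ := fun i j => (A i ∩ A j).indicator fun _ => 1
  have hg : ∀ i j, IsBdd (g i j) := fun i j => isBdd_indicator _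
  have hfg : ∀ i j y, f i y * f j y = g i j y := fun i j y => by
    simp only [f, g]
    by_cases h1 : y ∈ A i <;> by_cases h2 : y ∈ A j <;> simp [h1, h2]
  have hgs : IsBdd fun y => ∑ i ∈ s, ∑ j ∈ s, g i j y :=
    isBdd_sum s _ fun i => isBdd_sum s _ fun j => hg i j
  have hfs := isBdd_sum s f hf
  have key : M.toFun (fun y => 2 * ∑ i ∈ s, f i y) ≤
      M.toFun (fun y => 1 + ∑ i ∈ s, ∑ j ∈ s, g i j y) := by
    refine M.mono (hfs.const_mul 2) ((isBdd_const 1).add hgs) fun y => ?_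
    have : ∑ i ∈ s, ∑ j ∈ s, g i j y = (∑ i ∈ s, f i y) ^ 2 := by
      rw [sq, Finset.sum_mul_sum]
      simp only [hfg]
    rw [this]
    nlinarith [sq_nonneg ((∑ i ∈ s, f i y) - 1)]
  rw [M.smul' _ _ hfs, M.toFun_sum s f hf, M.add' _ _ (isBdd_const 1) hgs, M.one',
    M.toFun_sum s _ (fun i => isBdd_sum s _ fun j => hg i j)] at key
  have e1 : ∀ i ∈ s, M.toFun (fun y => ∑ j ∈ s, g i j y) ≤ M.toFun (f i) + s.card * δ := by
    intro i hi
    rw [M.toFun_sum s _ (hg i), ← Finset.add_sum_erase s _ hi]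
    have : g i i = f i := by simp only [f, g, Set.inter_self]
    rw [this]
    have : ∑ j ∈ s.erase i, M.toFun (g i j) ≤ ∑ j ∈ s.erase i, δ :=
      Finset.sum_le_sum fun j hj => hAA i hi j (Finset.mem_of_mem_erase hj)
        (Finset.ne_of_mem_erase hj).symm
    rw [Finset.sum_const, nsmul_eq_mul] at this
    have h2 : ((s.erase i).card : ℝ) * δ ≤ s.card * δ := by
      gcongr
      exact Finset.erase_subset _ _
    linarith
  have e2 := Finset.sum_le_sum e1
  rw [Finset.sum_add_distrib, Finset.sum_const, nsmul_eq_mul] at e2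
  have e3 : (s.card : ℝ) * c ≤ ∑ i ∈ s, M.toFun (f i) := by
    rw [← nsmul_eq_mul, ← Finset.sum_const]
    exact Finset.sum_le_sum hA
  nlinarith

end InvMean

end Mass

end MixedIdentity

namespace MixedIdentity

section Heavy

open Filter Topology Module

variable {K V : Type*} [Field K] [AddCommGroup V] [Module K V] [FiniteDimensional K V]

/-- The `ℓ¹` norm of coordinates with respect to an absolute value. -/
noncomputable def coordNorm (v : AbsoluteValue K ℝ) (x : V) : ℝ :=
  ∑ i, v ((finBasis K V).repr x i)

variable (v : AbsoluteValue K ℝ)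

lemma coordNorm_nonneg (x : V) : 0 ≤ coordNorm v x := Finset.sum_nonneg fun _ _ => v.nonneg _

lemma exists_functional_bound (φ : Dual K V) :
    ∃ C, 0 < C ∧ ∀ x, v (φ x) ≤ C * coordNorm v x := by
  refine ⟨∑ i, v (φ (finBasis K V i)) + 1,
    add_pos_of_nonneg_of_pos (Finset.sum_nonneg fun _ _ => v.nonneg _) one_pos, fun x => ?_⟩
  have hx : φ x = ∑ i, (finBasis K V).repr x i * φ (finBasis K V i) := by
    conv_lhs => rw [← (finBasis K V).sum_repr x]
    rw [map_sum]
    simp only [map_smul, smul_eq_mul]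
  rw [hx]
  calc v (∑ i, (finBasis K V).repr x i * φ (finBasis K V i))
      ≤ ∑ i, v ((finBasis K V).repr x i * φ (finBasis K V i)) := v.sum_le _ _
    _ ≤ ∑ i, v ((finBasis K V).repr x i) * ((∑ i, v (φ (finBasis K V i))) + 1) := by
        refine Finset.sum_le_sum fun i _ => ?_
        rw [map_mul]
        refine mul_le_mul_of_nonneg_left ?_ (v.nonneg _)
        have := Finset.single_le_sum (f := fun i => v (φ (finBasis K V i)))
          (fun i _ => v.nonneg _) (Finset.mem_univ i)
        linarith
    _ = _ := by rw [← Finset.sum_mul, mul_comm]; rfl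

lemma exists_operator_bound (T : V →ₗ[K] V) :
    ∃ C, 0 < C ∧ ∀ x, coordNorm v (T x) ≤ C * coordNorm v x := by
  choose C hC hCb using fun i => exists_functional_bound v (((finBasis K V).coord i) ∘ₗ T)
  refine ⟨∑ i, C i + 1, add_pos_of_nonneg_of_pos (Finset.sum_nonneg fun i _ => (hC i).le) one_pos,
    fun x => ?_⟩
  have : coordNorm v (T x) ≤ ∑ i, C i * coordNorm v x := Finset.sum_le_sum fun i _ => hCb i x
  rw [← Finset.sum_mul] at this
  nlinarith [coordNorm_nonneg v x]

variable {G : Type*} [Group G] (M : InvMean G G) (ρ : Representation K G V) (x₀ : V)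

/-- The group elements moving `x₀` to a vector that is almost killed by the functionals in `Φ`. -/
def nearKernel (Φ : Finset (Dual K V)) (ε : ℝ) : Set G :=
  {g | ∀ φ ∈ Φ, v (φ (ρ g x₀)) ≤ ε * coordNorm v (ρ g x₀)}

lemma nearKernel_mono {Φ Ψ : Finset (Dual K V)} {ε δ : ℝ} (h : Φ ⊆ Ψ) (hε : ε ≤ δ) :
    nearKernel v ρ x₀ Ψ ε ⊆ nearKernel v ρ x₀ Φ δ := fun _ hg φ hφ =>
  (hg φ (h hφ)).trans (mul_le_mul_of_nonneg_right hε (coordNorm_nonneg v _))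

/-- A space of functionals is heavy if orbit points lie close to its kernel with mass at least
`c`. -/
def Heavy (D : Submodule K (Dual K V)) (c : ℝ) : Prop :=
  ∀ (Φ : Finset (Dual K V)) (ε : ℝ), (∀ φ ∈ Φ, φ ∈ D) → 0 < ε →
    c ≤ M.mass (nearKernel v ρ x₀ Φ ε)

variable {v M ρ x₀}

lemma Heavy.map {D : Submodule K (Dual K V)} {c : ℝ} (h : Heavy v M ρ x₀ D c) (s : G) :
    Heavy v M ρ x₀ (D.map (ρ s).dualMap) c := by
  classical
  intro Φ ε hΦ hε
  obtain ⟨C, hC, hCb⟩ := exists_operator_bound v (ρ s)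
  have hinv : ∀ x, ρ s⁻¹ (ρ s x) = x := fun x => by
    rw [← Module.End.mul_apply, ← map_mul]; simp
  have hinv' : ∀ x, ρ s (ρ s⁻¹ x) = x := fun x => by
    rw [← Module.End.mul_apply, ← map_mul]; simp
  have := h (Φ.image (ρ s⁻¹).dualMap) (ε / C) (by
    intro φ hφ
    obtain ⟨ψ, hψ, rfl⟩ := Finset.mem_image.1 hφ
    obtain ⟨χ, hχ, rfl⟩ := hΦ ψ hψ
    have : (ρ s⁻¹).dualMap ((ρ s).dualMap χ) = χ := by
      ext x
      simp [hinv']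
    rw [this]
    exact hχ) (by positivity)
  refine this.trans ?_
  rw [← M.mass_preimage s]
  refine M.mass_mono fun g hg φ hφ => ?_
  have h1 := hg _ (Finset.mem_image_of_mem _ hφ)
  have h2 : ρ (s • g) x₀ = ρ s (ρ g x₀) := by
    rw [smul_eq_mul, map_mul, Module.End.mul_apply]
  rw [LinearMap.dualMap_apply, h2, hinv] at h1
  refine h1.trans ?_
  rw [div_mul_eq_mul_div, div_le_iff₀ hC, mul_assoc, mul_comm _ C]
  exact mul_le_mul_of_nonneg_left (hCb _) hε.le

/-- The whole dual space is not heavy. -/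
lemma not_heavy_top (hx₀ : x₀ ≠ 0) {c : ℝ} (hc : 0 < c) : ¬ Heavy v M ρ x₀ ⊤ c := by
  classical
  intro h
  set n := finrank K V
  have h1 := h (Finset.univ.image (finBasis K V).coord) (1 / (2 * (n + 1)))
    (fun _ _ => Submodule.mem_top) (by positivity)
  have h2 : nearKernel v ρ x₀ (Finset.univ.image (finBasis K V).coord) (1 / (2 * (n + 1))) ⊆
      (∅ : Set G) := by
    intro g hg
    set x := ρ g x₀ with hx
    have h3 : coordNorm v x ≤ ∑ i : Fin n, 1 / (2 * ((n : ℝ) + 1)) * coordNorm v x :=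
      Finset.sum_le_sum fun i _ => hg _ (Finset.mem_image_of_mem _ (Finset.mem_univ i))
    rw [Finset.sum_const, Finset.card_univ, Fintype.card_fin, nsmul_eq_mul, ← mul_assoc] at h3
    have h4 : (n : ℝ) * (1 / (2 * (n + 1))) ≤ 1 / 2 := by
      rw [mul_one_div, div_le_div_iff₀ (by positivity) (by norm_num)]
      linarith
    have h5 : coordNorm v x = 0 := by
      have := coordNorm_nonneg v x
      nlinarith
    have h6 : x = 0 := by
      rw [← (finBasis K V).forall_coord_eq_zero_iff]
      intro i
      have := (Finset.sum_eq_zero_iff_of_nonneg (fun i _ => v.nonneg _)).1 h5 i (Finset.mem_univ i)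
      exact (v.eq_zero).1 this
    refine hx₀ ?_
    have h7 : ρ g⁻¹ x = x₀ := by
      rw [hx, ← Module.End.mul_apply, ← map_mul]; simp
    rw [← h7, h6, map_zero]
  have := h1.trans (M.mass_mono h2)
  rw [M.mass_empty] at this
  linarith

lemma not_heavy_sup {D₁ D₂ : Submodule K (Dual K V)} {c : ℝ} (h : ¬ Heavy v M ρ x₀ (D₁ ⊔ D₂) c) :
    ∃ (Φ₁ Φ₂ : Finset (Dual K V)) (ε : ℝ), 0 < ε ∧ (∀ φ ∈ Φ₁, φ ∈ D₁) ∧ (∀ φ ∈ Φ₂, φ ∈ D₂) ∧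
      M.mass (nearKernel v ρ x₀ Φ₁ ε ∩ nearKernel v ρ x₀ Φ₂ ε) ≤ c := by
  classical
  simp only [Heavy] at h
  push Not at h
  obtain ⟨Φ, ε, hΦ, hε, hlt⟩ := h
  choose! a ha b hb hab using fun φ hφ => Submodule.mem_sup.1 (hΦ φ hφ)
  refine ⟨Φ.image a, Φ.image b, ε / 2, by positivity, ?_, ?_, (M.mass_mono ?_).trans hlt.le⟩
  · intro φ hφ
    obtain ⟨ψ, hψ, rfl⟩ := Finset.mem_image.1 hφ
    exact ha ψ hψ
  · intro φ hφ
    obtain ⟨ψ, hψ, rfl⟩ := Finset.mem_image.1 hφ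
    exact hb ψ hψ
  · rintro g ⟨h1, h2⟩ φ hφ
    have e1 := h1 _ (Finset.mem_image_of_mem _ hφ)
    have e2 := h2 _ (Finset.mem_image_of_mem _ hφ)
    rw [← hab φ hφ, LinearMap.add_apply]
    refine (v.add_le _ _).trans ?_
    linarith

end Heavy

end MixedIdentity

namespace MixedIdentity

section Irreducible

open Filter Topology Module

variable {K V : Type*} [Field K] [AddCommGroup V] [Module K V] [FiniteDimensional K V]
  {v : AbsoluteValue K ℝ} {G : Type*} [Group G] {M : InvMean G G} {ρ : Representation K G V}
  {x₀ : V}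

lemma card_heavy_mul_le {r : ℕ} {c : ℝ}
    (hmax : ∀ D' c', 0 < c' → Heavy v M ρ x₀ D' c' → finrank K D' ≤ r)
    (T : Finset (Submodule K (Dual K V))) (hT : ∀ D ∈ T, Heavy v M ρ x₀ D c ∧ finrank K D = r) :
    T.card * c ≤ 1 := by
  classical
  suffices h : ∀ δ : ℝ, 0 < δ → T.card * c ≤ 1 + T.card ^ 2 * δ by
    refine le_of_forall_pos_le_add fun η hη => ?_
    refine (h (η / (T.card ^ 2 + 1)) (by positivity)).trans ?_
    gcongr
    rw [mul_div_assoc', div_le_iff₀ (by positivity)]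
    nlinarith
  intro δ hδ
  have hpair : ∀ p : Submodule K (Dual K V) × Submodule K (Dual K V), p.1 ∈ T → p.2 ∈ T →
      p.1 ≠ p.2 → ¬ Heavy v M ρ x₀ (p.1 ⊔ p.2) δ := by
    intro p h1 h2 hne hheavy
    have h3 := hmax _ _ hδ hheavy
    have h4 : p.1 = p.1 ⊔ p.2 := Submodule.eq_of_le_of_finrank_le le_sup_left (by
      rw [(hT _ h1).2]; exact h3)
    have h5 : p.2 = p.1 ⊔ p.2 := Submodule.eq_of_le_of_finrank_le le_sup_right (by
      rw [(hT _ h2).2]; exact h3)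
    exact hne (h4.trans h5.symm)
  have hex : ∀ p : Submodule K (Dual K V) × Submodule K (Dual K V), ∃ (Φ₁ Φ₂ : Finset (Dual K V))
      (ε : ℝ), 0 < ε ∧ (∀ φ ∈ Φ₁, φ ∈ p.1) ∧ (∀ φ ∈ Φ₂, φ ∈ p.2) ∧ (p.1 ∈ T → p.2 ∈ T → p.1 ≠ p.2 →
      M.mass (nearKernel v ρ x₀ Φ₁ ε ∩ nearKernel v ρ x₀ Φ₂ ε) ≤ δ) := by
    intro p
    by_cases h : p.1 ∈ T ∧ p.2 ∈ T ∧ p.1 ≠ p.2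
    · obtain ⟨Φ₁, Φ₂, ε, hε, h1, h2, h3⟩ := not_heavy_sup (hpair p h.1 h.2.1 h.2.2)
      exact ⟨Φ₁, Φ₂, ε, hε, h1, h2, fun _ _ _ => h3⟩
    · exact ⟨∅, ∅, 1, one_pos, by simp, by simp, fun h1 h2 h3 => absurd ⟨h1, h2, h3⟩ h⟩
  choose Φ₁ Φ₂ ε hε h1 h2 h3 using hex
  obtain ⟨η, hη, hη0⟩ : ∃ η, (∀ p ∈ T ×ˢ T, η ≤ ε p) ∧ 0 < η := by
    have : ∀ᶠ η in 𝓝[>] (0 : ℝ), ∀ p ∈ T ×ˢ T, η ≤ ε p := by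
      rw [eventually_all_finset]
      intro p hp
      exact mem_nhdsWithin_of_mem_nhds (Iic_mem_nhds (hε p))
    exact (this.and self_mem_nhdsWithin).exists
  let Φ : Submodule K (Dual K V) → Finset (Dual K V) := fun D =>
    T.biUnion fun D' => Φ₁ (D, D') ∪ Φ₂ (D', D)
  refine M.card_mul_le T (fun D => nearKernel v ρ x₀ (Φ D) η) hδ.le ?_ ?_
  · intro D hD
    refine (hT D hD).1 _ _ ?_ hη0
    intro φ hφ
    obtain ⟨D', -, hφ⟩ := Finset.mem_biUnion.1 hφ
    rcases Finset.mem_union.1 hφ with hφ | hφ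
    · exact h1 _ _ hφ
    · exact h2 _ _ hφ
  · intro D hD D' hD' hne
    refine (M.mass_mono ?_).trans (h3 (D, D') hD hD' hne)
    have hle := hη (D, D') (Finset.mk_mem_product hD hD')
    refine Set.inter_subset_inter (nearKernel_mono v ρ x₀ ?_ hle) (nearKernel_mono v ρ x₀ ?_ hle)
    · exact Finset.subset_union_left.trans (Finset.subset_biUnion_of_mem
        (fun D' => Φ₁ (D, D') ∪ Φ₂ (D', D)) hD')
    · exact Finset.subset_union_right.trans (Finset.subset_biUnion_of_mem
        (fun D => Φ₁ (D', D) ∪ Φ₂ (D, D')) hD)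

/-- The representation on the dual space has no proper nonzero subspace invariant under a finite
index subgroup. -/
def DualStronglyIrreducible (ρ : Representation K G V) : Prop :=
  ∀ H : Subgroup G, H.FiniteIndex → ∀ D : Submodule K (Dual K V),
    (∀ h ∈ H, D.map (ρ h).dualMap ≤ D) → D = ⊥ ∨ D = ⊤

lemma not_heavy (hρ : DualStronglyIrreducible ρ) (hx₀ : x₀ ≠ 0) {D : Submodule K (Dual K V)}
    (hD : D ≠ ⊥) {c : ℝ} (hc : 0 < c) : ¬ Heavy v M ρ x₀ D c := by
  classical
  intro hheavy
  let R : Set ℕ := {r | ∃ D c, 0 < c ∧ Heavy v M ρ x₀ D c ∧ finrank K D = r}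
  have hRb : BddAbove R := ⟨finrank K (Dual K V), by
    rintro _ ⟨D, c, -, -, rfl⟩
    exact Submodule.finrank_le D⟩
  have hRne : R.Nonempty := ⟨_, D, c, hc, hheavy, rfl⟩
  have hmaxr : ∀ D' c', 0 < c' → Heavy v M ρ x₀ D' c' → finrank K D' ≤ sSup R :=
    fun D' c' h1 h2 => le_csSup hRb ⟨D', c', h1, h2, rfl⟩
  obtain ⟨D₁, c₁, hc₁, hD₁, hr⟩ := Nat.sSup_mem hRne hRb
  have hD₁ne : D₁ ≠ ⊥ := by
    rintro rfl
    rw [finrank_bot] at hr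
    have := hmaxr D c hc hheavy
    rw [← hr, Nat.le_zero, Submodule.finrank_eq_zero] at this
    exact hD this
  let act : MulAction G (Submodule K (Dual K V)) :=
    { smul := fun g D => D.map (ρ g⁻¹).dualMap
      one_smul := fun D => by
        change D.map (ρ 1⁻¹).dualMap = D
        rw [inv_one, map_one, Module.End.one_eq_id, LinearMap.dualMap_id, Submodule.map_id]
      mul_smul := fun g h D => by
        change D.map (ρ (g * h)⁻¹).dualMap = (D.map (ρ h⁻¹).dualMap).map (ρ g⁻¹).dualMap
        rw [← Submodule.map_comp, LinearMap.dualMap_comp_dualMap, _root_.mul_inv_rev, map_mul]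
        rfl }
  have hsm : ∀ (g : G) (D : Submodule K (Dual K V)), g • D = D.map (ρ g⁻¹).dualMap :=
    fun _ _ => rfl
  have hrank : ∀ (g : G) (D : Submodule K (Dual K V)), finrank K ↥(g • D) ≤ finrank K D :=
    fun g D => Submodule.finrank_map_le _ _
  have hfin : (MulAction.orbit G D₁).Finite := by
    by_contra hinf
    obtain ⟨N, hN⟩ := exists_nat_gt (1 / c₁)
    obtain ⟨T, hT, hTc⟩ := Set.Infinite.exists_subset_card_eq hinf N
    have := card_heavy_mul_le (c := c₁) hmaxr T (by
      intro D hD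
      obtain ⟨g, rfl⟩ := hT hD
      refine ⟨hD₁.map _, le_antisymm (hmaxr _ _ hc₁ (hD₁.map _)) ?_⟩
      rw [← hr]
      have := hrank g⁻¹ (g • D₁)
      rwa [inv_smul_smul] at this)
    rw [hTc] at this
    rw [div_lt_iff₀ hc₁] at hN
    linarith
  have : Finite (MulAction.orbit G D₁) := hfin
  have hfi : (MulAction.stabilizer G D₁).FiniteIndex := by
    have : Finite (G ⧸ MulAction.stabilizer G D₁) :=
      Finite.of_equiv _ (MulAction.orbitEquivQuotientStabilizer G D₁)
    exact Subgroup.finiteIndex_of_finite_quotient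
  rcases hρ _ hfi D₁ (fun h hh => by
    have h1 : h⁻¹ • D₁ = D₁ := (MulAction.stabilizer G D₁).inv_mem hh
    rw [hsm, inv_inv] at h1
    exact h1.le) with h | h
  · exact hD₁ne h
  · rw [h] at hD₁
    exact not_heavy_top hx₀ hc₁ hD₁

/-- In a dual strongly irreducible representation of an amenable group, the eigenvalues of each
operator all have the same absolute value. -/
theorem eigenvalue_abs_le (hG : Amenable G) (hρ : DualStronglyIrreducible ρ)
    (v : AbsoluteValue K ℝ) (h : G) {φ ψ : Dual K V} (hφ : φ ≠ 0) (hψ : ψ ≠ 0) {a b : K}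
    (ha : φ ∘ₗ ρ h = a • φ) (hb : ψ ∘ₗ ρ h = b • ψ) : v b ≤ v a := by
  classical
  by_contra! hab
  obtain ⟨M⟩ := hG
  obtain ⟨x₀, hx₀⟩ : ∃ x₀ : V, x₀ ≠ 0 := by
    by_contra! h0
    exact hφ (by ext x; simp [h0 x])
  have hspan : ∀ {χ : Dual K V}, χ ≠ 0 → ∃ ε, 0 < ε ∧
      M.mass (nearKernel v ρ x₀ {χ} ε) < 1 / 2 := by
    intro χ hχ
    have := not_heavy (M := M) (v := v) hρ hx₀ (D := Submodule.span K {χ})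
      (by simpa using hχ) (c := 1 / 2) (by norm_num)
    simp only [Heavy] at this
    push Not at this
    obtain ⟨Φ, ε, hΦ, hε, hlt⟩ := this
    choose! t ht using fun θ hθ => Submodule.mem_span_singleton.1 (hΦ θ hθ)
    have hpos : 0 < ∑ θ ∈ Φ, v (t θ) + 1 :=
      add_pos_of_nonneg_of_pos (Finset.sum_nonneg fun _ _ => v.nonneg _) one_pos
    refine ⟨ε / (∑ θ ∈ Φ, v (t θ) + 1), by positivity, (M.mass_mono ?_).trans_lt hlt⟩
    intro g hg θ hθ
    have h1 := hg χ (Finset.mem_singleton_self χ)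
    rw [← ht θ hθ, LinearMap.smul_apply, smul_eq_mul, map_mul]
    rw [div_mul_eq_mul_div, le_div_iff₀ hpos] at h1
    refine le_trans ?_ h1
    rw [mul_comm]
    refine mul_le_mul_of_nonneg_left ?_ (v.nonneg _)
    have := Finset.single_le_sum (f := fun θ => v (t θ)) (fun i _ => v.nonneg _) hθ
    linarith
  obtain ⟨ε₁, hε₁, h1⟩ := hspan hφ
  obtain ⟨ε₂, hε₂, h2⟩ := hspan hψ
  obtain ⟨C₁, hC₁, hC₁b⟩ := exists_functional_bound v φ
  obtain ⟨C₂, hC₂, hC₂b⟩ := exists_functional_bound v ψ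
  have hpow : ∀ (χ : Dual K V) (z : K), χ ∘ₗ ρ h = z • χ → ∀ (n : ℕ) x,
      χ (ρ (h ^ n) x) = z ^ n * χ x := by
    intro χ z hz n
    induction n with
    | zero => simp
    | succ n ih =>
      intro x
      have := LinearMap.congr_fun hz x
      simp only [LinearMap.comp_apply, LinearMap.smul_apply, smul_eq_mul] at this
      rw [pow_succ, map_mul, Module.End.mul_apply, ih, this]
      ring
  have hvb : 0 < v b := (v.nonneg a).trans_lt hab
  have hr : v a / v b < 1 := (div_lt_one hvb).2 hab
  have hr0 : 0 ≤ v a / v b := div_nonneg (v.nonneg _) hvb.le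
  obtain ⟨n, hn⟩ : ∃ n : ℕ, (v a / v b) ^ n < ε₁ * ε₂ / (C₁ * C₂) :=
    exists_pow_lt_of_lt_one (by positivity) hr
  have hsub : (nearKernel v ρ x₀ {ψ} ε₂)ᶜ ⊆ {g : G | h ^ n • g ∈ nearKernel v ρ x₀ {φ} ε₁} := by
    intro g hg
    have hg' : ε₂ * coordNorm v (ρ g x₀) < v (ψ (ρ g x₀)) := by
      simpa [nearKernel] using hg
    intro χ hχ
    obtain rfl := Finset.mem_singleton.1 hχ
    rw [smul_eq_mul, map_mul, Module.End.mul_apply, hpow _ _ ha, map_mul, map_pow]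
    set x := ρ g x₀
    have e2 := hC₂b (ρ (h ^ n) x)
    rw [hpow _ _ hb, map_mul, map_pow] at e2
    set y := coordNorm v (ρ (h ^ n) x)
    have e1 := hC₁b x
    have hvbn : 0 < v b ^ n := pow_pos hvb n
    rw [div_pow, div_lt_div_iff₀ hvbn (by positivity)] at hn
    have hx0 := coordNorm_nonneg v x
    have hy0 : 0 ≤ y := coordNorm_nonneg v _
    have han : 0 ≤ v a ^ n := pow_nonneg (v.nonneg _) n
    have k1 : v b ^ n * (ε₂ * coordNorm v x) ≤ C₂ * y :=
      (mul_le_mul_of_nonneg_left hg'.le hvbn.le).trans e2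
    have k2 : v a ^ n * v (χ x) * (C₂ * ε₂ * v b ^ n) ≤ ε₁ * y * (C₂ * ε₂ * v b ^ n) := by
      calc v a ^ n * v (χ x) * (C₂ * ε₂ * v b ^ n)
          ≤ v a ^ n * (C₁ * coordNorm v x) * (C₂ * ε₂ * v b ^ n) := by gcongr
        _ = (v a ^ n * (C₁ * C₂)) * (v b ^ n * (ε₂ * coordNorm v x)) := by ring
        _ ≤ (ε₁ * ε₂ * v b ^ n) * (C₂ * y) := by gcongr
        _ = _ := by ring
    exact le_of_mul_le_mul_right k2 (by positivity)
  have h3 := M.mass_mono hsub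
  rw [M.mass_preimage, M.mass_compl] at h3
  linarith

end Irreducible

end MixedIdentity

namespace MixedIdentity

section MinimalRepresentation

open Module

/-- The elements acting by operators commuting with everything. -/
def scalarKer {K G V : Type*} [Field K] [Group G] [AddCommGroup V] [Module K V]
    (ρ : Representation K G V) : Subgroup G where
  carrier := {g | ∀ T : Module.End K V, ρ g * T = T * ρ g}
  one_mem' := fun T => by simp
  mul_mem' := fun {a b} ha hb T => by
    rw [map_mul, mul_assoc, hb T, ← mul_assoc, ha T, mul_assoc]
  inv_mem' := fun {a} ha T => by
    have h1 : ρ a⁻¹ * ρ a = 1 := by rw [← map_mul]; simp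
    have h2 : ρ a * ρ a⁻¹ = 1 := by rw [← map_mul]; simp
    calc ρ a⁻¹ * T = ρ a⁻¹ * (T * ρ a) * ρ a⁻¹ := by
          rw [mul_assoc, mul_assoc, h2, mul_one]
      _ = T * ρ a⁻¹ := by rw [← ha T, ← mul_assoc, h1, one_mul]

section
variable {K G V : Type*} [Field K] [Group G] [AddCommGroup V] [Module K V]
    {ρ : Representation K G V}

instance scalarKer_normal : (scalarKer ρ).Normal where
  conj_mem := fun a ha g T => by
    have : ρ (g * a * g⁻¹) = ρ a := by
      rw [map_mul, map_mul, ← ha, mul_assoc, ← map_mul ρ g, mul_inv_cancel, map_one, mul_one]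
    rw [this]
    exact ha T

lemma mem_scalarKer_of_map_eq_smul {g : G} {c : K} (h : ρ g = c • 1) : g ∈ scalarKer ρ :=
  fun T => by rw [h]; simp

lemma map_commutator_eq_one {a b : G} (ha : a ∈ scalarKer ρ) : ρ (a * b * a⁻¹ * b⁻¹) = 1 := by
  rw [map_mul, map_mul, map_mul, ha (ρ b), mul_assoc, mul_assoc, ← mul_assoc (ρ a), ← map_mul ρ a,
    mul_inv_cancel, map_one, one_mul, ← map_mul, mul_inv_cancel, map_one]

lemma scalarKer_dual [FiniteDimensional K V] (h : scalarKer ρ = ⊥) :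
    scalarKer ρ.dual = ⊥ := by
  rw [eq_bot_iff, ← h]
  intro g hg
  rw [← inv_mem_iff]
  intro T
  have h1 := hg (T.dualMap)
  have h2 : (T ∘ₗ ρ g⁻¹).dualMap = (ρ g⁻¹ ∘ₗ T).dualMap := by
    rw [← LinearMap.dualMap_comp_dualMap, ← LinearMap.dualMap_comp_dualMap]
    exact h1
  refine LinearMap.ext fun x => sub_eq_zero.1 <|
    (forall_dual_apply_eq_zero_iff K _).1 fun φ => ?_
  rw [map_sub, sub_eq_zero]
  exact (LinearMap.congr_fun (LinearMap.congr_fun h2 φ) x).symm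
end

variable {Γ : Type} [Group Γ]

lemma IsMIF.exists_conj_not_commute_of_finiteIndex (hΓ : IsMIF Γ) {G : Type*} [Group G]
    {ι : G →* Γ} (hι : Function.Injective ι) (hfi : ι.range.FiniteIndex) {a b : G} (ha : a ≠ 1)
    (hb : b ≠ 1) : ∃ γ : G, ¬ Commute (γ * a * γ⁻¹) b := by
  obtain ⟨γ, hγ⟩ := hΓ.exists_conj_not_commute (Nat.factorial_ne_zero ι.range.index)
    (a := ι a) (b := ι b) (by rwa [Ne, map_eq_one_iff ι hι]) (by rwa [Ne, map_eq_one_iff ι hι])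
  obtain ⟨n, hn0, hn, hmem⟩ := Subgroup.exists_pow_mem_of_index_ne_zero hfi.index_ne_zero γ
  obtain ⟨k, hk⟩ := Nat.dvd_factorial hn0 hn
  have : γ ^ ι.range.index.factorial ∈ ι.range := by
    rw [hk, pow_mul]
    exact Subgroup.pow_mem _ hmem k
  obtain ⟨g, hg⟩ := this
  refine ⟨g, fun h => hγ ?_⟩
  rw [← hg, ← map_inv, ← map_mul, ← map_mul]
  exact h.map ι

/-- The group `Γ` has a finite index subgroup with a representation of dimension `n` in which
only the identity acts by a scalar. -/
def HasRep (Γ : Type) [Group Γ] (n : ℕ) : Prop :=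
  ∃ (G : Type) (_ : Group G) (ι : G →* Γ) (V : Type) (_ : AddCommGroup V) (_ : Module ℂ V)
    (_ : FiniteDimensional ℂ V) (ρ : Representation ℂ G V),
    Function.Injective ι ∧ ι.range.FiniteIndex ∧ scalarKer ρ = ⊥ ∧ finrank ℂ V = n

/-- A representation of minimal dimension is strongly irreducible. -/
lemma stronglyIrreducible_of_minimal (hΓ : IsMIF Γ) {n : ℕ} (hmin : ∀ k < n, ¬ HasRep Γ k)
    {G : Type} [Group G] {ι : G →* Γ} {V : Type} [AddCommGroup V] [Module ℂ V]
    [FiniteDimensional ℂ V] {ρ : Representation ℂ G V} (hι : Function.Injective ι)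
    (hfi : ι.range.FiniteIndex) (hρ : scalarKer ρ = ⊥) (hn : finrank ℂ V = n)
    (H : Subgroup G) (hH : H.FiniteIndex) (U : Submodule ℂ V)
    (hU : ∀ h ∈ H, ∀ u ∈ U, ρ h u ∈ U) : U = ⊥ ∨ U = ⊤ := by
  by_contra! hcon
  let κ : H →* Γ := ι.comp H.subtype
  have hκ : Function.Injective κ := hι.comp Subtype.val_injective
  have hκfi : κ.range.FiniteIndex := by
    constructor
    rw [MonoidHom.range_comp, Subgroup.range_subtype, Subgroup.index_map,
      (MonoidHom.ker_eq_bot_iff ι).2 hι, sup_bot_eq]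
    exact mul_ne_zero hH.index_ne_zero hfi.index_ne_zero
  let ρ₁ : Representation ℂ H U :=
    { toFun := fun h => (ρ h).restrict (hU h h.2)
      map_one' := by ext; simp
      map_mul' := fun a b => by ext; simp }
  let ρ₂ : Representation ℂ H (V ⧸ U) :=
    { toFun := fun h => U.mapQ U (ρ h) (hU h h.2)
      map_one' := by ext; simp
      map_mul' := fun a b => by ext; simp }
  have h1 : scalarKer ρ₁ ≠ ⊥ := fun h => hmin (finrank ℂ U)
    (hn ▸ Submodule.finrank_lt hcon.2) ⟨H, _, κ, U, _, _, inferInstance, ρ₁, hκ, hκfi, h, rfl⟩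
  have h2 : scalarKer ρ₂ ≠ ⊥ := fun h => hmin (finrank ℂ (V ⧸ U))
    (by
      have := Submodule.finrank_quotient_add_finrank U
      have h3 : 0 < finrank ℂ U := Nat.pos_of_ne_zero fun h0 =>
        hcon.1 (Submodule.finrank_eq_zero.1 h0)
      omega) ⟨H, _, κ, V ⧸ U, _, _, inferInstance, ρ₂, hκ, hκfi, h, rfl⟩
  obtain ⟨a, ha, ha1⟩ := (Subgroup.bot_or_exists_ne_one _).resolve_left h1
  obtain ⟨b, hb, hb1⟩ := (Subgroup.bot_or_exists_ne_one _).resolve_left h2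
  have hcomm : ∀ x y : H, x * y * x⁻¹ * y⁻¹ = 1 → Commute x y := fun x y h => by
    rwa [mul_inv_eq_one, mul_inv_eq_iff_eq_mul] at h
  obtain ⟨γ, hγ⟩ := hΓ.exists_conj_not_commute_of_finiteIndex hκ hκfi ha1 hb1
  obtain ⟨c, hc⟩ : ∃ c : H, c = (γ * a * γ⁻¹) * b * (γ * a * γ⁻¹)⁻¹ * b⁻¹ := ⟨_, rfl⟩
  have hc1 : c ≠ 1 := fun h => hγ (hcomm _ _ (hc ▸ h))
  have hcZ₁ : c ∈ scalarKer ρ₁ := by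
    have h3 : γ * a * γ⁻¹ ∈ scalarKer ρ₁ := scalarKer_normal.conj_mem _ ha γ
    have h4 := (scalarKer ρ₁).mul_mem h3 (scalarKer_normal.conj_mem _ (inv_mem h3) b)
    rw [hc]
    simpa only [mul_assoc] using h4
  have hcZ₂ : c ∈ scalarKer ρ₂ := by
    rw [hc]
    exact (scalarKer ρ₂).mul_mem (scalarKer_normal.conj_mem _ hb _) (inv_mem hb)
  obtain ⟨γ', hγ'⟩ := hΓ.exists_conj_not_commute_of_finiteIndex hκ hκfi hc1 hc1
  obtain ⟨e, he⟩ : ∃ e : H, e = (γ' * c * γ'⁻¹) * c * (γ' * c * γ'⁻¹)⁻¹ * c⁻¹ := ⟨_, rfl⟩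
  have he1 : e ≠ 1 := fun h => hγ' (hcomm _ _ (he ▸ h))
  have heZ₁ : ρ₁ e = 1 := he ▸ map_commutator_eq_one (scalarKer_normal.conj_mem _ hcZ₁ _)
  have heZ₂ : ρ₂ e = 1 := he ▸ map_commutator_eq_one (scalarKer_normal.conj_mem _ hcZ₂ _)
  obtain ⟨γ'', hγ''⟩ := hΓ.exists_conj_not_commute_of_finiteIndex hκ hκfi he1 he1
  obtain ⟨f, hf⟩ : ∃ f : H, f = γ'' * e * γ''⁻¹ := ⟨_, rfl⟩
  have hfZ₁ : ρ₁ f = 1 := by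
    rw [hf, map_mul, map_mul, heZ₁, mul_one, ← map_mul, mul_inv_cancel, map_one]
  have hfZ₂ : ρ₂ f = 1 := by
    rw [hf, map_mul, map_mul, heZ₂, mul_one, ← map_mul, mul_inv_cancel, map_one]
  have q1 : ∀ g : H, ρ₁ g = 1 → ∀ u ∈ U, ρ g u = u := fun g hg u hu =>
    congrArg Subtype.val (LinearMap.congr_fun hg ⟨u, hu⟩)
  have q2 : ∀ g : H, ρ₂ g = 1 → ∀ x, ρ g x - x ∈ U := fun g hg x =>
    (Submodule.Quotient.eq U).1 (LinearMap.congr_fun hg (Submodule.Quotient.mk x))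
  rw [← hf] at hγ''
  apply hγ''
  have h5 : ρ ((f : G) * e) = ρ ((e : G) * f) := by
    rw [map_mul, map_mul]
    ext x
    have k1 := q1 f hfZ₁ _ (q2 e heZ₂ x)
    have k2 := q1 e heZ₁ _ (q2 f hfZ₂ x)
    rw [map_sub] at k1 k2
    rw [Module.End.mul_apply, Module.End.mul_apply]
    rw [sub_eq_iff_eq_add] at k1 k2
    rw [k1, k2]
    abel
  have h6 : ((f : G) * e) * ((e : G) * f)⁻¹ ∈ scalarKer ρ := by
    apply mem_scalarKer_of_map_eq_smul (c := 1)
    rw [map_mul, h5, ← map_mul, mul_inv_cancel, map_one, one_smul]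
  rw [hρ, Subgroup.mem_bot, mul_inv_eq_one] at h6
  exact Subtype.ext h6

/-- A mixed identity free linear group has a finite index subgroup with a dual strongly
irreducible representation in which only the identity acts by a scalar. -/
theorem exists_dualStronglyIrreducible (hΓ : IsMIF Γ) {V : Type} [AddCommGroup V] [Module ℂ V]
    [FiniteDimensional ℂ V] (ρ : Representation ℂ Γ V) (hρ : Function.Injective ρ) :
    ∃ (G : Type) (_ : Group G) (ι : G →* Γ) (V : Type) (_ : AddCommGroup V) (_ : Module ℂ V)
      (_ : FiniteDimensional ℂ V) (ρ : Representation ℂ G V),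
      Function.Injective ι ∧ ι.range.FiniteIndex ∧ scalarKer ρ = ⊥ ∧
        DualStronglyIrreducible ρ := by
  classical
  have hbase : HasRep Γ (finrank ℂ V) := by
    have hfi : (MonoidHom.id Γ).range.FiniteIndex := by
      rw [MonoidHom.range_eq_top.2 Function.surjective_id]; infer_instance
    refine ⟨Γ, _, MonoidHom.id Γ, V, _, _, inferInstance, ρ, Function.injective_id, hfi, ?_, rfl⟩
    rw [eq_bot_iff]
    intro a ha
    by_contra ha1
    obtain ⟨γ, hγ⟩ := hΓ.exists_conj_not_commute_of_finiteIndex Function.injective_id hfi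
      (ι := MonoidHom.id Γ) (a := a) (b := a) ha1 ha1
    apply hγ
    apply hρ
    rw [map_mul, map_mul ρ a]
    exact (ha _).symm
  have hex : ∃ n, HasRep Γ n := ⟨_, hbase⟩
  obtain ⟨G, _, ι, V, _, _, _, ρ, hι, hfi, hker, hn⟩ := Nat.find_spec hex
  refine ⟨G, _, ι, V, _, _, inferInstance, ρ, hι, hfi, hker, fun H hH D hD => ?_⟩
  refine stronglyIrreducible_of_minimal hΓ (fun k hk => Nat.find_min hex hk) hι hfi
    (scalarKer_dual hker) (by rw [Subspace.dual_finrank_eq, hn]) H hH D ?_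
  intro h hh u hu
  exact hD h⁻¹ (inv_mem hh) ⟨u, hu, rfl⟩

end MinimalRepresentation

end MixedIdentity

namespace MixedIdentity

section Burnside

open Module

/-- Burnside: an irreducible representation over an algebraically closed field spans the
endomorphism algebra. -/
theorem span_range_eq_top {K G V : Type*} [Field K] [IsAlgClosed K] [Group G] [AddCommGroup V]
    [Module K V] [FiniteDimensional K V] [Nontrivial V] (σ : Representation K G V)
    (hirr : ∀ U : Submodule K V, (∀ g, ∀ u ∈ U, σ g u ∈ U) → U = ⊥ ∨ U = ⊤) :
    Submodule.span K (Set.range σ) = ⊤ := by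
  classical
  let R : Subalgebra K (End K V) := Algebra.adjoin K (Set.range σ)
  have hmem : ∀ g, σ g ∈ R := fun g => Algebra.subset_adjoin ⟨g, rfl⟩
  have hR : R.toSubmodule = Submodule.span K (Set.range σ) := by
    have : (Submonoid.closure (Set.range σ) : Set (End K V)) = Set.range σ := by
      have h : Set.range σ = (MonoidHom.mrange σ : Set (End K V)) := rfl
      rw [h, Submonoid.closure_eq]
    rw [Algebra.adjoin_eq_span, this]
  have hsimple : IsSimpleModule R V := by
    refine { eq_bot_or_eq_top := fun U => ?_, exists_pair_ne := ⟨⊥, ⊤, bot_ne_top⟩ }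
    rcases hirr (U.restrictScalars K) (fun g u hu => U.smul_mem ⟨σ g, hmem g⟩ hu) with h | h
    · left
      exact (Submodule.restrictScalars_eq_bot_iff K R V).1 h
    · right
      exact (Submodule.restrictScalars_eq_top_iff K R V).1 h
  have hschur := (IsSimpleModule.algebraMap_end_bijective_of_isAlgClosed (A := R) (V := V) K).2
  rw [← hR, eq_top_iff]
  intro f _
  let f' : End (End R V) V :=
    { toFun := f
      map_add' := map_add f
      map_smul' := fun e x => by
        obtain ⟨c, rfl⟩ := hschur e
        exact f.map_smul c x }
  obtain ⟨r, hr⟩ := jacobson_density (R := R) f' (Finset.univ.image (finBasis K V))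
  have : f = r := (finBasis K V).ext fun i => hr _ (Finset.mem_image_of_mem _ (Finset.mem_univ i))
  rw [this]
  exact r.2

end Burnside

end MixedIdentity

namespace MixedIdentity

section FieldEmbeddings

open Cardinal Polynomial

/-- Extension of embeddings of countable fields to large algebraically closed fields. -/
theorem exists_ringHom_comp_eq {F K L : Type} [Field F] [Field K] [Field L] [IsAlgClosed L]
    (hF : #F ≤ ℵ₀) (hL : ℵ₀ < #L) (hKL : #K ≤ #L) (f : F →+* K) (g : F →+* L) :
    ∃ τ : K →+* L, τ.comp f = g := by
  algebraize [f, g]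
  obtain ⟨s, hs⟩ := exists_isTranscendenceBasis F K
  obtain ⟨t, ht⟩ := exists_isTranscendenceBasis F L
  have h1 : #s ≤ #t := by
    have h2 := IsAlgClosed.cardinal_eq_cardinal_transcendence_basis_of_aleph0_lt' _ ht hF hL
    rw [← h2]
    exact (mk_set_le s).trans hKL
  obtain ⟨e⟩ := h1
  have ht' : Function.Injective (MvPolynomial.aeval (R := F) fun i : s => (e i : L)) :=
    AlgebraicIndependent.comp ht.1 e e.injective
  let A := Algebra.adjoin F (Set.range ((↑) : s → K))
  let j : A →ₐ[F] L := (MvPolynomial.aeval fun i : s => (e i : L)).comp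
    (hs.1.aevalEquiv.symm : A →ₐ[F] MvPolynomial s F)
  have hj : Function.Injective j :=
    fun x y h => hs.1.aevalEquiv.symm.injective (ht' h)
  let : Algebra A L := j.toRingHom.toAlgebra
  have : FaithfulSMul A L := (faithfulSMul_iff_algebraMap_injective A L).2 hj
  have : Algebra.IsAlgebraic A K := hs.isAlgebraic
  have : IsScalarTower F A L := IsScalarTower.of_algebraMap_eq fun x => (j.commutes x).symm
  let τ : K →ₐ[A] L := IsAlgClosed.lift
  refine ⟨τ.toRingHom, RingHom.ext fun x => ?_⟩
  have h3 : f x = algebraMap A K (algebraMap F A x) := rfl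
  have h4 : g x = algebraMap A L (algebraMap F A x) := IsScalarTower.algebraMap_apply F A L x
  rw [h4, ← τ.commutes, ← h3]
  rfl

/-- A complex number can be moved to any root of its minimal polynomial. -/
theorem exists_ringHom_apply_eq_of_root {L : Type} [Field L] [IsAlgClosed L] [CharZero L]
    (hL : 𝔠 ≤ #L) {z : ℂ} (hz : IsAlgebraic ℚ z) {y : L}
    (hy : aeval y (minpoly ℚ z) = 0) : ∃ τ : ℂ →+* L, τ z = y := by
  have hirr : Fact (Irreducible (minpoly ℚ z)) := ⟨minpoly.irreducible hz.isIntegral⟩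
  have hc : #(AdjoinRoot (minpoly ℚ z)) ≤ ℵ₀ := by
    refine (mk_le_of_surjective (AdjoinRoot.mk_surjective (g := minpoly ℚ z))).trans ?_
    exact cardinalMk_le_max.trans (by simp)
  have h1 : eval₂ (algebraMap ℚ ℂ) z (minpoly ℚ z) = 0 := by
    rw [← aeval_def, minpoly.aeval]
  have h2 : eval₂ (algebraMap ℚ L) y (minpoly ℚ z) = 0 := by
    rw [← aeval_def, hy]
  obtain ⟨τ, hτ⟩ := exists_ringHom_comp_eq hc (aleph0_lt_continuum.trans_le hL)
    (mk_complex ▸ hL) (AdjoinRoot.lift (algebraMap ℚ ℂ) z h1)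
    (AdjoinRoot.lift (algebraMap ℚ L) y h2)
  refine ⟨τ, ?_⟩
  have := RingHom.congr_fun hτ (AdjoinRoot.root _)
  rwa [RingHom.comp_apply, AdjoinRoot.lift_root, AdjoinRoot.lift_root] at this

theorem exists_ringHom_of_transcendental {z : ℂ} (hz : Transcendental ℚ z) (q : ℚ) :
    ∃ τ : ℂ →+* ℂ, τ z = z + q := by
  have hz' : Transcendental ℚ (z + q) := fun h => hz (by
    simpa using h.sub (isAlgebraic_algebraMap (R := ℚ) (A := ℂ) q))
  have h1 : Function.Injective (aeval z : ℚ[X] →ₐ[ℚ] ℂ).toRingHom :=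
    transcendental_iff_injective.1 hz
  have h2 : Function.Injective (aeval (z + q) : ℚ[X] →ₐ[ℚ] ℂ).toRingHom :=
    transcendental_iff_injective.1 hz'
  have hc : #(FractionRing ℚ[X]) ≤ ℵ₀ := by
    rw [IsFractionRing.cardinalMk ℚ[X] (FractionRing ℚ[X])]
    exact cardinalMk_le_max.trans (by simp)
  obtain ⟨τ, hτ⟩ := exists_ringHom_comp_eq hc (mk_complex ▸ aleph0_lt_continuum) le_rfl
    (IsFractionRing.lift h1) (IsFractionRing.lift h2)
  refine ⟨τ, ?_⟩
  have := RingHom.congr_fun hτ (algebraMap _ _ (X : ℚ[X]))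
  rw [RingHom.comp_apply, IsFractionRing.lift_algebraMap, IsFractionRing.lift_algebraMap] at this
  simpa using this

lemma isAlgebraic_of_bounded {z : ℂ} {B : ℝ} (h : ∀ τ : ℂ →+* ℂ, ‖τ z‖ ≤ B) :
    IsAlgebraic ℚ z := by
  by_contra hz
  obtain ⟨n, hn⟩ := exists_nat_gt (B + ‖z‖)
  obtain ⟨τ, hτ⟩ := exists_ringHom_of_transcendental hz n
  have h1 := h τ
  rw [hτ] at h1
  have h2 : ‖(n : ℂ)‖ ≤ ‖z + n‖ + ‖z‖ := by
    have := norm_sub_le (z + n) z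
    simpa using this
  rw [Complex.norm_natCast] at h2
  push_cast at h1
  linarith

lemma isInt_of_padic_norm_le_one {q : ℚ} (h : ∀ (p : ℕ) [Fact p.Prime], ‖(q : ℚ_[p])‖ ≤ 1) :
    ∃ n : ℤ, (n : ℚ) = q := by
  refine ⟨q.num, ?_⟩
  have : q.den = 1 := by
    by_contra hd
    obtain ⟨p, hp, hpd⟩ := Nat.exists_prime_and_dvd hd
    have := Fact.mk hp
    have h1 : ‖((q.den : ℤ) : ℚ_[p])‖ < 1 :=
      Padic.norm_intCast_lt_one_iff.2 (Int.natCast_dvd_natCast.2 hpd)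
    have h2 : ((q.num : ℤ) : ℚ_[p]) = (q : ℚ_[p]) * ((q.den : ℤ) : ℚ_[p]) := by
      have := congrArg (Rat.cast : ℚ → ℚ_[p]) (Rat.mul_den_eq_num q)
      push_cast at this ⊢
      exact this.symm
    have h3 : ‖(q.num : ℚ_[p])‖ < 1 := by
      rw [h2, norm_mul]
      exact mul_lt_one_of_nonneg_of_lt_one_right (h p) (norm_nonneg _) h1
    have h4 : p ∣ q.num.natAbs := Int.natCast_dvd.1 (Padic.norm_intCast_lt_one_iff.1 h3)
    exact hp.one_lt.ne' (Nat.dvd_one.1 (q.reduced ▸ Nat.dvd_gcd h4 hpd))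
  exact Rat.coe_int_num_of_den_eq_one this

lemma norm_coeff_prod_X_sub_C_le_one {L : Type*} [NormedField L] [IsUltrametricDist L]
    (s : Multiset L) (hs : ∀ r ∈ s, ‖r‖ ≤ 1) (i : ℕ) :
    ‖(s.map fun r => X - C r).prod.coeff i‖ ≤ 1 := by
  induction s using Multiset.induction_on generalizing i with
  | empty =>
    rw [Multiset.map_zero, Multiset.prod_zero, coeff_one]
    split <;> simp
  | cons a s ih =>
    have ih' := ih fun r hr => hs r (Multiset.mem_cons_of_mem hr)
    have ha := hs a (Multiset.mem_cons_self a s)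
    rw [Multiset.map_cons, Multiset.prod_cons, sub_mul, sub_eq_add_neg, coeff_add,
      coeff_neg, coeff_C_mul]
    refine (IsUltrametricDist.norm_add_le_max _ _).trans (max_le ?_ ?_)
    · cases i with
      | zero => simp
      | succ i => rw [coeff_X_mul]; exact ih' i
    · rw [norm_neg, norm_mul]
      exact mul_le_one₀ ha (norm_nonneg _) (ih' i)

/-- A complex number with bounded archimedean conjugates, integral at all primes, is an algebraic
integer. -/
theorem isIntegral_of_bounded {z : ℂ} {B : ℝ} (h : ∀ τ : ℂ →+* ℂ, ‖τ z‖ ≤ B)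
    (hp : ∀ (p : ℕ) [Fact p.Prime] (τ : ℂ →+* ℂ_[p]), ‖τ z‖ ≤ 1) : IsIntegral ℤ z := by
  have hz := isAlgebraic_of_bounded h
  have hmon := minpoly.monic hz.isIntegral
  have hcoeff (i : ℕ) : ∃ n : ℤ, (n : ℚ) = (minpoly ℚ z).coeff i := by
    refine isInt_of_padic_norm_le_one fun p _ => ?_
    have hc : 𝔠 ≤ #(ℂ_[p]) := continuum_le_cardinal_of_nontriviallyNormedField ℂ_[p]
    have h1 := (IsAlgClosed.splits ((minpoly ℚ z).map (algebraMap ℚ ℂ_[p])))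
    have h2 := h1.eq_prod_roots_of_monic (hmon.map _)
    have h3 := norm_coeff_prod_X_sub_C_le_one
      ((minpoly ℚ z).map (algebraMap ℚ ℂ_[p])).roots (fun r hr => by
        have h4 : aeval r (minpoly ℚ z) = 0 := by
          have := isRoot_of_mem_roots hr
          rwa [IsRoot, eval_map_algebraMap] at this
        obtain ⟨τ, rfl⟩ := exists_ringHom_apply_eq_of_root hc hz h4
        exact hp p τ) i
    rw [← h2, coeff_map] at h3
    have h5 : algebraMap ℚ ℂ_[p] ((minpoly ℚ z).coeff i) =
        algebraMap ℚ_[p] ℂ_[p] ((minpoly ℚ z).coeff i : ℚ_[p]) := by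
      simp
    rwa [h5, norm_algebraMap'] at h3
  choose c hc using hcoeff
  have hl : minpoly ℚ z ∈ lifts (Int.castRingHom ℚ) :=
    (lifts_iff_coeff_lifts _).2 fun i => ⟨c i, hc i⟩
  obtain ⟨q, hq, -, hqm⟩ := lifts_and_degree_eq_and_monic hl hmon
  refine ⟨q, hqm, ?_⟩
  have h1 : aeval z (minpoly ℚ z) = 0 := minpoly.aeval ℚ z
  rw [← hq, aeval_def, eval₂_map] at h1
  rwa [RingHom.ext_int (algebraMap ℤ ℂ) ((algebraMap ℚ ℂ).comp (Int.castRingHom ℚ))]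

/-- Elements of a finitely generated `ℚ`-subalgebra of `ℂ` whose conjugates are integral and
bounded form a finite set. -/
theorem finite_of_bounded (R : Subalgebra ℚ ℂ) (hR : R.FG) (B : ℝ) :
    {z : ℂ | z ∈ R ∧ (∀ τ : ℂ →+* ℂ, ‖τ z‖ ≤ B) ∧
      ∀ (p : ℕ) [Fact p.Prime] (τ : ℂ →+* ℂ_[p]), ‖τ z‖ ≤ 1}.Finite := by
  have hft : Algebra.FiniteType ℚ R := R.fg_iff_finiteType.1 hR
  obtain ⟨m, hm⟩ := Ideal.exists_maximal R
  let : Field (R ⧸ m) := Ideal.Quotient.field m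
  have : Algebra.FiniteType ℚ (R ⧸ m) := hft.of_surjective (Ideal.Quotient.mkₐ ℚ m)
    (Ideal.Quotient.mkₐ_surjective ℚ m)
  have hfd : Module.Finite ℚ (R ⧸ m) := finite_of_finite_type_of_isJacobsonRing ℚ (R ⧸ m)
  have : CharZero (R ⧸ m) := charZero_of_injective_algebraMap (algebraMap ℚ (R ⧸ m)).injective
  have : NumberField (R ⧸ m) := by
    refine @NumberField.mk _ _ inferInstance ?_
    convert hfd using 1
    exact Subsingleton.elim _ _
  let π : R →+* R ⧸ m := Ideal.Quotient.mk m
  have hmin (z : R) : aeval (π z) (minpoly ℚ (z : ℂ)) = 0 := by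
    have h1 : aeval z (minpoly ℚ (z : ℂ)) = 0 := Subtype.ext (by
      rw [← Subalgebra.coe_val, ← aeval_algHom_apply]
      simp)
    have h2 := aeval_algHom_apply π.toRatAlgHom z (minpoly ℚ (z : ℂ))
    rw [h1, map_zero] at h2
    exact h2
  let S : Set R := {z | (∀ τ : ℂ →+* ℂ, ‖τ z‖ ≤ B) ∧
      ∀ (p : ℕ) [Fact p.Prime] (τ : ℂ →+* ℂ_[p]), ‖τ z‖ ≤ 1}
  have hS : S.Finite := by
    refine Set.Finite.of_finite_image
      ((NumberField.Embeddings.finite_of_norm_le (R ⧸ m) ℂ B).subset ?_) (f := π) ?_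
    · rintro _ ⟨z, ⟨hz1, hz2⟩, rfl⟩
      refine ⟨?_, fun φ => ?_⟩
      · have h1 : IsIntegral ℤ z :=
          (isIntegral_algebraMap_iff (B := ℂ) Subtype.val_injective).1
            (isIntegral_of_bounded hz1 hz2)
        exact h1.map π.toIntAlgHom
      · have h2 : aeval (φ (π z)) (minpoly ℚ (z : ℂ)) = 0 := by
          have h3 := aeval_algHom_apply φ.toRatAlgHom (π z) (minpoly ℚ (z : ℂ))
          rw [hmin, map_zero] at h3
          exact h3
        obtain ⟨τ, hτ⟩ := exists_ringHom_apply_eq_of_root mk_complex.ge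
          (isAlgebraic_of_bounded hz1) h2
        rw [← hτ]
        exact hz1 τ
    · intro x hx y hy hxy
      by_contra hne
      have h1 : IsAlgebraic ℚ ((x - y : R) : ℂ) :=
        (isAlgebraic_of_bounded hx.1).sub (isAlgebraic_of_bounded hy.1)
      have h2 := minpoly.coeff_zero_ne_zero h1.isIntegral
        (fun h => hne (sub_eq_zero.1 (Subtype.ext h)))
      have h3 := hmin (x - y)
      rw [map_sub, hxy, sub_self, ← coeff_zero_eq_aeval_zero', map_eq_zero] at h3
      exact h2 h3
  exact (hS.image ((↑) : R → ℂ)).subset fun z hz => ⟨⟨z, hz.1⟩, hz.2, rfl⟩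

end FieldEmbeddings

end MixedIdentity

namespace MixedIdentity

section LinearNonamenable

open Module

lemma isUnit_representation {G W : Type*} [Group G] [AddCommGroup W] [Module ℂ W]
    (σ : Representation ℂ G W) (g : G) : IsUnit (σ g) := (Group.isUnit g).map σ

variable {G : Type} [Group G] {W : Type} [AddCommGroup W] [Module ℂ W] [FiniteDimensional ℂ W]

/-- The conjugation-invariant scalar-invariant ratio `tr ^ m / det`. -/
noncomputable def traceRatio (T : End ℂ W) : ℂ :=
  LinearMap.trace ℂ W T ^ finrank ℂ W / LinearMap.det T

lemma roots_charpoly_card (T : End ℂ W) : T.charpoly.roots.card = finrank ℂ W := by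
  rw [← LinearMap.charpoly_natDegree T]
  exact (IsAlgClosed.splits T.charpoly).natDegree_eq_card_roots.symm

lemma map_trace_eq {L : Type*} [Field L] (τ : ℂ →+* L) (T : End ℂ W) :
    τ (LinearMap.trace ℂ W T) = (T.charpoly.roots.map τ).sum := by
  rw [Module.End.trace_eq_sum_roots_charpoly_of_splits (IsAlgClosed.splits _),
    map_multiset_sum]

lemma norm_map_det_eq {L : Type*} [NormedField L] (τ : ℂ →+* L) (T : End ℂ W) {c : ℝ}
    (hc : ∀ r ∈ T.charpoly.roots, ‖τ r‖ = c) : ‖τ (LinearMap.det T)‖ = c ^ finrank ℂ W := by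
  rw [Module.End.det_eq_prod_roots_charpoly_of_splits (IsAlgClosed.splits _), map_multiset_prod,
    ← coe_nnnorm, ← roots_charpoly_card T]
  have : ∀ s : Multiset ℂ, (∀ r ∈ s, ‖τ r‖ = c) → ‖(s.map τ).prod‖ = c ^ s.card := by
    intro s
    induction s using Multiset.induction_on with
    | empty => simp
    | cons a s ih =>
      intro h
      rw [Multiset.map_cons, Multiset.prod_cons, norm_mul, h a (Multiset.mem_cons_self a s),
        ih fun r hr => h r (Multiset.mem_cons_of_mem hr), Multiset.card_cons, pow_succ']
  exact this _ hc

lemma norm_map_traceRatio_le {L : Type*} [NormedField L] (τ : ℂ →+* L) (T : End ℂ W)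
    (hT : IsUnit T) (heig : ∀ a b, T.HasEigenvalue a → T.HasEigenvalue b → ‖τ b‖ ≤ ‖τ a‖) :
    ‖τ (traceRatio T)‖ ≤ (finrank ℂ W : ℝ) ^ finrank ℂ W ∧
      (IsUltrametricDist L → ‖τ (traceRatio T)‖ ≤ 1) := by
  have hdet : τ (LinearMap.det T) ≠ 0 :=
    (map_ne_zero τ).2 (hT.map LinearMap.det).ne_zero
  have hdet' := norm_pos_iff.2 hdet
  have heig' {r} (hr : r ∈ T.charpoly.roots) : T.HasEigenvalue r :=
    (Module.End.hasEigenvalue_iff_isRoot_charpoly T r).2 (Polynomial.isRoot_of_mem_roots hr)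
  obtain ⟨c, hc0, hc⟩ : ∃ c : ℝ, 0 ≤ c ∧ ∀ r ∈ T.charpoly.roots, ‖τ r‖ = c := by
    by_cases h : ∃ a, a ∈ T.charpoly.roots
    · obtain ⟨a, ha⟩ := h
      exact ⟨‖τ a‖, norm_nonneg _, fun r hr => le_antisymm
        (heig _ _ (heig' ha) (heig' hr)) (heig _ _ (heig' hr) (heig' ha))⟩
    · push Not at h
      exact ⟨0, le_rfl, fun r hr => (h r hr).elim⟩
  have hd := norm_map_det_eq τ T hc
  rw [traceRatio, map_div₀, map_pow, norm_div, norm_pow, div_le_iff₀ hdet', div_le_iff₀ hdet', hd,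
    map_trace_eq, ← mul_pow, one_mul]
  refine ⟨pow_le_pow_left₀ (norm_nonneg _) ?_ _, fun _ => pow_le_pow_left₀ (norm_nonneg _) ?_ _⟩
  · rw [← roots_charpoly_card T]
    have : ∀ s : Multiset ℂ, (∀ r ∈ s, ‖τ r‖ = c) → ‖(s.map τ).sum‖ ≤ s.card * c := by
      intro s
      induction s using Multiset.induction_on with
      | empty => simp
      | cons a s ih =>
        intro h
        rw [Multiset.map_cons, Multiset.sum_cons, Multiset.card_cons]
        have h1 := norm_add_le (τ a) (s.map τ).sum
        have h2 := h a (Multiset.mem_cons_self a s)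
        have h3 := ih fun r hr => h r (Multiset.mem_cons_of_mem hr)
        push_cast
        linarith
    exact this _ hc
  · have : ∀ s : Multiset ℂ, (∀ r ∈ s, ‖τ r‖ = c) → ‖(s.map τ).sum‖ ≤ c := by
      intro s
      induction s using Multiset.induction_on with
      | empty => simpa using hc0
      | cons a s ih =>
        intro h
        rw [Multiset.map_cons, Multiset.sum_cons]
        exact (IsUltrametricDist.norm_add_le_max _ _).trans (max_le
          (h a (Multiset.mem_cons_self a s)).le
          (ih fun r hr => h r (Multiset.mem_cons_of_mem hr)))
    exact this _ hc

variable (σ : Representation ℂ G W)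

/-- Traces and determinants of a finitely generated linear group lie in a finitely generated
`ℚ`-algebra. -/
lemma exists_subalgebra_traceRatio_mem (hG : Group.FG G) :
    ∃ R : Subalgebra ℚ ℂ, R.FG ∧ ∀ g, traceRatio (σ g) ∈ R := by
  classical
  obtain ⟨S, hS⟩ := hG.out
  let b := finBasis ℂ W
  let A : G → Matrix (Fin (finrank ℂ W)) (Fin (finrank ℂ W)) ℂ :=
    fun g => LinearMap.toMatrix b b (σ g)
  have hA1 : A 1 = 1 := by simp [A]
  have hAmul (g h) : A (g * h) = A g * A h := by
    simp only [A, map_mul, Module.End.mul_eq_comp]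
    exact LinearMap.toMatrix_comp b b b _ _
  let E : Set ℂ := ⋃ g ∈ (S ∪ S.image (·⁻¹) : Finset G), ⋃ i, ⋃ j, {A g i j}
  have hE : E.Finite := Set.Finite.biUnion (Finset.finite_toSet _) fun g _ =>
    Set.finite_iUnion fun i => Set.finite_iUnion fun j => Set.finite_singleton _
  let R := Algebra.adjoin ℚ E
  have hmem {g} (hg : g ∈ S ∪ S.image (·⁻¹)) (i j) : A g i j ∈ R :=
    Algebra.subset_adjoin (Set.mem_biUnion hg
      (Set.mem_iUnion.2 ⟨i, Set.mem_iUnion.2 ⟨j, rfl⟩⟩))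
  have hmulmem {g h} (hg : ∀ i j, A g i j ∈ R) (hh : ∀ i j, A h i j ∈ R) (i j) :
      A (g * h) i j ∈ R := by
    rw [hAmul, Matrix.mul_apply]
    exact sum_mem fun k _ => mul_mem (hg _ _) (hh _ _)
  have hall (g : G) : (∀ i j, A g i j ∈ R) ∧ ∀ i j, A g⁻¹ i j ∈ R := by
    have hg : g ∈ Subgroup.closure (S : Set G) := hS ▸ Subgroup.mem_top g
    induction hg using Subgroup.closure_induction with
    | mem g hg =>
      exact ⟨hmem (Finset.mem_union_left _ hg),
        hmem (Finset.mem_union_right _ (Finset.mem_image_of_mem _ hg))⟩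
    | one =>
      have this : ∀ i j, A 1 i j ∈ R := fun i j => by
        rw [hA1, Matrix.one_apply]
        split
        exacts [one_mem _, zero_mem _]
      exact ⟨this, by rwa [inv_one]⟩
    | mul g h _ _ hg hh =>
      exact ⟨hmulmem hg.1 hh.1, by rw [_root_.mul_inv_rev]; exact hmulmem hh.2 hg.2⟩
    | inv g _ hg => exact ⟨hg.2, by rw [inv_inv]; exact hg.1⟩
  refine ⟨R, ⟨hE.toFinset, by simp [R]⟩, fun g => ?_⟩
  have hdet (g : G) : LinearMap.det (σ g) ∈ R := by
    rw [← LinearMap.det_toMatrix b, Matrix.det_apply]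
    exact sum_mem fun s _ => Subalgebra.zsmul_mem _ (prod_mem fun i _ => (hall g).1 _ _) _
  have hinv : (LinearMap.det (σ g))⁻¹ = LinearMap.det (σ g⁻¹) := by
    refine (eq_inv_of_mul_eq_one_right ?_).symm
    rw [← map_mul, ← map_mul, mul_inv_cancel, map_one, map_one]
  rw [traceRatio, div_eq_mul_inv, hinv, LinearMap.trace_eq_matrix_trace ℂ b]
  exact mul_mem (pow_mem (sum_mem fun i _ => (hall g).1 _ _) _) (hdet _)

lemma eq_of_trace_mul_eq {A B : End ℂ W}
    (h : ∀ T, LinearMap.trace ℂ W (A * T) = LinearMap.trace ℂ W (B * T)) : A = B := by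
  classical
  let b := finBasis ℂ W
  apply (LinearMap.toMatrixAlgEquiv b).injective
  rw [Matrix.ext_iff_trace_mul_right]
  intro M
  have := h ((LinearMap.toMatrixAlgEquiv b).symm M)
  rw [LinearMap.trace_eq_matrix_trace ℂ b, LinearMap.trace_eq_matrix_trace ℂ b] at this
  have h2 (C : End ℂ W) : LinearMap.toMatrix b b (C * (LinearMap.toMatrixAlgEquiv b).symm M) =
      LinearMap.toMatrixAlgEquiv b C * M := by
    change LinearMap.toMatrixAlgEquiv b _ = _
    rw [map_mul, AlgEquiv.apply_symm_apply]
  rwa [h2, h2] at this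

/-- A group with spanning image, trivial scalar kernel and finitely many trace ratios is finite. -/
lemma finite_of_finite_traceRatio (hker : scalarKer σ = ⊥)
    (hspan : Submodule.span ℂ (Set.range σ) = ⊤)
    (hfin : (Set.range fun g => traceRatio (σ g)).Finite) : Finite G := by
  classical
  rcases subsingleton_or_nontrivial W with hW | hW
  · have : Subsingleton G := by
      refine ⟨fun g h => ?_⟩
      have h1 (g : G) : g = 1 := by
        have : g ∈ scalarKer σ := fun T => LinearMap.ext fun x => Subsingleton.elim _ _
        rwa [hker, Subgroup.mem_bot] at this
      rw [h1 g, h1 h]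
    infer_instance
  have hm : finrank ℂ W ≠ 0 := (finrank_pos (R := ℂ) (M := W)).ne'
  have hdet (g : G) : LinearMap.det (σ g) ≠ 0 :=
    ((isUnit_representation σ g).map LinearMap.det).ne_zero
  let 𝔟 := Basis.ofSpan hspan.ge
  have h𝔟 (i) : ∃ g, σ g = 𝔟 i := Basis.ofSpan_subset hspan.ge ⟨i, rfl⟩
  choose e he using h𝔟
  have hc (g : G) : ∃ c : ℂ, c ^ finrank ℂ W = (LinearMap.det (σ g))⁻¹ :=
    IsAlgClosed.exists_pow_nat_eq _ (Nat.pos_of_ne_zero hm)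
  choose c hc using hc
  have hc0 (g) : c g ≠ 0 := fun h => by
    have := hc g
    rw [h, zero_pow hm] at this
    exact inv_ne_zero (hdet g) this.symm
  have := FiniteDimensional.fintypeBasisIndex 𝔟
  let F : G → _ → ℂ := fun g i => c g * LinearMap.trace ℂ W (σ g * 𝔟 i)
  have hF1 : (Set.range F).Finite := by
    refine (Set.Finite.pi' (t := fun i => {z : ℂ | z ^ finrank ℂ W ∈
      (fun t => t * LinearMap.det (𝔟 i)) '' Set.range fun g => traceRatio (σ g)}) fun i => ?_).subset ?_
    · refine Set.Finite.preimage' (f := fun z : ℂ => z ^ finrank ℂ W) (hfin.image _) fun a _ => ?_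
      refine (Polynomial.nthRootsFinset (finrank ℂ W) a).finite_toSet.subset fun z hz => ?_
      exact (Polynomial.mem_nthRootsFinset (Nat.pos_of_ne_zero hm) a).2 hz
    · rintro _ ⟨g, rfl⟩ i
      refine ⟨_, ⟨g * e i, rfl⟩, ?_⟩
      have := hdet g
      have h2 := hdet (e i)
      simp only [F, traceRatio, mul_pow, hc, map_mul, ← he i]
      field_simp
  have hF2 : Function.Injective F := by
    intro g h hgh
    have h1 : c g • σ g = c h • σ h := by
      refine eq_of_trace_mul_eq fun T => ?_
      have : (LinearMap.trace ℂ W).comp (LinearMap.mulLeft ℂ (c g • σ g)) =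
          (LinearMap.trace ℂ W).comp (LinearMap.mulLeft ℂ (c h • σ h)) := by
        refine 𝔟.ext fun i => ?_
        have := congrFun hgh i
        simpa [F] using this
      exact LinearMap.congr_fun this T
    have h2 : σ (h⁻¹ * g) = ((c g)⁻¹ * c h) • 1 := by
      have h3 : σ g = ((c g)⁻¹ * c h) • σ h := by
        rw [mul_smul, ← h1, smul_smul, inv_mul_cancel₀ (hc0 g), one_smul]
      rw [map_mul, h3, mul_smul_comm, ← map_mul, inv_mul_cancel, map_one]
    have h4 := mem_scalarKer_of_map_eq_smul h2
    rw [hker, Subgroup.mem_bot, inv_mul_eq_one] at h4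
    exact h4.symm
  have := hF1.to_subtype
  exact Finite.of_injective (Set.rangeFactorization F) fun g h hgh => hF2 (Subtype.ext_iff.1 hgh)

variable {V : Type} [AddCommGroup V] [Module ℂ V] [FiniteDimensional ℂ V]

/-- A finitely generated amenable group with a strongly irreducible dual representation and trivial
scalar kernel is finite. -/
theorem finite_of_amenable (hG : Amenable G) (hfg : Group.FG G) (ρ : Representation ℂ G V)
    (hρ : DualStronglyIrreducible ρ) (hker : scalarKer ρ = ⊥) : Finite G := by
  have hker' := scalarKer_dual hker
  rcases subsingleton_or_nontrivial (Dual ℂ V) with hW | hW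
  · have h1 (g : G) : g = 1 := by
      have : g ∈ scalarKer ρ.dual := fun T => LinearMap.ext fun x => Subsingleton.elim _ _
      rwa [hker', Subgroup.mem_bot] at this
    have : Subsingleton G := ⟨fun g h => by rw [h1 g, h1 h]⟩
    infer_instance
  have hspan : Submodule.span ℂ (Set.range ρ.dual) = ⊤ := by
    refine span_range_eq_top ρ.dual fun U hU => hρ ⊤ inferInstance U fun h _ => ?_
    rintro _ ⟨u, hu, rfl⟩
    have := hU h⁻¹ u hu
    rwa [Representation.dual_apply, inv_inv] at this
  obtain ⟨R, hR, hmem⟩ := exists_subalgebra_traceRatio_mem ρ.dual hfg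
  have heig {L : Type} [NormedField L] (τ : ℂ →+* L) (g : G) (a b : ℂ)
      (ha : Module.End.HasEigenvalue (ρ.dual g) a) (hb : Module.End.HasEigenvalue (ρ.dual g) b) :
      ‖τ b‖ ≤ ‖τ a‖ := by
    obtain ⟨φ, hφ⟩ := ha.exists_hasEigenvector
    obtain ⟨ψ, hψ⟩ := hb.exists_hasEigenvector
    let v : AbsoluteValue ℂ ℝ := (NormedField.toAbsoluteValue L).comp τ.injective
    exact eigenvalue_abs_le hG hρ v g⁻¹ hφ.2 hψ.2 hφ.apply_eq_smul hψ.apply_eq_smul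
  refine finite_of_finite_traceRatio ρ.dual hker' hspan
    ((finite_of_bounded R hR ((finrank ℂ (Dual ℂ V) : ℝ) ^ finrank ℂ (Dual ℂ V))).subset ?_)
  rintro _ ⟨g, rfl⟩
  refine ⟨hmem g, fun τ => ?_, fun p _ τ => ?_⟩
  · exact (norm_map_traceRatio_le τ _ (isUnit_representation ρ.dual g) (heig τ g)).1
  · exact (norm_map_traceRatio_le τ _ (isUnit_representation ρ.dual g) (heig τ g)).2
      inferInstance

/-- A finitely generated mixed identity free linear group is not amenable. -/
theorem IsMIF.not_amenable {Γ : Type} [Group Γ] (hΓ : IsMIF Γ) (hfg : Group.FG Γ)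
    (ρ : Representation ℂ Γ V) (hρ : Function.Injective ρ) : ¬ Amenable Γ := by
  intro hA
  obtain ⟨G, _, ι, U, _, _, _, θ, hι, hfi, hker, hθ⟩ := exists_dualStronglyIrreducible hΓ ρ hρ
  let e := MonoidHom.ofInjective hι
  have hGA : Amenable G := (hA.subgroup ι.range).of_mulEquiv e.symm
  have hGfg : Group.FG G := by
    have : Group.FG ι.range := inferInstance
    exact Group.fg_of_surjective (f := e.symm.toMonoidHom) e.symm.surjective
  have hfin := finite_of_amenable hGA hGfg θ hθ hker
  have : Finite ι.range := Finite.of_equiv G e.toEquiv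
  have : Finite Γ := by
    have := ι.range.finite_quotient_of_finiteIndex
    exact Finite.of_equiv _ (Subgroup.groupEquivQuotientProdSubgroup (s := ι.range)).symm
  obtain ⟨γ, hγ⟩ := hΓ.exists_pow_ne_one (k := Nat.card Γ) Nat.card_pos.ne'
  exact hγ pow_card_eq_one'

end LinearNonamenable

end MixedIdentity

namespace MixedIdentity

section IndependentVariables

open MvPolynomial

variable {K : Type*} [Field K]

/-- The variables in `J` are algebraically independent modulo `Q`. -/
def IndepVars {σ : Type*} (Q : Ideal (MvPolynomial σ K)) (J : Finset σ) : Prop :=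
  ∀ f ∈ Q, (∀ m ∈ f.support, ∀ i ∉ J, m i = 0) → f = 0

lemma height_le_height_map_C {R : Type*} [CommRing R] [IsNoetherianRing R] (p : Ideal R)
    [p.IsPrime] : p.height ≤ (p.map (Polynomial.C : R →+* Polynomial R)).height := by
  have : (p.map (Polynomial.C : R →+* Polynomial R)).LiesOver p :=
    ⟨by
      ext x
      rw [Ideal.mem_comap]
      constructor
      · exact fun h => Ideal.mem_map_of_mem _ h
      · intro h
        have := Ideal.mem_map_C_iff.1 h 0
        simpa using this⟩
  rw [Ideal.height_eq_height_add_of_liesOver_of_hasGoingDown p (p.map Polynomial.C)]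
  exact le_self_add

theorem exists_indepVars_fin (N : ℕ) (Q : Ideal (MvPolynomial (Fin N) K)) [Q.IsPrime] :
    ∃ J : Finset (Fin N), IndepVars Q J ∧ (N : ℕ∞) ≤ J.card + Q.height := by
  induction N with
  | zero =>
    refine ⟨∅, fun f hf _ => ?_, by simp⟩
    by_contra h
    rw [eq_C_of_isEmpty f] at hf h
    refine Ideal.IsPrime.ne_top' (Q.eq_top_of_isUnit_mem hf (IsUnit.map C ?_))
    exact (isUnit_iff_ne_zero.2 fun h0 => h (by rw [h0, C_0]))
  | succ N ih =>
    let e := finSuccEquiv K N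
    let Q' : Ideal (Polynomial (MvPolynomial (Fin N) K)) := Q.comap e.toRingEquiv.symm
    have hQ' : Q'.height = Q.height := RingEquiv.height_comap e.toRingEquiv.symm Q
    have hmem {f} (hf : f ∈ Q) : e f ∈ Q' := by
      refine Ideal.mem_comap.2 ?_
      rwa [show e.toRingEquiv.symm (e f) = f from e.symm_apply_apply f]
    have : Q'.IsPrime := Ideal.comap_isPrime _ _
    let p := Q'.comap (Polynomial.C : MvPolynomial (Fin N) K →+* _)
    obtain ⟨J, hJ, hJc⟩ := ih p
    have hp := height_le_height_map_C p
    have hle : p.map Polynomial.C ≤ Q' := Ideal.map_comap_le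
    by_cases h : p.map Polynomial.C = Q'
    · refine ⟨Finset.cons 0 (J.map (Fin.succEmb N)) (by simp), fun f hf hsupp => ?_, ?_⟩
      · refine e.injective ?_
        rw [map_zero]
        ext1 i
        have h1 := Ideal.mem_map_C_iff.1 (h ▸ hmem hf) i
        refine hJ _ h1 fun m hm k hk => ?_
        have h2 := hsupp _ (mem_support_coeff_finSuccEquiv.1 hm) k.succ (by
          simpa [Fin.succ_ne_zero] using hk)
        simpa using h2
      · rw [Finset.card_cons, Finset.card_map]
        rw [h, hQ'] at hp
        push_cast
        calc (N : ℕ∞) + 1 ≤ J.card + p.height + 1 := by gcongr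
          _ ≤ J.card + Q.height + 1 := by gcongr
          _ = _ := by ring
    · refine ⟨J.map (Fin.succEmb N), fun f hf hsupp => ?_, ?_⟩
      · have h0 (i : ℕ) (hi : i ≠ 0) : (e f).coeff i = 0 := by
          rw [← support_eq_empty, Finset.eq_empty_iff_forall_notMem]
          intro m hm
          have h2 := hsupp _ (mem_support_coeff_finSuccEquiv.1 hm) 0 (by simp [Fin.succ_ne_zero])
          exact hi (by simpa using h2)
        have h1 : e f = Polynomial.C ((e f).coeff 0) := by
          ext1 i
          rw [Polynomial.coeff_C]
          split_ifs with hi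
          · rw [hi]
          · exact h0 i hi
        have h3 : (e f).coeff 0 = 0 := by
          refine hJ _ ?_ fun m hm k hk => ?_
          · rw [Ideal.mem_comap, ← h1]
            exact hmem hf
          · have h2 := hsupp _ (mem_support_coeff_finSuccEquiv.1 hm) k.succ (by simpa using hk)
            simpa using h2
        refine e.injective ?_
        rw [h1, h3, map_zero, map_zero]
      · rw [Finset.card_map]
        have h4 := Ideal.height_add_one_le_of_lt_of_isPrime (lt_of_le_of_ne hle h)
        push_cast
        calc (N : ℕ∞) + 1 ≤ J.card + p.height + 1 := by gcongr
          _ ≤ J.card + (p.map Polynomial.C).height + 1 := by gcongr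
          _ = J.card + ((p.map Polynomial.C).height + 1) := by ring
          _ ≤ J.card + Q.height := by rw [← hQ']; gcongr

theorem exists_indepVars {σ : Type*} [Fintype σ] (Q : Ideal (MvPolynomial σ K)) [Q.IsPrime] :
    ∃ J : Finset σ, IndepVars Q J ∧ (Fintype.card σ : ℕ∞) ≤ J.card + Q.height := by
  let ε := Fintype.equivFin σ
  let e := renameEquiv K ε
  let Q' := Q.comap e.toRingEquiv.symm
  have hQ' : Q'.height = Q.height := RingEquiv.height_comap e.toRingEquiv.symm Q
  have : Q'.IsPrime := Ideal.comap_isPrime _ _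
  obtain ⟨J, hJ, hJc⟩ := exists_indepVars_fin _ Q'
  refine ⟨J.map ε.symm.toEmbedding, fun f hf hsupp => ?_, by simpa [hQ'] using hJc⟩
  refine e.injective ?_
  rw [map_zero]
  refine hJ _ (Ideal.mem_comap.2 ?_) fun m hm i hi => ?_
  · rwa [show e.toRingEquiv.symm (e f) = f from e.symm_apply_apply f]
  have hm' : m ∈ (rename ε f).support := hm
  classical
  rw [support_rename_of_injective ε.injective, Finset.mem_image] at hm'
  obtain ⟨m, hm', rfl⟩ := hm'
  have := hsupp m hm' (ε.symm i) (by simpa using hi)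
  rw [← Equiv.apply_symm_apply ε i, Finsupp.mapDomain_apply ε.injective]
  exact this

end IndependentVariables

end MixedIdentity

namespace MixedIdentity

section HilbertFunction

open MvPolynomial Module

lemma exists_section_map {K E F : Type*} [Field K] [AddCommGroup E] [Module K E] [AddCommGroup F]
    [Module K F] (f : E →ₗ[K] F) (D : Submodule K E) :
    ∃ s : D.map f →ₗ[K] E, ∀ x, s x ∈ D ∧ f (s x) = x := by
  obtain ⟨s, hs⟩ := LinearMap.exists_rightInverse_of_surjective (f.submoduleMap D)
    (LinearMap.range_eq_top.2 (f.submoduleMap_surjective D))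
  exact ⟨D.subtype.comp s, fun x =>
    ⟨(s x).2, congrArg Subtype.val (LinearMap.congr_fun hs x)⟩⟩

lemma sum_finrank_add_le_of_injective {K ι A A' B : Type*} [Field K] [Fintype ι] {E : ι → Type*}
    [∀ i, AddCommGroup (E i)] [∀ i, Module K (E i)] [∀ i, FiniteDimensional K (E i)]
    [AddCommGroup A] [Module K A] [AddCommGroup A'] [Module K A'] [AddCommGroup B] [Module K B]
    [FiniteDimensional K B] (φ : ∀ i, E i →ₗ[K] A) (ψ : B →ₗ[K] A) (q : A →ₗ[K] A')
    (D : Submodule K A') [FiniteDimensional K D]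
    (hD : ∀ (x : ∀ i, E i) (y : B), q (∑ i, φ i (x i) + ψ y) ∈ D)
    (hinj : ∀ (x : ∀ i, E i) (y : B), q (∑ i, φ i (x i) + ψ y) = 0 → (∀ i, x i = 0) ∧ y = 0) :
    ∑ i, finrank K (E i) + finrank K B ≤ finrank K D := by
  let Φ : (∀ i, E i) × B →ₗ[K] A :=
    (∑ i, (φ i).comp (LinearMap.proj i)).coprod ψ
  have hΦ (x) : Φ x = ∑ i, φ i (x.1 i) + ψ x.2 := by
    simp [Φ, LinearMap.sum_apply]
  let Ψ : (∀ i, E i) × B →ₗ[K] D := LinearMap.codRestrict D (q.comp Φ) fun x => by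
    rw [LinearMap.comp_apply, hΦ]
    exact hD _ _
  have hΨ : Function.Injective Ψ := by
    refine (injective_iff_map_eq_zero Ψ).2 fun x hx => ?_
    have h1 : q (Φ x) = 0 := congrArg Subtype.val hx
    rw [hΦ] at h1
    exact Prod.ext (funext (hinj _ _ h1).1) (hinj _ _ h1).2
  have := LinearMap.finrank_le_finrank_of_injective hΨ
  rwa [finrank_prod, finrank_pi_fintype] at this

variable {σ : Type} {K : Type} [Field K]

lemma mem_restrictDegree_iff_degreeOf {t : ℕ} {f : MvPolynomial σ K} :
    f ∈ restrictDegree σ K t ↔ ∀ i, degreeOf i f ≤ t := by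
  simp_rw [mem_restrictDegree, degreeOf_le_iff]
  exact ⟨fun h i m hm => h m hm i, fun h m hm i => h i m hm⟩

lemma restrictDegree_mono {s t : ℕ} (h : s ≤ t) : restrictDegree σ K s ≤ restrictDegree σ K t :=
  fun _ hf => mem_restrictDegree_iff_degreeOf.2 fun i =>
    (mem_restrictDegree_iff_degreeOf.1 hf i).trans h

lemma mul_mem_restrictDegree {s t : ℕ} {f g : MvPolynomial σ K} (hf : f ∈ restrictDegree σ K s)
    (hg : g ∈ restrictDegree σ K t) : f * g ∈ restrictDegree σ K (s + t) :=
  mem_restrictDegree_iff_degreeOf.2 fun i => (degreeOf_mul_le i f g).trans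
    (add_le_add (mem_restrictDegree_iff_degreeOf.1 hf i) (mem_restrictDegree_iff_degreeOf.1 hg i))

lemma exists_mem_restrictDegree (f : MvPolynomial σ K) : ∃ t, f ∈ restrictDegree σ K t :=
  ⟨_, mem_restrictDegree_iff_degreeOf.2 fun i => degreeOf_le_totalDegree f i⟩

/-- The quotient map by an ideal, as a linear map. -/
noncomputable def quotMap (Q : Ideal (MvPolynomial σ K)) :
    MvPolynomial σ K →ₗ[K] MvPolynomial σ K ⧸ Q :=
  (Ideal.Quotient.mkₐ K Q).toLinearMap

lemma quotMap_eq_zero_iff {Q : Ideal (MvPolynomial σ K)} {f : MvPolynomial σ K} :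
    quotMap Q f = 0 ↔ f ∈ Q := Ideal.Quotient.eq_zero_iff_mem

variable [Fintype σ]

/-- The box monomials of degree at most `t` in each variable. -/
noncomputable def boxMonomial (t : ℕ) (s : σ → Fin (t + 1)) : MvPolynomial σ K :=
  monomial (Finsupp.equivFunOnFinite.symm fun i => (s i : ℕ)) 1

lemma restrictDegree_le_span (t : ℕ) :
    restrictDegree σ K t ≤ Submodule.span K (Set.range (boxMonomial (K := K) t)) := by
  intro f hf
  rw [mem_restrictDegree] at hf
  rw [f.as_sum]
  refine sum_mem fun m hm => ?_
  rw [show monomial m (coeff m f) = coeff m f • (monomial m 1 : MvPolynomial σ K) by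
    rw [smul_monomial, smul_eq_mul, mul_one]]
  refine Submodule.smul_mem _ _ (Submodule.subset_span
    ⟨fun i => ⟨m i, Nat.lt_succ_of_le (hf m hm i)⟩, ?_⟩)
  exact congrArg (fun m => monomial m 1) (Finsupp.ext fun i => rfl)

instance finiteDimensional_restrictDegree (t : ℕ) : FiniteDimensional K (restrictDegree σ K t) := by
  have : FiniteDimensional K (Submodule.span K (Set.range (boxMonomial (σ := σ) (K := K) t))) :=
    FiniteDimensional.span_of_finite K (Set.finite_range _)
  exact Submodule.finiteDimensional_of_le (restrictDegree_le_span t)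

/-- The Hilbert function with respect to the filtration by degree in each variable. -/
noncomputable def hilb (Q : Ideal (MvPolynomial σ K)) (t : ℕ) : ℕ :=
  finrank K ((restrictDegree σ K t).map (quotMap Q))

lemma hilb_le (Q : Ideal (MvPolynomial σ K)) (t : ℕ) : hilb Q t ≤ (t + 1) ^ Fintype.card σ := by
  classical
  refine (Submodule.finrank_map_le _ _).trans ?_
  have : FiniteDimensional K (Submodule.span K (Set.range (boxMonomial (σ := σ) (K := K) t))) :=
    FiniteDimensional.span_of_finite K (Set.finite_range _)
  refine (Submodule.finrank_mono (restrictDegree_le_span t)).trans ?_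
  refine (finrank_range_le_card _).trans ?_
  simp

lemma le_hilb {Q : Ideal (MvPolynomial σ K)} {J : Finset σ} (hJ : IndepVars Q J) (t : ℕ) :
    (t + 1) ^ J.card ≤ hilb Q t := by
  classical
  let e (s : J → Fin (t + 1)) : σ →₀ ℕ :=
    Finsupp.equivFunOnFinite.symm fun i => if h : i ∈ J then (s ⟨i, h⟩ : ℕ) else 0
  have he : Function.Injective e := by
    intro s s' h
    ext i
    have := DFunLike.congr_fun h i.1
    simpa [e] using this
  have hv (s) : (monomial (e s) 1 : MvPolynomial σ K) ∈ restrictDegree σ K t := by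
    rw [mem_restrictDegree]
    intro m hm i
    rw [Finset.mem_singleton.1 (support_monomial_subset hm)]
    simp only [e, Finsupp.equivFunOnFinite_symm_apply_apply]
    split
    · exact Nat.le_of_lt_succ (Fin.is_lt _)
    · exact Nat.zero_le _
  let v : (J → Fin (t + 1)) → (restrictDegree σ K t).map (quotMap Q) :=
    fun s => ⟨quotMap Q (monomial (e s) 1), Submodule.mem_map_of_mem (hv s)⟩
  have hli : LinearIndependent K v := by
    rw [Fintype.linearIndependent_iff]
    intro g hg s
    have h1 : ∑ s, g s • (monomial (e s) 1 : MvPolynomial σ K) ∈ Q := by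
      rw [← quotMap_eq_zero_iff, map_sum]
      have := congrArg Subtype.val hg
      simpa [v] using this
    have h2 := hJ _ h1 (fun m hm i hi => by
      obtain ⟨s, -, hs⟩ := Finset.mem_biUnion.1 (support_sum hm)
      have hs' := support_monomial_subset (support_smul hs)
      rw [Finset.mem_singleton.1 hs']
      simp [e, hi])
    have h3 := congrArg (coeff (e s)) h2
    simpa [coeff_sum, coeff_monomial, he.eq_iff] using h3
  have := hli.fintype_card_le_finrank
  simpa [hilb] using this

/-- Hilbert functions of the components of a hypersurface section. -/
lemma exists_sum_hilb_add_le {P : Ideal (MvPolynomial σ K)} [P.IsPrime] {n : ℕ}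
    {g : MvPolynomial σ K} (hg : g ∈ restrictDegree σ K n) (hgP : g ∉ P)
    (S : Finset (Ideal (MvPolynomial σ K))) (hS : ∀ Q ∈ S, Q.IsPrime) (hPS : ∀ Q ∈ S, P ≤ Q)
    (hgS : ∀ Q ∈ S, g ∈ Q) (hanti : ∀ Q ∈ S, ∀ Q' ∈ S, Q ≤ Q' → Q = Q') :
    ∃ c, ∀ t, ∑ Q ∈ S, hilb Q t + hilb P (t + c) ≤ hilb P (t + c + n) := by
  classical
  have hex (Q : S) : ∃ e : MvPolynomial σ K, e ∉ Q.1 ∧ ∀ Q' ∈ S, Q' ≠ Q.1 → e ∈ Q' := by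
    have := hS Q.1 Q.2
    have h1 : ¬ (S.erase Q.1).inf id ≤ Q.1 := fun h => by
      obtain ⟨Q', hQ', hle⟩ := (Ideal.IsPrime.inf_le' this).1 h
      rw [Finset.mem_erase] at hQ'
      exact hQ'.1 (hanti _ hQ'.2 _ Q.2 hle)
    obtain ⟨e, he, heQ⟩ := SetLike.not_le_iff_exists.1 h1
    refine ⟨e, heQ, fun Q' hQ' hne => ?_⟩
    exact Finset.inf_le (f := id) (Finset.mem_erase.2 ⟨hne, hQ'⟩) he
  choose e heQ heQ' using hex
  have hdeg : ∃ c, ∀ Q, e Q ∈ restrictDegree σ K c := by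
    choose d hd using fun Q => exists_mem_restrictDegree (e Q)
    exact ⟨Finset.univ.sup d, fun Q => restrictDegree_mono
      (Finset.le_sup (f := d) (Finset.mem_univ Q)) (hd Q)⟩
  obtain ⟨c, hc⟩ := hdeg
  refine ⟨c, fun t => ?_⟩
  have hsec (Q : Ideal (MvPolynomial σ K)) (t : ℕ) :
      ∃ s : (restrictDegree σ K t).map (quotMap Q) →ₗ[K] MvPolynomial σ K,
        ∀ x, s x ∈ restrictDegree σ K t ∧ quotMap Q (s x) = x :=
    exists_section_map _ _
  choose s hsD using fun (Q : S) => hsec Q.1 t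
  obtain ⟨r, hr⟩ := hsec P (t + c)
  have key := sum_finrank_add_le_of_injective
    (E := fun Q : S => (restrictDegree σ K t).map (quotMap Q.1))
    (B := (restrictDegree σ K (t + c)).map (quotMap P))
    (fun Q : S => (LinearMap.mulLeft K (e Q)).comp (s Q)) ((LinearMap.mulLeft K g).comp r)
    (quotMap P) ((restrictDegree σ K (t + c + n)).map (quotMap P)) ?_ ?_
  · rw [← Finset.sum_coe_sort S]
    exact key
  · intro x y
    refine Submodule.mem_map_of_mem (add_mem (sum_mem fun Q _ =>
      restrictDegree_mono (show c + t ≤ t + c + n by omega)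
      (mul_mem_restrictDegree (hc Q) (hsD Q _).1))
      (restrictDegree_mono (show n + (t + c) ≤ t + c + n by omega)
      (mul_mem_restrictDegree hg (hr _).1)))
  · intro x y hx
    have h1 : ∑ Q : S, e Q * s Q (x Q) + g * r y ∈ P := quotMap_eq_zero_iff.1 hx
    have h2 (Q : S) : x Q = 0 := by
      have hQ := hS Q.1 Q.2
      have h3 : ∑ Q : S, e Q * s Q (x Q) ∈ Q.1 :=
        (Ideal.add_mem_iff_left _ (Ideal.mul_mem_right _ _ (hgS Q.1 Q.2))).1 (hPS Q.1 Q.2 h1)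
      rw [← Finset.add_sum_erase _ _ (Finset.mem_univ Q)] at h3
      have h4 := (Ideal.add_mem_iff_left _ (Ideal.sum_mem _ fun Q' hQ' => Ideal.mul_mem_right _ _
        (heQ' Q' Q.1 Q.2 fun h => (Finset.mem_erase.1 hQ').1 (Subtype.ext h.symm)))).1 h3
      have h5 := (hQ.mem_or_mem h4).resolve_left (heQ Q)
      rw [← quotMap_eq_zero_iff, (hsD Q _).2] at h5
      exact Subtype.ext h5
    refine ⟨h2, ?_⟩
    have h5 : g * r y ∈ P := by simpa [h2] using h1
    have h6 := (Ideal.IsPrime.mem_or_mem ‹_› h5).resolve_left hgP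
    rw [← quotMap_eq_zero_iff, (hr _).2] at h6
    exact Subtype.ext h6

end HilbertFunction

end MixedIdentity

namespace MixedIdentity

section HilbertSeries

open MvPolynomial Filter Topology

lemma choose_le_succ_pow (t j : ℕ) : (t + j).choose j ≤ (t + 1) ^ j := by
  induction j with
  | zero => simp
  | succ j ih =>
    have h := Nat.add_one_mul_choose_eq (t + j) j
    have h2 : t + j + 1 ≤ (t + 1) * (j + 1) := by nlinarith [Nat.zero_le (t * j)]
    refine Nat.le_of_mul_le_mul_right ?_ (Nat.succ_pos j)
    calc (t + (j + 1)).choose (j + 1) * (j + 1) = (t + j + 1) * (t + j).choose j := h.symm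
      _ ≤ (t + 1) * (j + 1) * (t + 1) ^ j := Nat.mul_le_mul h2 ih
      _ = (t + 1) ^ (j + 1) * (j + 1) := by ring

lemma succ_pow_le_choose (t N : ℕ) : (t + 1) ^ N ≤ N.factorial * (t + N).choose N :=
  (Nat.pow_succ_le_ascFactorial (t + 1) N).trans_eq (Nat.ascFactorial_eq_factorial_mul_choose t N)

lemma tsum_shift_le {a b : ℕ → ℝ} {c n : ℕ} {z : ℝ} (hz : 0 ≤ z) (hz1 : z ≤ 1)
    (ha0 : ∀ t, 0 ≤ a t) (ha : Summable fun t => a t * z ^ t) (hb : Summable fun t => b t * z ^ t)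
    (hab : ∀ t, b t + a (t + c) ≤ a (t + c + n)) :
    z ^ (c + n) * ∑' t, b t * z ^ t ≤ (1 - z ^ n) * ∑' t, a t * z ^ t := by
  have h1 := ha.sum_add_tsum_nat_add (c + n)
  have h2 := ha.sum_add_tsum_nat_add c
  have hs1 := (summable_nat_add_iff (c + n)).2 ha
  have hs2 := (summable_nat_add_iff c).2 ha
  have h3 : z ^ (c + n) * (∑' t, b t * z ^ t) + z ^ n * ∑' t, a (t + c) * z ^ (t + c) ≤
      ∑' t, a (t + (c + n)) * z ^ (t + (c + n)) := by
    rw [← tsum_mul_left, ← tsum_mul_left, ← (hb.mul_left _).tsum_add (hs2.mul_left _)]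
    refine ((hb.mul_left _).add (hs2.mul_left _)).tsum_le_tsum (fun t => ?_) hs1
    calc z ^ (c + n) * (b t * z ^ t) + z ^ n * (a (t + c) * z ^ (t + c))
        = (b t + a (t + c)) * z ^ (t + (c + n)) := by ring
      _ ≤ a (t + (c + n)) * z ^ (t + (c + n)) :=
        mul_le_mul_of_nonneg_right (by rw [← add_assoc]; exact hab t) (pow_nonneg hz _)
  have h4 : z ^ n * ∑ i ∈ Finset.range c, a i * z ^ i ≤
      ∑ i ∈ Finset.range (c + n), a i * z ^ i := by
    have h5 : ∑ i ∈ Finset.range c, a i * z ^ i ≤ ∑ i ∈ Finset.range (c + n), a i * z ^ i :=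
      Finset.sum_le_sum_of_subset_of_nonneg (Finset.range_mono (Nat.le_add_right _ _))
        fun i _ _ => mul_nonneg (ha0 i) (pow_nonneg hz _)
    have h6 : 0 ≤ ∑ i ∈ Finset.range c, a i * z ^ i :=
      Finset.sum_nonneg fun i _ => mul_nonneg (ha0 i) (pow_nonneg hz _)
    exact (mul_le_of_le_one_left h6 (pow_le_one₀ hz hz1)).trans h5
  have h7 : z ^ n * ∑' t, a t * z ^ t = z ^ n * ∑ i ∈ Finset.range c, a i * z ^ i +
      z ^ n * ∑' t, a (t + c) * z ^ (t + c) := by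
    rw [← mul_add, h2]
  linarith

variable {σ : Type} {K : Type} [Field K]

/-- The Hilbert series. -/
noncomputable def hser (Q : Ideal (MvPolynomial σ K)) (z : ℝ) : ℝ := ∑' t, (hilb Q t : ℝ) * z ^ t

lemma hser_nonneg (Q : Ideal (MvPolynomial σ K)) {z : ℝ} (hz : 0 ≤ z) : 0 ≤ hser Q z :=
  tsum_nonneg fun t => by positivity

variable [Fintype σ]

lemma hilb_le_choose (Q : Ideal (MvPolynomial σ K)) (t : ℕ) :
    (hilb Q t : ℝ) ≤ ((Fintype.card σ).factorial : ℝ) *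
      ((t + Fintype.card σ).choose (Fintype.card σ) : ℝ) := by
  exact_mod_cast (hilb_le Q t).trans (succ_pow_le_choose t _)

lemma summable_hser (Q : Ideal (MvPolynomial σ K)) {z : ℝ} (hz : 0 ≤ z) (hz1 : z < 1) :
    Summable fun t => (hilb Q t : ℝ) * z ^ t := by
  have h := (summable_choose_mul_geometric_of_norm_lt_one (Fintype.card σ)
    (show ‖z‖ < 1 by rwa [Real.norm_of_nonneg hz])).mul_left ((Fintype.card σ).factorial : ℝ)
  refine Summable.of_nonneg_of_le (fun t => by positivity) (fun t => ?_) h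
  rw [← mul_assoc]
  exact mul_le_mul_of_nonneg_right (hilb_le_choose Q t) (pow_nonneg hz _)

lemma hser_mul_le (Q : Ideal (MvPolynomial σ K)) {z : ℝ} (hz : 0 ≤ z) (hz1 : z < 1) :
    hser Q z * (1 - z) ^ (Fintype.card σ + 1) ≤ (Fintype.card σ).factorial := by
  have hz' : ‖z‖ < 1 := by rwa [Real.norm_of_nonneg hz]
  have h := (summable_choose_mul_geometric_of_norm_lt_one (Fintype.card σ) hz').mul_left
    ((Fintype.card σ).factorial : ℝ)
  have h1 : hser Q z ≤ (Fintype.card σ).factorial * (1 / (1 - z) ^ (Fintype.card σ + 1)) := by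
    rw [← tsum_choose_mul_geometric_of_norm_lt_one _ hz', ← tsum_mul_left]
    refine (summable_hser Q hz hz1).tsum_le_tsum (fun t => ?_) h
    rw [← mul_assoc]
    exact mul_le_mul_of_nonneg_right (hilb_le_choose Q t) (pow_nonneg hz _)
  have h2 : 0 < (1 - z) ^ (Fintype.card σ + 1) := pow_pos (by linarith) _
  rwa [mul_one_div, le_div_iff₀ h2] at h1

lemma one_le_hser_mul {Q : Ideal (MvPolynomial σ K)} [Q.IsPrime] {ℓ : ℕ} (hQ : Q.height ≤ ℓ)
    {z : ℝ} (hz : 0 ≤ z) (hz1 : z < 1) :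
    (1 - z) ^ ℓ ≤ hser Q z * (1 - z) ^ (Fintype.card σ + 1) := by
  have hz' : ‖z‖ < 1 := by rwa [Real.norm_of_nonneg hz]
  obtain ⟨J, hJ, hcard⟩ := exists_indepVars Q
  have hle : Fintype.card σ ≤ J.card + ℓ := by
    have := hcard.trans (add_le_add le_rfl hQ)
    exact_mod_cast this
  have h1 : 1 / (1 - z) ^ (J.card + 1) ≤ hser Q z := by
    rw [← tsum_choose_mul_geometric_of_norm_lt_one _ hz']
    refine (summable_choose_mul_geometric_of_norm_lt_one _ hz').tsum_le_tsum (fun t => ?_)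
      (summable_hser Q hz hz1)
    refine mul_le_mul_of_nonneg_right ?_ (pow_nonneg hz _)
    exact_mod_cast (choose_le_succ_pow t _).trans (le_hilb hJ t)
  have hu : 0 < 1 - z := by linarith
  rw [div_le_iff₀ (pow_pos hu _)] at h1
  have hu1 : 1 - z ≤ 1 := by linarith
  have h2 : (1 - z) ^ (J.card + 1 + ℓ) ≤ (1 - z) ^ (Fintype.card σ + 1) :=
    pow_le_pow_of_le_one hu.le hu1 (by omega)
  calc (1 - z) ^ ℓ = 1 * (1 - z) ^ ℓ := (one_mul _).symm
    _ ≤ hser Q z * (1 - z) ^ (J.card + 1) * (1 - z) ^ ℓ :=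
      mul_le_mul_of_nonneg_right h1 (pow_nonneg hu.le _)
    _ = hser Q z * (1 - z) ^ (J.card + 1 + ℓ) := by ring
    _ ≤ _ := mul_le_mul_of_nonneg_left h2 (hser_nonneg Q hz)

lemma eventually_sum_hser_le {P : Ideal (MvPolynomial σ K)} [P.IsPrime] {n : ℕ}
    {g : MvPolynomial σ K} (hg : g ∈ restrictDegree σ K n) (hgP : g ∉ P)
    (S : Finset (Ideal (MvPolynomial σ K))) (hS : ∀ Q ∈ S, Q.IsPrime) (hPS : ∀ Q ∈ S, P ≤ Q)
    (hgS : ∀ Q ∈ S, g ∈ Q) (hanti : ∀ Q ∈ S, ∀ Q' ∈ S, Q ≤ Q' → Q = Q') :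
    ∀ᶠ z in 𝓝[<] (1 : ℝ), ∑ Q ∈ S, hser Q z ≤ 2 * n * (1 - z) * hser P z := by
  obtain ⟨c, hc⟩ := exists_sum_hilb_add_le hg hgP S hS hPS hgS hanti
  have h1 : ∀ᶠ z in 𝓝[<] (1 : ℝ), 1 / 2 < z ^ (c + n) := by
    refine (((continuous_pow (c + n)).tendsto (1 : ℝ)).mono_left nhdsWithin_le_nhds).eventually ?_
    exact lt_mem_nhds (by norm_num)
  have h2 : ∀ᶠ z in 𝓝[<] (1 : ℝ), 0 < z := mem_nhdsWithin_of_mem_nhds (lt_mem_nhds zero_lt_one)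
  filter_upwards [h1, h2, self_mem_nhdsWithin] with z hz1 hz2 (hz3 : z < 1)
  have hsum : ∑ Q ∈ S, hser Q z = ∑' t, (∑ Q ∈ S, (hilb Q t : ℝ)) * z ^ t := by
    simp_rw [Finset.sum_mul]
    exact (Summable.tsum_finsetSum fun Q _ => summable_hser Q hz2.le hz3).symm
  have hsm : Summable fun t => (∑ Q ∈ S, (hilb Q t : ℝ)) * z ^ t := by
    simp_rw [Finset.sum_mul]
    exact summable_sum fun Q _ => summable_hser Q hz2.le hz3
  have h3 := tsum_shift_le (a := fun t => (hilb P t : ℝ)) hz2.le hz3.le (fun t => by positivity)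
    (summable_hser P hz2.le hz3) hsm (c := c) (n := n) (fun t => by exact_mod_cast hc t)
  rw [← hsum] at h3
  have h4 : 1 - z ^ n ≤ n * (1 - z) := by
    have := one_add_mul_sub_le_pow (show (-1 : ℝ) ≤ z by linarith) n
    linarith
  have h5 := mul_le_mul_of_nonneg_right h4 (hser_nonneg P hz2.le)
  have h6 : 0 ≤ ∑ Q ∈ S, hser Q z := Finset.sum_nonneg fun Q _ => hser_nonneg Q hz2.le
  have h7 : 1 / 2 * ∑ Q ∈ S, hser Q z ≤ z ^ (c + n) * ∑ Q ∈ S, hser Q z :=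
    mul_le_mul_of_nonneg_right hz1.le h6
  change _ ≤ (1 - z ^ n) * hser P z at h3
  linarith

end HilbertSeries

end MixedIdentity

namespace MixedIdentity

section Components

open MvPolynomial Filter Topology

variable {σ : Type} {K : Type} [Field K]

lemma exists_mem_span_forall_notMem [Infinite K] (E : Set (MvPolynomial σ K))
    (S : Finset (Ideal (MvPolynomial σ K))) (hS : ∀ P ∈ S, ¬ Ideal.span E ≤ P) :
    ∃ g ∈ Submodule.span K E, ∀ P ∈ S, g ∉ P := by
  classical
  let V := Submodule.span K E
  let c (P : Ideal (MvPolynomial σ K)) : Subspace K V :=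
    (P.restrictScalars K).comap V.subtype
  have h := Subspace.biUnion_ne_univ_of_top_notMem (s := S.image c) (by
    intro h
    obtain ⟨P, hP, hc⟩ := Finset.mem_image.1 h
    refine hS P hP (Ideal.span_le.2 fun e he => ?_)
    have : (⟨e, Submodule.subset_span he⟩ : V) ∈ c P := hc ▸ Submodule.mem_top
    exact this)
  obtain ⟨g, hg⟩ := (Set.ne_univ_iff_exists_notMem _).1 h
  refine ⟨g, g.2, fun P hP hgP => hg ?_⟩
  exact Set.mem_biUnion (Finset.mem_coe.2 (Finset.mem_image_of_mem c hP)) hgP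

variable [Fintype σ]

lemma height_le_card (Q : Ideal (MvPolynomial σ K)) [Q.IsPrime] :
    Q.height ≤ (Fintype.card σ : ℕ∞) := by
  have h := Ideal.height_le_ringKrullDim_of_ne_top (I := Q) Ideal.IsPrime.ne_top'
  rw [MvPolynomial.ringKrullDim_of_isNoetherianRing, ringKrullDim_eq_zero_of_field, zero_add,
    Nat.card_eq_fintype_card] at h
  exact_mod_cast h

/-- Each stage has few primes. -/
lemma card_le_of_eventually {n ℓ : ℕ} {T : Finset (Ideal (MvPolynomial σ K))}
    (hT : ∀ Q ∈ T, Q.IsPrime ∧ Q.height ≤ ℓ)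
    (h : ∀ᶠ z in 𝓝[<] (1 : ℝ), ∑ Q ∈ T, hser Q z ≤
        (2 * n * (1 - z)) ^ ℓ * hser (⊥ : Ideal (MvPolynomial σ K)) z) :
    T.card ≤ (Fintype.card σ).factorial * (2 * n) ^ ℓ := by
  have h2 : ∀ᶠ z in 𝓝[<] (1 : ℝ), 0 < z := mem_nhdsWithin_of_mem_nhds (lt_mem_nhds zero_lt_one)
  obtain ⟨z, hz, hz0, hz1⟩ := (h.and (h2.and self_mem_nhdsWithin)).exists
  have hu : (0 : ℝ) < 1 - z := by simpa using hz1
  set N := Fintype.card σ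
  have h3 : (T.card : ℝ) * (1 - z) ^ ℓ ≤ ∑ Q ∈ T, hser Q z * (1 - z) ^ (N + 1) := by
    rw [← nsmul_eq_mul]
    refine Finset.card_nsmul_le_sum _ _ _ fun Q hQ => ?_
    have := (hT Q hQ).1
    exact one_le_hser_mul (hT Q hQ).2 hz0.le hz1
  have h4 : ((T.card : ℝ)) * (1 - z) ^ ℓ ≤ (N.factorial * (2 * n) ^ ℓ : ℝ) * (1 - z) ^ ℓ := by
    calc (T.card : ℝ) * (1 - z) ^ ℓ ≤ (∑ Q ∈ T, hser Q z) * (1 - z) ^ (N + 1) := by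
          rwa [Finset.sum_mul]
      _ ≤ (2 * n * (1 - z)) ^ ℓ * hser (⊥ : Ideal (MvPolynomial σ K)) z * (1 - z) ^ (N + 1) :=
          mul_le_mul_of_nonneg_right hz (pow_nonneg hu.le _)
      _ = (2 * n * (1 - z)) ^ ℓ * (hser (⊥ : Ideal (MvPolynomial σ K)) z * (1 - z) ^ (N + 1)) := by
          ring
      _ ≤ (2 * n * (1 - z)) ^ ℓ * N.factorial :=
          mul_le_mul_of_nonneg_left (hser_mul_le _ hz0.le hz1) (by positivity)
      _ = _ := by rw [mul_pow _ (1 - z)]; ring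
  exact_mod_cast le_of_mul_le_mul_right h4 (pow_pos hu _)

/-- The state after `ℓ` generic cuts inside the linear span of `E`. -/
lemma exists_generic_cut [Infinite K] {n : ℕ} (E : Set (MvPolynomial σ K))
    (hE : E ⊆ restrictDegree σ K n) (ℓ : ℕ) :
    ∃ (G : Finset (MvPolynomial σ K)) (T D : Finset (Ideal (MvPolynomial σ K))),
      G.card ≤ ℓ ∧ (G : Set (MvPolynomial σ K)) ⊆ Ideal.span E ∧
      (∀ Q ∈ T, Q ∈ (Ideal.span (G : Set (MvPolynomial σ K))).minimalPrimes) ∧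
      (∀ P ∈ (Ideal.span (G : Set (MvPolynomial σ K))).minimalPrimes, ¬ Ideal.span E ≤ P →
        P ∈ T ∧ (ℓ : ℕ∞) ≤ P.height) ∧
      (∀ᶠ z in 𝓝[<] (1 : ℝ), ∑ Q ∈ T, hser Q z ≤
        (2 * n * (1 - z)) ^ ℓ * hser (⊥ : Ideal (MvPolynomial σ K)) z) ∧
      D.card ≤ ∑ k ∈ Finset.range ℓ, (Fintype.card σ).factorial * (2 * n) ^ k ∧
      ∀ M ∈ (Ideal.span E).minimalPrimes, M ∈ D ∨ M ∈ T ∨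
        ∃ P ∈ (Ideal.span (G : Set (MvPolynomial σ K))).minimalPrimes, P < M := by
  classical
  induction ℓ with
  | zero =>
    have hbot : (Ideal.span ((∅ : Finset (MvPolynomial σ K)) : Set (MvPolynomial σ K))).minimalPrimes
        = {⊥} := by
      rw [Finset.coe_empty, Ideal.span_empty]
      exact IsDomain.minimalPrimes_eq_singleton_bot _
    refine ⟨∅, {⊥}, ∅, le_rfl, by simp, ?_, ?_, ?_, by simp, ?_⟩
    · rw [hbot]; simp
    · rw [hbot]; simp
    · refine Eventually.of_forall fun z => ?_
      simp
    · intro M hM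
      rw [hbot]
      rcases eq_or_ne M ⊥ with h | h
      · exact Or.inr (Or.inl (by simp [h]))
      · exact Or.inr (Or.inr ⟨⊥, rfl, bot_lt_iff_ne_bot.2 h⟩)
  | succ ℓ ih =>
    obtain ⟨G, T, D, hG, hGI, hT, hmin, hev, hD, hcov⟩ := ih
    have hTprime (P) (hP : P ∈ T) : P.IsPrime := (hT P hP).1.1
    obtain ⟨g, hgE, hg⟩ := exists_mem_span_forall_notMem E
      {P ∈ T | ¬ Ideal.span E ≤ P} (fun P hP => (Finset.mem_filter.1 hP).2)
    replace hg (P) (hP : P ∈ T) (hI : ¬ Ideal.span E ≤ P) : g ∉ P :=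
      hg P (Finset.mem_filter.2 ⟨hP, hI⟩)
    have hgI : g ∈ Ideal.span E := Submodule.span_le_restrictScalars K _ E hgE
    have hgn : g ∈ restrictDegree σ K n := Submodule.span_le.2 hE hgE
    set J := Ideal.span (G : Set (MvPolynomial σ K)) with hJ
    set J' := Ideal.span ((insert g G : Finset (MvPolynomial σ K)) : Set (MvPolynomial σ K))
    have hJJ' : J ≤ J' := Ideal.span_mono (by simp)
    have hgJ' : g ∈ J' := Ideal.subset_span (by simp)
    have hGI' : ((insert g G : Finset (MvPolynomial σ K)) : Set (MvPolynomial σ K)) ⊆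
        Ideal.span E := by
      rw [Finset.coe_insert]
      exact Set.insert_subset hgI hGI
    let T' : Finset (Ideal (MvPolynomial σ K)) :=
      {Q ∈ (Ideal.finite_minimalPrimes_of_isNoetherianRing _ J').toFinset |
        ∃ P ∈ T, ¬ Ideal.span E ≤ P ∧ P ≤ Q}
    have hT' (Q) : Q ∈ T' ↔ Q ∈ J'.minimalPrimes ∧ ∃ P ∈ T, ¬ Ideal.span E ≤ P ∧ P ≤ Q := by
      simp [T']
    refine ⟨insert g G, T', D ∪ T, (Finset.card_insert_le _ _).trans (by omega), hGI',
      fun Q hQ => ((hT' Q).1 hQ).1, ?_, ?_, ?_, ?_⟩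
    · intro Q hQ hIQ
      have := hQ.1.1
      obtain ⟨P, hP, hPQ⟩ := Ideal.exists_minimalPrimes_le (hJJ'.trans hQ.1.2)
      have hIP : ¬ Ideal.span E ≤ P := fun h => hIQ (h.trans hPQ)
      obtain ⟨hPT, hht⟩ := hmin P hP hIP
      refine ⟨(hT' Q).2 ⟨hQ, P, hPT, hIP, hPQ⟩, ?_⟩
      have := hTprime P hPT
      have hlt : P < Q := lt_of_le_of_ne hPQ fun h => hg P hPT hIP (h ▸ hQ.1.2 hgJ')
      refine le_trans ?_ (Ideal.height_add_one_le_of_lt_of_isPrime hlt)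
      push_cast
      exact add_le_add hht le_rfl
    · have hev2 : ∀ P ∈ T, ∀ᶠ z in 𝓝[<] (1 : ℝ), (¬ Ideal.span E ≤ P →
          ∑ Q ∈ T' with P ≤ Q, hser Q z ≤ 2 * n * (1 - z) * hser P z) := by
        intro P hP
        by_cases hIP : Ideal.span E ≤ P
        · exact Eventually.of_forall fun z h => absurd hIP h
        have := hTprime P hP
        refine (eventually_sum_hser_le hgn (hg P hP hIP) {Q ∈ T' | P ≤ Q} ?_ ?_ ?_ ?_).mono
          fun z hz _ => hz
        · exact fun Q hQ => ((hT' Q).1 (Finset.mem_filter.1 hQ).1).1.1.1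
        · exact fun Q hQ => (Finset.mem_filter.1 hQ).2
        · exact fun Q hQ => ((hT' Q).1 (Finset.mem_filter.1 hQ).1).1.1.2 hgJ'
        · intro Q hQ Q' hQ' hle
          have h1 := ((hT' Q).1 (Finset.mem_filter.1 hQ).1).1
          have h2 := ((hT' Q').1 (Finset.mem_filter.1 hQ').1).1
          exact le_antisymm hle (h2.2 h1.1 hle)
      have h2 : ∀ᶠ z in 𝓝[<] (1 : ℝ), 0 < z :=
        mem_nhdsWithin_of_mem_nhds (lt_mem_nhds zero_lt_one)
      filter_upwards [hev, (eventually_all_finset T).2 hev2, h2, self_mem_nhdsWithin]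
        with z hz1 hz2 hz0 (hz : z < 1)
      have hu : 0 < 1 - z := by linarith
      calc ∑ Q ∈ T', hser Q z
          ≤ ∑ Q ∈ T', ∑ P ∈ T with ¬ Ideal.span E ≤ P ∧ P ≤ Q, hser Q z := by
            refine Finset.sum_le_sum fun Q hQ => ?_
            obtain ⟨P, hP, hIP, hPQ⟩ := ((hT' Q).1 hQ).2
            exact Finset.single_le_sum (f := fun _ => hser Q z)
              (fun _ _ => hser_nonneg Q hz0.le) (Finset.mem_filter.2 ⟨hP, hIP, hPQ⟩)
        _ = ∑ P ∈ T, ∑ Q ∈ T' with ¬ Ideal.span E ≤ P ∧ P ≤ Q, hser Q z := by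
            simp_rw [Finset.sum_filter]
            exact Finset.sum_comm
        _ ≤ ∑ P ∈ T, 2 * n * (1 - z) * hser P z := by
            refine Finset.sum_le_sum fun P hP => ?_
            by_cases hIP : Ideal.span E ≤ P
            · simp only [hIP, not_true_eq_false, false_and, Finset.filter_false,
                Finset.sum_empty]
              have := hser_nonneg P hz0.le
              positivity
            · simpa [hIP] using hz2 P hP hIP
        _ = 2 * n * (1 - z) * ∑ P ∈ T, hser P z := by rw [Finset.mul_sum]
        _ ≤ 2 * n * (1 - z) * ((2 * n * (1 - z)) ^ ℓ * hser ⊥ z) :=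
            mul_le_mul_of_nonneg_left hz1 (by positivity)
        _ = _ := by ring
    · have hTc := card_le_of_eventually (fun Q hQ => ⟨hTprime Q hQ,
        (Ideal.height_le_card_of_mem_minimalPrimes_span_finset (hT Q hQ)).trans
          (Nat.cast_le.2 hG)⟩) hev
      rw [Finset.sum_range_succ]
      exact (Finset.card_union_le _ _).trans (add_le_add hD hTc)
    · intro M hM
      rcases hcov M hM with h | h | ⟨P, hP, hPM⟩
      · exact Or.inl (Finset.mem_union_left _ h)
      · exact Or.inl (Finset.mem_union_right _ h)
      · right
        have := hM.1.1
        obtain ⟨Q, hQ, hQM⟩ := Ideal.exists_minimalPrimes_le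
          ((Ideal.span_le.2 hGI').trans hM.1.2 : J' ≤ M)
        rcases hQM.lt_or_eq with hlt | rfl
        · exact Or.inr ⟨Q, hQ, hlt⟩
        · left
          obtain ⟨P', hP', hPM'⟩ := Ideal.exists_minimalPrimes_le (hJJ'.trans hQ.1.2)
          have hlt : P' < Q := lt_of_le_of_ne hPM' fun h =>
            hPM.not_ge ((h ▸ hP').2 hP.1 hPM.le)
          have hIP' : ¬ Ideal.span E ≤ P' := fun h => hlt.not_ge (hM.2 ⟨hP'.1.1, h⟩ hPM')
          exact (hT' Q).2 ⟨hQ, P', (hmin P' hP' hIP').1, hIP', hPM'⟩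

/-- The number of components of a variety defined by equations of bounded degree. -/
theorem ncard_minimalPrimes_le [Infinite K] {n : ℕ} (E : Set (MvPolynomial σ K))
    (hE : E ⊆ restrictDegree σ K n) :
    (Ideal.span E).minimalPrimes.ncard ≤
      ∑ k ∈ Finset.range (Fintype.card σ + 2), (Fintype.card σ).factorial * (2 * n) ^ k := by
  classical
  obtain ⟨G, T, D, hG, -, hT, hmin, hev, hD, hcov⟩ := exists_generic_cut E hE (Fintype.card σ + 1)
  have hTc := card_le_of_eventually (fun Q hQ => ⟨(hT Q hQ).1.1,
    (Ideal.height_le_card_of_mem_minimalPrimes_span_finset (hT Q hQ)).trans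
      (Nat.cast_le.2 hG)⟩) hev
  have hsub : (Ideal.span E).minimalPrimes ⊆ ((D ∪ T : Finset _) : Set _) := by
    intro M hM
    rw [Finset.coe_union]
    rcases hcov M hM with h | h | ⟨P, hP, hPM⟩
    · exact Or.inl h
    · exact Or.inr h
    · exfalso
      have := hP.1.1
      have h1 : ¬ Ideal.span E ≤ P := fun h => hPM.not_ge (hM.2 ⟨this, h⟩ hPM.le)
      have h2 := (hmin P hP h1).2.trans (height_le_card P)
      have : Fintype.card σ + 1 ≤ Fintype.card σ := by exact_mod_cast h2
      omega
  calc _ ≤ (D ∪ T).card := by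
        rw [← Set.ncard_coe_finset]; exact Set.ncard_le_ncard hsub (Finset.finite_toSet _)
    _ ≤ D.card + T.card := Finset.card_union_le _ _
    _ ≤ _ := by rw [Finset.sum_range_succ]; exact add_le_add hD hTc

lemma exists_ncard_minimalPrimes_le (σ K : Type) [Fintype σ] [Field K] [Infinite K] :
    ∃ C : ℕ, ∀ n, 1 ≤ n → ∀ E : Set (MvPolynomial σ K), (∀ f ∈ E, f.totalDegree ≤ n) →
      (Ideal.span E).minimalPrimes.ncard ≤ C * n ^ (Fintype.card σ + 1) := by
  refine ⟨∑ k ∈ Finset.range (Fintype.card σ + 2), (Fintype.card σ).factorial * 2 ^ k,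
    fun n hn E hE => (ncard_minimalPrimes_le E (n := n) fun f hf =>
      mem_restrictDegree_iff_degreeOf.2 fun i =>
        (degreeOf_le_totalDegree f i).trans (hE f hf)).trans ?_⟩
  rw [Finset.sum_mul]
  refine Finset.sum_le_sum fun k hk => ?_
  rw [mul_pow, ← mul_assoc]
  exact Nat.mul_le_mul_left _ (Nat.pow_le_pow_right hn (by
    rw [Finset.mem_range] at hk; omega))

end Components

end MixedIdentity

namespace MixedIdentity

section MatrixPolynomials

open MvPolynomial

variable {d : ℕ}

/-- Polynomial functions on `d × d` matrices. -/
abbrev MatPoly (d : ℕ) : Type := MvPolynomial (Fin d × Fin d) ℂ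

/-- Evaluation of a polynomial at a matrix. -/
noncomputable def ev (p : Matrix (Fin d) (Fin d) ℂ) : MatPoly d →ₐ[ℂ] ℂ :=
  aeval fun ik => p ik.1 ik.2

/-- Precomposition with left multiplication by a matrix. -/
noncomputable def ltrans (g : Matrix (Fin d) (Fin d) ℂ) : MatPoly d →ₐ[ℂ] MatPoly d :=
  aeval fun ik => ∑ j, C (g ik.1 j) * X (j, ik.2)

/-- Precomposition with right multiplication by a matrix. -/
noncomputable def rtrans (g : Matrix (Fin d) (Fin d) ℂ) : MatPoly d →ₐ[ℂ] MatPoly d :=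
  aeval fun ik => ∑ j, X (ik.1, j) * C (g j ik.2)

lemma ev_ltrans (p g : Matrix (Fin d) (Fin d) ℂ) (f : MatPoly d) :
    ev p (ltrans g f) = ev (g * p) f := by
  have : (ev p).comp (ltrans g) = ev (g * p) :=
    algHom_ext fun ik => by simp [ev, ltrans, Matrix.mul_apply]
  exact DFunLike.congr_fun this f

lemma ev_rtrans (p g : Matrix (Fin d) (Fin d) ℂ) (f : MatPoly d) :
    ev p (rtrans g f) = ev (p * g) f := by
  have : (ev p).comp (rtrans g) = ev (p * g) :=
    algHom_ext fun ik => by simp [ev, rtrans, Matrix.mul_apply]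
  exact DFunLike.congr_fun this f

lemma ltrans_ltrans (g h : Matrix (Fin d) (Fin d) ℂ) (f : MatPoly d) :
    ltrans h (ltrans g f) = ltrans (g * h) f := by
  have : (ltrans h).comp (ltrans g) = ltrans (g * h) := algHom_ext fun ik => by
    simp only [ltrans, AlgHom.comp_apply, aeval_X, map_sum, map_mul, Matrix.mul_apply,
      Finset.sum_mul, Finset.mul_sum, algHom_C, algebraMap_eq]
    rw [Finset.sum_comm]
    simp only [mul_assoc]
  exact DFunLike.congr_fun this f

lemma ltrans_one (f : MatPoly d) : ltrans 1 f = f := by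
  have : ltrans (1 : Matrix (Fin d) (Fin d) ℂ) = AlgHom.id ℂ _ := algHom_ext fun ik => by
    simp [ltrans, Matrix.one_apply]
  exact DFunLike.congr_fun this f

lemma totalDegree_aeval_le {σ τ K : Type*} [Fintype σ] [Field K] (g : σ → MvPolynomial τ K)
    (hg : ∀ i, (g i).totalDegree ≤ 1) (f : MvPolynomial σ K) :
    (aeval g f).totalDegree ≤ f.totalDegree := by
  rw [aeval_def, eval₂_eq']
  refine totalDegree_finsetSum_le fun m hm => ?_
  refine (totalDegree_mul _ _).trans ?_
  rw [algebraMap_eq, totalDegree_C, zero_add]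
  refine (totalDegree_finsetProd _ _).trans ?_
  refine le_trans (Finset.sum_le_sum (g := fun i => m i) fun i _ => ?_) ?_
  · exact (totalDegree_pow _ _).trans ((Nat.mul_le_mul_left _ (hg i)).trans_eq (mul_one _))
  · refine le_trans (le_of_eq ?_) (le_totalDegree hm)
    rw [Finsupp.sum_fintype _ _ fun _ => rfl]

lemma totalDegree_ltrans_le (g : Matrix (Fin d) (Fin d) ℂ) (f : MatPoly d) :
    (ltrans g f).totalDegree ≤ f.totalDegree :=
  totalDegree_aeval_le _ (fun ik => totalDegree_finsetSum_le fun j _ =>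
    (totalDegree_mul _ _).trans (by simp [totalDegree_C])) f

/-- Left translation by an invertible matrix, as a ring automorphism. -/
noncomputable def ltransEquiv (g : GL (Fin d) ℂ) : MatPoly d ≃+* MatPoly d :=
  RingEquiv.ofRingHom (ltrans g.1 : MatPoly d →+* MatPoly d) (ltrans (g⁻¹).1 : MatPoly d →+* MatPoly d)
    (RingHom.ext fun f => by
      simp [ltrans_ltrans, ← Units.val_mul, -Units.val_inv_eq_inv_val, -Matrix.coe_units_inv,
        ltrans_one])
    (RingHom.ext fun f => by
      simp [ltrans_ltrans, ← Units.val_mul, -Units.val_inv_eq_inv_val, -Matrix.coe_units_inv,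
        ltrans_one])

noncomputable instance mulActionIdeal : MulAction (GL (Fin d) ℂ) (Ideal (MatPoly d)) where
  smul g I := I.comap (ltrans g.1)
  one_smul I := Ideal.ext fun f => by
    change ltrans 1 f ∈ I ↔ _
    rw [ltrans_one]
  mul_smul g h I := Ideal.ext fun f => by
    change ltrans (g.1 * h.1) f ∈ I ↔ ltrans h.1 (ltrans g.1 f) ∈ I
    rw [ltrans_ltrans]

lemma mem_smul_ideal {g : GL (Fin d) ℂ} {I : Ideal (MatPoly d)} {f : MatPoly d} :
    f ∈ g • I ↔ ltrans g.1 f ∈ I := Iff.rfl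

lemma smul_ideal_mono (g : GL (Fin d) ℂ) {I J : Ideal (MatPoly d)} (h : I ≤ J) : g • I ≤ g • J :=
  fun _ hf => h hf

instance smul_isPrime (g : GL (Fin d) ℂ) (I : Ideal (MatPoly d)) [I.IsPrime] : (g • I).IsPrime :=
  Ideal.IsPrime.comap (ltrans g.1)

lemma height_smul (g : GL (Fin d) ℂ) (I : Ideal (MatPoly d)) : (g • I).height = I.height :=
  RingEquiv.height_comap (ltransEquiv g) I

lemma smul_le_smul_iff (g : GL (Fin d) ℂ) {I J : Ideal (MatPoly d)} : g • I ≤ g • J ↔ I ≤ J :=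
  ⟨fun h => by simpa using smul_ideal_mono g⁻¹ h, smul_ideal_mono g⟩

/-- The maximal ideal of a point. -/
noncomputable def ptIdeal (p : Matrix (Fin d) (Fin d) ℂ) : Ideal (MatPoly d) := RingHom.ker (ev p)

lemma mem_ptIdeal {p : Matrix (Fin d) (Fin d) ℂ} {f : MatPoly d} : f ∈ ptIdeal p ↔ ev p f = 0 :=
  Iff.rfl

instance ptIdeal_isPrime (p : Matrix (Fin d) (Fin d) ℂ) : (ptIdeal p).IsPrime := RingHom.ker_isPrime _

lemma smul_ptIdeal (g : GL (Fin d) ℂ) (p : Matrix (Fin d) (Fin d) ℂ) :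
    g • ptIdeal p = ptIdeal (g.1 * p) :=
  Ideal.ext fun f => by rw [mem_smul_ideal, mem_ptIdeal, mem_ptIdeal, ev_ltrans]

/-- The ideal of polynomials vanishing on a set of invertible matrices. -/
noncomputable def vanIdeal (S : Set (GL (Fin d) ℂ)) : Ideal (MatPoly d) := ⨅ s ∈ S, ptIdeal s.1

lemma mem_vanIdeal {S : Set (GL (Fin d) ℂ)} {f : MatPoly d} :
    f ∈ vanIdeal S ↔ ∀ s ∈ S, ev s.1 f = 0 := by
  simp [vanIdeal, mem_ptIdeal]

lemma vanIdeal_anti {S T : Set (GL (Fin d) ℂ)} (h : S ⊆ T) : vanIdeal T ≤ vanIdeal S :=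
  fun _ hf => mem_vanIdeal.2 fun s hs => mem_vanIdeal.1 hf s (h hs)

/-- The inclusion `Q ≤ g • Q` is a polynomial condition on `g`. -/
lemma exists_condition (Q : Ideal (MatPoly d)) :
    ∃ D : Set (MatPoly d), ∀ g : GL (Fin d) ℂ, (∀ c ∈ D, ev g.1 c = 0) ↔ Q ≤ g • Q := by
  let β : MatPoly d →ₐ[ℂ] MvPolynomial (Fin d × Fin d) (MatPoly d) :=
    aeval fun ik => ∑ j, C (X (ik.1, j)) * X (j, ik.2)
  have hβ (g : Matrix (Fin d) (Fin d) ℂ) (f) : ltrans g f = mapAlgHom (ev g) (β f) := by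
    have : ltrans g = (mapAlgHom (ev g)).comp β := algHom_ext fun ik => by
      simp [ltrans, β, ev]
    exact DFunLike.congr_fun this f
  let c (f : MatPoly d) (φ : MatPoly d →ₗ[ℂ] ℂ) : MatPoly d :=
    ∑ m ∈ (β f).support, φ (monomial m 1) • coeff m (β f)
  have hc (g : Matrix (Fin d) (Fin d) ℂ) (f φ) : ev g (c f φ) = φ (ltrans g f) := by
    rw [hβ]
    conv_rhs => rw [(β f).as_sum]
    simp only [c, map_sum, map_smul, mapAlgHom_apply]
    refine Finset.sum_congr rfl fun m _ => ?_
    change _ = φ (MvPolynomial.map (ev g : MatPoly d →+* ℂ) _)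
    rw [map_monomial, show monomial m ((ev g : MatPoly d →+* ℂ) (coeff m (β f))) =
      (ev g) (coeff m (β f)) • (monomial m 1 : MatPoly d) by
        rw [smul_monomial, smul_eq_mul, mul_one]; rfl, map_smul, smul_eq_mul, smul_eq_mul, mul_comm]
  refine ⟨{x | ∃ f ∈ Q, ∃ φ : MatPoly d →ₗ[ℂ] ℂ, (∀ q ∈ Q, φ q = 0) ∧ x = c f φ}, fun g => ?_⟩
  constructor
  · intro h f hf
    rw [mem_smul_ideal]
    by_contra hnot
    obtain ⟨φ, hφ, hφQ⟩ := Submodule.exists_dual_map_eq_bot_of_notMem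
      (p := Q.restrictScalars ℂ) (x := ltrans g.1 f) hnot inferInstance
    refine hφ ?_
    rw [← hc]
    refine h _ ⟨f, hf, φ, fun q hq => ?_, rfl⟩
    have : φ q ∈ (Q.restrictScalars ℂ).map φ := Submodule.mem_map_of_mem hq
    rwa [hφQ, Submodule.mem_bot] at this
  · rintro h _ ⟨f, hf, φ, hφ, rfl⟩
    rw [hc]
    exact hφ _ (h hf)

end MatrixPolynomials

end MixedIdentity

namespace MixedIdentity

section Escape

open MvPolynomial

variable {d : ℕ}

/-- A nonamenable subgroup whose nonamenable subgroups are all as Zariski dense as itself. -/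
structure IsNonamenableCore (F : Subgroup (GL (Fin d) ℂ)) : Prop where
  not_amenable : ¬ Amenable F
  vanIdeal_le : ∀ H ≤ F, ¬ Amenable H →
    vanIdeal (H : Set (GL (Fin d) ℂ)) ≤ vanIdeal (F : Set (GL (Fin d) ℂ))

lemma exists_isNonamenableCore {Γ : Subgroup (GL (Fin d) ℂ)} (hΓ : ¬ Amenable Γ) :
    ∃ F ≤ Γ, IsNonamenableCore F := by
  let s : Set (Ideal (MatPoly d)) :=
    {I | ∃ H ≤ Γ, ¬ Amenable H ∧ vanIdeal (H : Set (GL (Fin d) ℂ)) = I}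
  obtain ⟨_, ⟨F, hFΓ, hF, rfl⟩, hmax⟩ := WellFounded.has_min
    (wellFounded_gt (α := Ideal (MatPoly d))) s ⟨_, Γ, le_rfl, hΓ, rfl⟩
  refine ⟨F, hFΓ, hF, fun H hHF hH => ?_⟩
  have hle := vanIdeal_anti (show (H : Set (GL (Fin d) ℂ)) ⊆ F from hHF)
  by_contra hnot
  exact hmax _ ⟨H, hHF.trans hFΓ, hH, rfl⟩ (lt_of_le_not_ge hle hnot)

variable {F : Subgroup (GL (Fin d) ℂ)}

lemma IsNonamenableCore.smul_eq (hF : IsNonamenableCore F) {Q : Ideal (MatPoly d)}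
    (hQ : ¬ Amenable (MulAction.stabilizer F Q)) {g : GL (Fin d) ℂ} (hg : g ∈ F) : g • Q = Q := by
  obtain ⟨D, hD⟩ := exists_condition Q
  have hle : (MulAction.stabilizer F Q).map F.subtype ≤ F := by
    rintro _ ⟨x, -, rfl⟩
    exact x.2
  have hvan := hF.vanIdeal_le _ hle fun h => hQ (h.of_mulEquiv
    (Subgroup.equivMapOfInjective _ F.subtype F.subtype_injective).symm)
  have hDF : D ⊆ vanIdeal (F : Set (GL (Fin d) ℂ)) := by
    intro c hc
    refine hvan (mem_vanIdeal.2 ?_)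
    rintro _ ⟨x, hx, rfl⟩
    have hx' : x.1 • Q = Q := hx
    exact (hD x.1).2 hx'.ge c hc
  have key (g) (hg : g ∈ F) : Q ≤ g • Q :=
    (hD g).1 fun c hc => mem_vanIdeal.1 (hDF hc) g hg
  refine le_antisymm ?_ (key g hg)
  rw [← smul_le_smul_iff g⁻¹, inv_smul_smul]
  exact key _ (inv_mem hg)

open scoped Classical in
/-- After enough expansion steps, the low-height components are all invariant. -/
lemma IsNonamenableCore.smul_eq_of_height_lt (hF : IsNonamenableCore F) {S : Finset F} {ε : ℝ}
    (hε : 0 < ε) (hS : ∀ B : Finset (Ideal (MatPoly d)), B.Nonempty →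
      (∀ y ∈ B, Amenable (MulAction.stabilizer F y)) →
      ∃ s ∈ S, ε * B.card < ((B.image (s • ·)) \ B).card)
    (I : ℕ → Ideal (MatPoly d)) (hI : ∀ r, I r ≤ I (r + 1))
    (hIS : ∀ r, ∀ s ∈ S, ∀ P : Ideal (MatPoly d), I (r + 1) ≤ P → I r ≤ s.1 • P)
    (hfix : ∀ P : Ideal (MatPoly d), (∀ g ∈ F, g • P = P) → I 0 ≤ P → ∀ r, I r ≤ P)
    {M : ℝ} (hM : ∀ r, ((I r).minimalPrimes.ncard : ℝ) ≤ M) {k : ℕ} (hk : M < (1 + ε) ^ k)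
    (h : ℕ) : ∀ P ∈ (I (k * h)).minimalPrimes, P.height < h → ∀ g ∈ F, g • P = P := by
  have hmono : Monotone I := monotone_nat_of_le_succ hI
  induction h with
  | zero => intro P _ hP; simp at hP
  | succ h ih =>
    have hdown (r : ℕ) (hr : ∀ P ∈ (I r).minimalPrimes, P.height < h → ∀ g ∈ F, g • P = P)
        {P : Ideal (MatPoly d)} (hP : P ∈ (I (r + 1)).minimalPrimes) (hPh : P.height ≤ h)
        {s : GL (Fin d) ℂ} (hsF : s ∈ F) (hs : I r ≤ s • P) : s • P ∈ (I r).minimalPrimes := by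
      have := hP.1.1
      obtain ⟨P', hP', hle⟩ := Ideal.exists_minimalPrimes_le hs
      have := hP'.1.1
      rcases hle.eq_or_lt with rfl | hlt
      · exact hP'
      exfalso
      have h1 : P'.height < h := by
        have h2 := Ideal.height_add_one_le_of_lt_of_isPrime hlt
        rw [height_smul] at h2
        have h3 := h2.trans hPh
        have h4 : P'.height ≠ ⊤ := ne_top_of_le_ne_top (ENat.natCast_ne_top h) (le_self_add.trans h3)
        exact (ENat.add_one_le_iff h4).1 h3
      have h2 := hr P' hP' h1
      have h3 : P' < P := by
        refine lt_of_le_not_ge ?_ fun hge => hlt.not_ge ?_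
        · rw [← smul_le_smul_iff s, h2 s hsF]; exact hle
        · rw [← h2 s hsF]; exact smul_ideal_mono s hge
      have h4 : I (r + 1) ≤ P' := hfix P' h2 ((hmono (Nat.zero_le r)).trans hP'.1.2) _
      exact h3.not_ge (hP.2 ⟨hP'.1.1, h4⟩ h3.le)
    have hlow (j : ℕ) : ∀ P ∈ (I (k * h + j)).minimalPrimes, P.height < h →
        ∀ g ∈ F, g • P = P := by
      induction j with
      | zero => exact ih
      | succ j ihj =>
        intro P hP hPh
        have h1 := hdown (k * h + j) ihj hP hPh.le F.one_mem
          (by rw [one_smul]; exact (hI _).trans hP.1.2)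
        rw [one_smul] at h1
        exact ihj P h1 hPh
    let B (j : ℕ) : Finset (Ideal (MatPoly d)) :=
      {P ∈ (Ideal.finite_minimalPrimes_of_isNoetherianRing _ (I (k * h + j))).toFinset |
        P.height = h ∧ ¬ ∀ g ∈ F, g • P = P}
    have hB (j : ℕ) (P) : P ∈ B j ↔ P ∈ (I (k * h + j)).minimalPrimes ∧ P.height = h ∧
        ¬ ∀ g ∈ F, g • P = P := by simp [B]
    have hstep (j : ℕ) {P} (hP : P ∈ B (j + 1)) {s} (hsF : s ∈ F) (hs : I (k * h + j) ≤ s • P) :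
        s • P ∈ B j := by
      rw [hB] at hP ⊢
      refine ⟨hdown _ (hlow j) hP.1 hP.2.1.le hsF hs, (height_smul s P).trans hP.2.1,
        fun hfx => hP.2.2 fun g hg => ?_⟩
      have h1 := hfx (s * g * s⁻¹) (mul_mem (mul_mem hsF hg) (inv_mem hsF))
      rw [mul_smul, inv_smul_smul, mul_smul] at h1
      exact smul_left_cancel s h1
    have hgrow (j : ℕ) : (1 + ε) * (B (j + 1)).card ≤ (B j).card := by
      rcases (B (j + 1)).eq_empty_or_nonempty with h0 | hne
      · rw [h0]; simp
      obtain ⟨s, hs, hlt⟩ := hS _ hne fun P hP => by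
        by_contra hnot
        exact ((hB _ P).1 hP).2.2 fun g hg => hF.smul_eq hnot hg
      have hsub : (B (j + 1)) ∪ ((B (j + 1)).image (s • ·) \ B (j + 1)) ⊆ B j := by
        refine Finset.union_subset (fun P hP => ?_) fun P hP => ?_
        · have := hstep j hP F.one_mem
            (by rw [one_smul]; exact (hI _).trans ((hB _ P).1 hP).1.1.2)
          rwa [one_smul] at this
        · obtain ⟨Q, hQ, rfl⟩ := Finset.mem_image.1 (Finset.mem_sdiff.1 hP).1
          exact hstep j hQ s.2 (hIS _ s hs Q ((hB _ Q).1 hQ).1.1.2)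
      have h1 := Finset.card_le_card hsub
      rw [Finset.card_union_of_disjoint Finset.disjoint_sdiff] at h1
      have h2 : ((B (j + 1)).card : ℝ) + (((B (j + 1)).image (s • ·)) \ B (j + 1)).card ≤
          (B j).card := by exact_mod_cast h1
      linarith
    have hpow (j : ℕ) : (1 + ε) ^ j * (B j).card ≤ M := by
      induction j with
      | zero =>
        rw [pow_zero, one_mul]
        refine le_trans (Nat.cast_le.2 ?_) (hM (k * h))
        rw [← Set.ncard_coe_finset]
        exact Set.ncard_le_ncard (fun P hP => ((hB 0 P).1 hP).1)
          (Ideal.finite_minimalPrimes_of_isNoetherianRing _ _)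
      | succ j ihj =>
        refine le_trans ?_ ihj
        rw [pow_succ, mul_assoc]
        exact mul_le_mul_of_nonneg_left (hgrow j) (by positivity)
    have hempty : B k = ∅ := by
      by_contra hne
      have h1 : (1 : ℝ) ≤ (B k).card := by
        exact_mod_cast Finset.card_pos.2 (Finset.nonempty_iff_ne_empty.2 hne)
      have h2 : (1 + ε) ^ k * 1 ≤ (1 + ε) ^ k * (B k).card :=
        mul_le_mul_of_nonneg_left h1 (by positivity)
      linarith [hpow k]
    intro P hP hPh
    rw [Nat.mul_succ] at hP
    have hle : P.height ≤ h := by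
      refine Order.le_of_lt_add_one ?_
      exact_mod_cast hPh
    rcases hle.lt_or_eq with hlt | heq
    · exact hlow k P hP hlt
    · by_contra hnot
      have : P ∈ B k := (hB k P).2 ⟨hP, heq, hnot⟩
      rw [hempty] at this
      simp at this

end Escape

end MixedIdentity

namespace MixedIdentity

section EscapeProperty

open MvPolynomial

lemma exists_nat_pow_gt (C e : ℕ) {ε : ℝ} (hε : 0 < ε) :
    ∃ c : ℝ, 0 ≤ c ∧ ∀ n : ℕ, 1 ≤ n → ∃ k : ℕ, ((C * n ^ e : ℕ) : ℝ) < (1 + ε) ^ k ∧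
      (k : ℝ) ≤ c * Real.log (n + 1) := by
  have ha : 0 < Real.log (1 + ε) := Real.log_pos (by linarith)
  have h2 : 0 < Real.log 2 := Real.log_pos (by norm_num)
  have hC : 0 ≤ Real.log (C + 1) := Real.log_nonneg (by linarith [(Nat.cast_nonneg C : (0 : ℝ) ≤ C)])
  refine ⟨(Real.log (C + 1) / Real.log 2 + e) / Real.log (1 + ε) + 1 / Real.log 2, by positivity,
    fun n hn => ?_⟩
  have hn' : (1 : ℝ) ≤ n := by exact_mod_cast hn
  have hL : Real.log 2 ≤ Real.log (n + 1) := Real.log_le_log (by norm_num) (by linarith)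
  set T := Real.log (C + 1) + e * Real.log (n + 1) with hT
  have hT0 : 0 ≤ T := by have := h2.le.trans hL; positivity
  refine ⟨⌊T / Real.log (1 + ε)⌋₊ + 1, ?_, ?_⟩
  · have h1 : T < (⌊T / Real.log (1 + ε)⌋₊ + 1 : ℕ) * Real.log (1 + ε) := by
      rw [← div_lt_iff₀ ha]
      exact_mod_cast Nat.lt_floor_add_one (T / Real.log (1 + ε))
    rw [← Real.log_pow] at h1
    have h3 : T = Real.log ((C + 1) * (n + 1) ^ e) := by
      rw [Real.log_mul (by positivity) (by positivity), Real.log_pow]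
    have h4 := (Real.log_lt_log_iff (by positivity) (by positivity)).1 (h3.symm.trans_lt h1)
    refine lt_of_le_of_lt ?_ h4
    push_cast
    have h5 : (n : ℝ) ^ e ≤ (n + 1) ^ e := pow_le_pow_left₀ (by positivity) (by linarith) _
    have h6 : (0 : ℝ) ≤ (n + 1) ^ e := by positivity
    have h7 : (C : ℝ) * n ^ e ≤ C * (n + 1) ^ e := mul_le_mul_of_nonneg_left h5 (by positivity)
    linarith
  · have h1 := Nat.floor_le (div_nonneg hT0 ha.le)
    have h3 : Real.log (C + 1) ≤ Real.log (C + 1) / Real.log 2 * Real.log (n + 1) := by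
      rw [div_mul_eq_mul_div, le_div_iff₀ h2]
      exact mul_le_mul_of_nonneg_left hL hC
    have h4 : (1 : ℝ) ≤ 1 / Real.log 2 * Real.log (n + 1) := by
      rw [div_mul_eq_mul_div, one_mul, le_div_iff₀ h2, one_mul]
      exact hL
    have h5 : T / Real.log (1 + ε) ≤
        (Real.log (C + 1) / Real.log 2 + e) / Real.log (1 + ε) * Real.log (n + 1) := by
      rw [div_mul_eq_mul_div]
      refine div_le_div_of_nonneg_right ?_ ha.le
      rw [add_mul]
      linarith
    push_cast
    rw [add_mul]
    linarith

variable {d : ℕ}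

/-- Systems of polynomial equations of degree at most `n` that hold on the elements of `S` of length
`O(log n)` hold on all of `S`. -/
def Escapes (L : GL (Fin d) ℂ → ℕ) (S : Set (GL (Fin d) ℂ)) : Prop :=
  ∃ c : ℝ, 0 ≤ c ∧ ∀ n : ℕ, 1 ≤ n → ∀ E : Set (MatPoly d), (∀ f ∈ E, f.totalDegree ≤ n) →
    ∀ p : Matrix (Fin d) (Fin d) ℂ,
      (∀ g ∈ S, (L g : ℝ) ≤ c * Real.log (n + 1) → ∀ f ∈ E, ev (g.1 * p) f = 0) →
      ∀ g ∈ S, ∀ f ∈ E, ev (g.1 * p) f = 0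

variable {Γ F : Subgroup (GL (Fin d) ℂ)} {L : GL (Fin d) ℂ → ℕ}

lemma length_list_prod_le (hL1 : L 1 = 0) (hL : ∀ a ∈ Γ, ∀ b ∈ Γ, L (a * b) ≤ L a + L b)
    (hFΓ : F ≤ Γ) {S : Finset F} (l : List F) (hl : ∀ s ∈ l, s ∈ S) :
    L l.prod.1 ≤ l.length * S.sup fun s => L s.1 := by
  induction l with
  | nil => simpa using hL1.le
  | cons a l ih =>
    rw [List.prod_cons, List.length_cons, Nat.succ_mul, add_comm]
    refine (hL _ (hFΓ a.2) _ (hFΓ l.prod.2)).trans (add_le_add ?_ (ih fun s hs =>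
      hl s (List.mem_cons_of_mem _ hs)))
    exact Finset.le_sup (f := fun s : F => L s.1) (hl a List.mem_cons_self)

theorem IsNonamenableCore.escapes (hF : IsNonamenableCore F) (hFΓ : F ≤ Γ) (hL1 : L 1 = 0)
    (hL : ∀ a ∈ Γ, ∀ b ∈ Γ, L (a * b) ≤ L a + L b) : Escapes L (F : Set (GL (Fin d) ℂ)) := by
  obtain ⟨S, ε, hε, hS⟩ := exists_expansion (Y := Ideal (MatPoly d)) hF.not_amenable
  obtain ⟨C, hC⟩ := exists_ncard_minimalPrimes_le (Fin d × Fin d) ℂ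
  set N := Fintype.card (Fin d × Fin d)
  obtain ⟨c, hc0, hc⟩ := exists_nat_pow_gt C (N + 1) hε
  set m := S.sup fun s => L s.1
  refine ⟨m * (N + 1) * c, by positivity, fun n hn E hE p hp => ?_⟩
  obtain ⟨k, hk, hkc⟩ := hc n hn
  let U (r : ℕ) : Set (MatPoly d) :=
    {f | ∃ l : List F, (∀ s ∈ l, s ∈ S) ∧ l.length ≤ r ∧ ∃ f' ∈ E, f = ltrans l.prod.1.1 f'}
  have hE0 : E ⊆ U 0 := fun f hf => ⟨[], by simp, le_rfl, f, hf, (ltrans_one f).symm⟩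
  have hUmono {r r' : ℕ} (h : r ≤ r') : U r ⊆ U r' := by
    rintro f ⟨l, hl, hlr, hf⟩
    exact ⟨l, hl, hlr.trans h, hf⟩
  have key := hF.smul_eq_of_height_lt hε hS (fun r => Ideal.span (U r))
    (fun r => Ideal.span_mono (hUmono (Nat.le_succ r))) ?_ ?_
    (fun r => Nat.cast_le.2 (hC n hn (U r) ?_)) hk (N + 1)
  · have hpt : Ideal.span (U (k * (N + 1))) ≤ ptIdeal p := by
      rw [Ideal.span_le]
      rintro _ ⟨l, hl, hlr, f, hf, rfl⟩
      rw [SetLike.mem_coe, mem_ptIdeal, ev_ltrans]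
      refine hp _ l.prod.2 ?_ f hf
      have h1 : L l.prod.1 ≤ k * (N + 1) * m :=
        (length_list_prod_le hL1 hL hFΓ l hl).trans (Nat.mul_le_mul_right _ hlr)
      calc (L l.prod.1 : ℝ) ≤ ((k * (N + 1) * m : ℕ) : ℝ) := Nat.cast_le.2 h1
        _ = m * (N + 1) * k := by push_cast; ring
        _ ≤ m * (N + 1) * (c * Real.log (n + 1)) :=
          mul_le_mul_of_nonneg_left hkc (by positivity)
        _ = _ := by ring
    obtain ⟨P, hP, hPp⟩ := Ideal.exists_minimalPrimes_le hpt
    have := hP.1.1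
    have hPfix := key P hP (lt_of_le_of_lt (height_le_card P)
      (by exact_mod_cast Nat.lt_succ_self N))
    intro g hg f hf
    have h1 : f ∈ P := hP.1.2 (Ideal.subset_span (hUmono (Nat.zero_le _) (hE0 hf)))
    rw [← hPfix g hg] at h1
    have h2 := smul_ideal_mono g hPp h1
    rwa [smul_ptIdeal, mem_ptIdeal] at h2
  · intro r s hs P hP
    rw [Ideal.span_le]
    rintro _ ⟨l, hl, hlr, f, hf, rfl⟩
    rw [SetLike.mem_coe, mem_smul_ideal]
    rw [ltrans_ltrans]
    refine hP (Ideal.subset_span ⟨l ++ [s], fun x hx => ?_, by simpa using hlr, f, hf, ?_⟩)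
    · rcases List.mem_append.1 hx with h | h
      · exact hl x h
      · rwa [List.mem_singleton.1 h]
    · rw [List.prod_append, List.prod_singleton, Subgroup.coe_mul, Units.val_mul]
  · intro P hPfix hP r
    rw [Ideal.span_le]
    rintro _ ⟨l, hl, hlr, f, hf, rfl⟩
    have h1 : f ∈ P := hP (Ideal.subset_span (hE0 hf))
    rw [← hPfix _ l.prod.2] at h1
    rwa [mem_smul_ideal] at h1
  · rintro _ ⟨l, hl, hlr, f, hf, rfl⟩
    exact (totalDegree_ltrans_le _ f).trans (hE f hf)

open scoped Pointwise

lemma Escapes.mul (hL : ∀ a ∈ Γ, ∀ b ∈ Γ, L (a * b) ≤ L a + L b) {S T : Set (GL (Fin d) ℂ)}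
    (hS : Escapes L S) (hT : Escapes L T) (hSΓ : S ⊆ Γ) (hTΓ : T ⊆ Γ) : Escapes L (S * T) := by
  obtain ⟨a, ha, hS⟩ := hS
  obtain ⟨b, hb, hT⟩ := hT
  refine ⟨a + b, add_nonneg ha hb, fun n hn E hE p hp => ?_⟩
  have h1 : ∀ s ∈ S, ∀ t ∈ T, (L t : ℝ) ≤ b * Real.log (n + 1) →
      ∀ f ∈ E, ev (s.1 * (t.1 * p)) f = 0 := by
    intro s hs t ht htL
    refine hS n hn E hE (t.1 * p) (fun s hs hsL f hf => ?_) s hs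
    rw [← mul_assoc]
    refine hp (s * t) (Set.mul_mem_mul hs ht) ?_ f hf
    have := Nat.cast_le (α := ℝ).2 (hL s (hSΓ hs) t (hTΓ ht))
    push_cast at this
    rw [add_mul]
    linarith
  rintro _ ⟨s, hs, t, ht, rfl⟩ f hf
  have h2 := hT n hn (ltrans s.1 '' E) ?_ p ?_ t ht _ (Set.mem_image_of_mem _ hf)
  · rw [ev_ltrans, ← mul_assoc] at h2
    exact h2
  · rintro _ ⟨f, hf, rfl⟩
    exact (totalDegree_ltrans_le _ f).trans (hE f hf)
  · rintro t ht htL _ ⟨f, hf, rfl⟩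
    rw [ev_ltrans]
    exact h1 s hs t ht htL f hf

lemma escapes_singleton (g : GL (Fin d) ℂ) : Escapes L {g} := by
  have h2 : 0 < Real.log 2 := Real.log_pos (by norm_num)
  refine ⟨L g / Real.log 2, by positivity, fun n hn E _ p hp g' hg' => hp g' hg' ?_⟩
  rw [Set.mem_singleton_iff.1 hg', div_mul_eq_mul_div, le_div_iff₀ h2]
  have hn' : (1 : ℝ) ≤ n := by exact_mod_cast hn
  exact mul_le_mul_of_nonneg_left (Real.log_le_log (by norm_num) (by linarith)) (Nat.cast_nonneg _)

end EscapeProperty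

end MixedIdentity

namespace MixedIdentity

section ZariskiGeneration

open MvPolynomial
open scoped Pointwise

lemma amenable_of_subsingleton {G : Type*} [Group G] [Subsingleton G] : Amenable G :=
  ⟨{ toFun := fun f => f 1
     add' := fun _ _ _ _ => rfl
     smul' := fun _ _ _ => rfl
     nonneg' := fun _ _ h => h 1
     one' := rfl
     inv' := fun _ f _ => congrArg f (Subsingleton.elim _ _) }⟩

variable {d : ℕ} {Γ F : Subgroup (GL (Fin d) ℂ)} {L : GL (Fin d) ℂ → ℕ}

open scoped Classical in
lemma IsNonamenableCore.isPrime_vanIdeal (hF : IsNonamenableCore F) :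
    (vanIdeal (F : Set (GL (Fin d) ℂ))).IsPrime := by
  set I := vanIdeal (F : Set (GL (Fin d) ℂ)) with hI
  have hIfix (g) (hg : g ∈ F) : g • I = I := by
    have key (g) (hg : g ∈ F) : I ≤ g • I := fun f hf => mem_vanIdeal.2 fun s hs => by
      rw [ev_ltrans]
      exact mem_vanIdeal.1 hf (g * s) (F.mul_mem hg hs)
    refine le_antisymm ?_ (key g hg)
    rw [← smul_le_smul_iff g⁻¹, inv_smul_smul]
    exact key _ (inv_mem hg)
  have hmin {g} (hg : g ∈ F) {P} (hP : P ∈ I.minimalPrimes) : g • P ∈ I.minimalPrimes := by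
    have := hP.1.1
    refine ⟨⟨inferInstance, ?_⟩, fun Q hQ hle => ?_⟩
    · rw [← hIfix g hg]
      exact smul_ideal_mono g hP.1.2
    · have := hQ.1
      rw [← smul_le_smul_iff g⁻¹, inv_smul_smul]
      refine hP.2 ⟨inferInstance, ?_⟩ ?_
      · rw [← hIfix _ (inv_mem hg)]
        exact smul_ideal_mono _ hQ.2
      · rw [← smul_le_smul_iff g, smul_inv_smul]
        exact hle
  obtain ⟨S, ε, hε, hS⟩ := exists_expansion (Y := Ideal (MatPoly d)) hF.not_amenable
  have hfix : ∀ P ∈ I.minimalPrimes, ∀ g ∈ F, g • P = P := by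
    by_contra! hcon
    obtain ⟨P, hP, hPF⟩ := hcon
    let B : Finset (Ideal (MatPoly d)) :=
      {P ∈ (Ideal.finite_minimalPrimes_of_isNoetherianRing _ I).toFinset |
        ¬ ∀ g ∈ F, g • P = P}
    have hB (P) : P ∈ B ↔ P ∈ I.minimalPrimes ∧ ¬ ∀ g ∈ F, g • P = P := by simp [B]
    obtain ⟨s, -, hs⟩ := hS B ⟨P, (hB P).2 ⟨hP, by push Not; exact hPF⟩⟩ fun P hP => by
      by_contra hnot
      exact ((hB P).1 hP).2 fun g hg => hF.smul_eq hnot hg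
    have hpos := Nat.cast_pos.1 (lt_of_le_of_lt (by positivity) hs)
    obtain ⟨Q, hQ⟩ := Finset.card_pos.1 hpos
    rw [Finset.mem_sdiff] at hQ
    refine hQ.2 ?_
    obtain ⟨P, hP, rfl⟩ := Finset.mem_image.1 hQ.1
    rw [hB] at hP ⊢
    refine ⟨hmin s.2 hP.1, fun hfx => hP.2 fun g hg => ?_⟩
    have h1 : (s.1 * g * s.1⁻¹) • s.1 • P = s.1 • P :=
      hfx _ (mul_mem (mul_mem s.2 hg) (inv_mem s.2))
    rw [mul_smul, inv_smul_smul, mul_smul] at h1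
    exact smul_left_cancel s.1 h1
  have hle : I ≤ ptIdeal 1 := fun f hf => mem_vanIdeal.1 hf 1 F.one_mem
  obtain ⟨P, hP, hP1⟩ := Ideal.exists_minimalPrimes_le hle
  have : P ≤ I := fun f hf => mem_vanIdeal.2 fun g hg => by
    rw [← hfix P hP g hg] at hf
    have h2 := smul_ideal_mono g hP1 hf
    rwa [smul_ptIdeal, mem_ptIdeal, mul_one] at h2
  rw [le_antisymm hP.1.2 this]
  exact hP.1.1

lemma isPrime_vanIdeal_mul {S T : Set (GL (Fin d) ℂ)} (hS : (vanIdeal S).IsPrime)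
    (hT : (vanIdeal T).IsPrime) : (vanIdeal (S * T)).IsPrime := by
  have hmem {f : MatPoly d} (hf : f ∉ vanIdeal (S * T)) : ∃ s ∈ S, ∃ t ∈ T, ev (s.1 * t.1) f ≠ 0 := by
    contrapose! hf
    refine mem_vanIdeal.2 ?_
    rintro _ ⟨s, hs, t, ht, rfl⟩
    exact hf s hs t ht
  refine Ideal.isPrime_iff.2 ⟨fun htop => ?_, fun {f h} hfh => ?_⟩
  · obtain ⟨s, hs⟩ : S.Nonempty := by
      by_contra! hne
      exact hS.ne_top ((Ideal.eq_top_iff_one _).2 (mem_vanIdeal.2 (by simp [hne])))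
    obtain ⟨t, ht⟩ : T.Nonempty := by
      by_contra! hne
      exact hT.ne_top ((Ideal.eq_top_iff_one _).2 (mem_vanIdeal.2 (by simp [hne])))
    have h1 := mem_vanIdeal.1 ((Ideal.eq_top_iff_one _).1 htop) _ (Set.mul_mem_mul hs ht)
    rw [map_one] at h1
    exact one_ne_zero h1
  · by_contra! hcon
    obtain ⟨s₁, hs₁, t₁, ht₁, h₁⟩ := hmem hcon.1
    obtain ⟨s₂, hs₂, t₂, ht₂, h₂⟩ := hmem hcon.2
    have h3 : rtrans t₁.1 f * rtrans t₂.1 h ∉ vanIdeal S := fun hin => by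
      rcases hS.mem_or_mem hin with h | h
      · exact h₁ (by rw [← ev_rtrans]; exact mem_vanIdeal.1 h s₁ hs₁)
      · exact h₂ (by rw [← ev_rtrans]; exact mem_vanIdeal.1 h s₂ hs₂)
    obtain ⟨s, hs, h4⟩ : ∃ s ∈ S, ev s.1 (rtrans t₁.1 f * rtrans t₂.1 h) ≠ 0 := by
      contrapose! h3
      exact mem_vanIdeal.2 h3
    rw [map_mul, ev_rtrans, ev_rtrans] at h4
    have h5 : ltrans s.1 f * ltrans s.1 h ∈ vanIdeal T := by
      rw [← map_mul]
      refine mem_vanIdeal.2 fun t ht => ?_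
      rw [ev_ltrans]
      exact mem_vanIdeal.1 hfh (s * t) (Set.mul_mem_mul hs ht)
    rcases hT.mem_or_mem h5 with h | h
    · have := mem_vanIdeal.1 h t₁ ht₁
      rw [ev_ltrans] at this
      exact left_ne_zero_of_mul h4 this
    · have := mem_vanIdeal.1 h t₂ ht₂
      rw [ev_ltrans] at this
      exact right_ne_zero_of_mul h4 this

lemma isPrime_vanIdeal_singleton (g : GL (Fin d) ℂ) : (vanIdeal {g}).IsPrime := by
  have : vanIdeal {g} = ptIdeal g.1 := by simp [vanIdeal]
  rw [this]
  infer_instance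

/-- A set on which equations can be tested on short elements, and on whose Zariski closure all
products of two conjugates of a fixed nontrivial subgroup lie. -/
theorem exists_escapes (hΓ : ¬ Amenable Γ) (hL1 : L 1 = 0)
    (hL : ∀ a ∈ Γ, ∀ b ∈ Γ, L (a * b) ≤ L a + L b) :
    ∃ (S : Set (GL (Fin d) ℂ)) (F : Subgroup (GL (Fin d) ℂ)), S ⊆ Γ ∧ Escapes L S ∧ F ≤ Γ ∧ F ≠ ⊥ ∧
      ∀ f ∈ vanIdeal S, ∀ g ∈ Γ, ∀ g' ∈ Γ, ∀ a ∈ F, ∀ b ∈ F,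
        ev (g * a * g⁻¹ * (g' * b * g'⁻¹) : GL (Fin d) ℂ).1 f = 0 := by
  obtain ⟨F, hFΓ, hF⟩ := exists_isNonamenableCore hΓ
  let good : Set (Set (GL (Fin d) ℂ)) :=
    {S | S ⊆ Γ ∧ 1 ∈ S ∧ (vanIdeal S).IsPrime ∧ Escapes L S}
  have hmul {S T} (hS : S ∈ good) (hT : T ∈ good) : S * T ∈ good := by
    refine ⟨?_, ⟨1, hS.2.1, 1, hT.2.1, mul_one _⟩, isPrime_vanIdeal_mul hS.2.2.1 hT.2.2.1,
      hS.2.2.2.mul hL hT.2.2.2 hS.1 hT.1⟩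
    rintro _ ⟨s, hs, t, ht, rfl⟩
    exact Γ.mul_mem (hS.1 hs) (hT.1 ht)
  have hconj {g} (hg : g ∈ Γ) : {g} * (F : Set (GL (Fin d) ℂ)) * {g⁻¹} ∈ good := by
    have hgs : ({g} : Set (GL (Fin d) ℂ)) ⊆ Γ := Set.singleton_subset_iff.2 hg
    have hgs' : ({g⁻¹} : Set (GL (Fin d) ℂ)) ⊆ Γ := Set.singleton_subset_iff.2 (inv_mem hg)
    have hsub : {g} * (F : Set (GL (Fin d) ℂ)) ⊆ Γ := by
      rintro _ ⟨s, hs, t, ht, rfl⟩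
      exact Γ.mul_mem (hgs hs) (hFΓ ht)
    refine ⟨?_, ?_, isPrime_vanIdeal_mul (isPrime_vanIdeal_mul (isPrime_vanIdeal_singleton g)
      hF.isPrime_vanIdeal) (isPrime_vanIdeal_singleton _),
      ((escapes_singleton g).mul hL (hF.escapes hFΓ hL1 hL) hgs hFΓ).mul hL
      (escapes_singleton _) hsub hgs'⟩
    · rintro _ ⟨s, hs, t, ht, rfl⟩
      exact Γ.mul_mem (hsub hs) (hgs' ht)
    · exact ⟨g * 1, ⟨g, rfl, 1, F.one_mem, rfl⟩, g⁻¹, rfl, by simp⟩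
  obtain ⟨S, hS, hmin⟩ := WellFounded.has_min
    (InvImage.wf (fun S : Set (GL (Fin d) ℂ) => (vanIdeal S).height) wellFounded_lt)
    good ⟨_, hconj Γ.one_mem⟩
  refine ⟨S, F, hS.1, hS.2.2.2, hFΓ, ?_, fun f hf g hg g' hg' a ha b hb => ?_⟩
  · rintro rfl
    exact hF.not_amenable amenable_of_subsingleton
  · have hT := hmul (hmul hS (hconj hg)) (hconj hg')
    set T := S * ({g} * (F : Set (GL (Fin d) ℂ)) * {g⁻¹}) * ({g'} * (F : Set _) * {g'⁻¹})
    have hST : S ⊆ T := fun s hs =>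
      ⟨s * 1, ⟨s, hs, 1, (hconj hg).2.1, rfl⟩, 1, (hconj hg').2.1, by simp⟩
    have hle : vanIdeal S ≤ vanIdeal T := by
      by_contra hnot
      have := hS.2.2.1
      have := hT.2.2.1
      have hlt : vanIdeal T < vanIdeal S := lt_of_le_not_ge (vanIdeal_anti hST) hnot
      have h1 := Ideal.height_add_one_le_of_lt_of_isPrime hlt
      refine hmin T hT ((ENat.add_one_le_iff ?_).1 h1)
      exact ne_top_of_le_ne_top (ENat.natCast_ne_top _) (height_le_card _)
    refine mem_vanIdeal.1 (hle hf) _ ⟨1 * (g * a * g⁻¹), ⟨1, hS.2.1, _, ?_, rfl⟩,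
      g' * b * g'⁻¹, ?_, by simp⟩
    · exact ⟨g * a, ⟨g, rfl, a, ha, rfl⟩, g⁻¹, rfl, rfl⟩
    · exact ⟨g' * b, ⟨g', rfl, b, hb, rfl⟩, g'⁻¹, rfl, rfl⟩

end ZariskiGeneration

end MixedIdentity

namespace MixedIdentity

section WordLength

variable {G : Type*} [Group G] {S : Set G}

lemma exists_list_prod_eq (hS : ∀ a ∈ S, a⁻¹ ∈ S) (hgen : Subgroup.closure S = ⊤) (g : G) :
    ∃ l : List G, (∀ a ∈ l, a ∈ S) ∧ l.prod = g := by
  refine Submonoid.exists_list_of_mem_closure ?_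
  have h : S ∪ S⁻¹ = S := Set.union_eq_left.2 fun a ha => by simpa using hS _ ha
  rw [← h, ← Subgroup.closure_toSubmonoid, hgen]
  trivial

lemma exists_list_length_eq_wordLength (hS : ∀ a ∈ S, a⁻¹ ∈ S) (hgen : Subgroup.closure S = ⊤)
    (g : G) : ∃ l : List G, (∀ a ∈ l, a ∈ S) ∧ l.length = wordLength S g ∧ l.prod = g := by
  obtain ⟨l, hl, hg⟩ := exists_list_prod_eq hS hgen g
  exact Nat.sInf_mem (s := {n | ∃ l : List G, (∀ a ∈ l, a ∈ S) ∧ l.length = n ∧ l.prod = g})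
    ⟨_, l, hl, rfl, hg⟩

lemma wordLength_prod_le {l : List G} (hl : ∀ a ∈ l, a ∈ S) : wordLength S l.prod ≤ l.length :=
  Nat.sInf_le ⟨l, hl, rfl, rfl⟩

lemma wordLength_one : wordLength S (1 : G) = 0 :=
  Nat.le_zero.1 (wordLength_prod_le (l := []) (by simp))

lemma wordLength_mul_le (hS : ∀ a ∈ S, a⁻¹ ∈ S) (hgen : Subgroup.closure S = ⊤) (a b : G) :
    wordLength S (a * b) ≤ wordLength S a + wordLength S b := by
  obtain ⟨l, hl, hla, rfl⟩ := exists_list_length_eq_wordLength hS hgen a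
  obtain ⟨m, hm, hmb, rfl⟩ := exists_list_length_eq_wordLength hS hgen b
  rw [← hla, ← hmb, ← List.prod_append, ← List.length_append]
  exact wordLength_prod_le fun a ha => (List.mem_append.1 ha).elim (hl a) (hm a)

lemma inv_mem_mixedGenSet (hS : ∀ a ∈ S, a⁻¹ ∈ S) :
    ∀ a ∈ mixedGenSet S, a⁻¹ ∈ mixedGenSet S := by
  rintro a (⟨b, hb, rfl⟩ | rfl | rfl)
  · exact Or.inl ⟨b⁻¹, hS b hb, map_inv _ _⟩
  · exact Or.inr (Or.inr rfl)
  · exact Or.inr (Or.inl (inv_inv _))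

lemma closure_mixedGenSet (hgen : Subgroup.closure S = ⊤) :
    Subgroup.closure (mixedGenSet S) = ⊤ := by
  refine eq_top_iff.2 fun w _ => ?_
  induction w using Monoid.Coprod.induction_on with
  | inl g =>
    have hg : g ∈ Subgroup.closure S := hgen ▸ Subgroup.mem_top g
    have := Subgroup.mem_map_of_mem (Monoid.Coprod.inl : G →* MixedWordGroup G) hg
    rw [MonoidHom.map_closure] at this
    exact Subgroup.closure_mono (fun a ha => Or.inl ha) this
  | inr z =>
    have hz : (Monoid.Coprod.inr z : MixedWordGroup G) = xGen G ^ z.toAdd := by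
      rw [xGen, ← map_zpow, ← ofAdd_zsmul]
      simp
    have hx : xGen G ∈ mixedGenSet S := Or.inr (Or.inl rfl)
    rw [hz]
    exact Subgroup.zpow_mem _ (Subgroup.subset_closure hx) _
  | mul a b ha hb => exact mul_mem (ha trivial) (hb trivial)

end WordLength

section WordPolynomials

open MvPolynomial

variable {d : ℕ}

/-- The generic matrix. -/
noncomputable def genericMatrix (d : ℕ) : Matrix (Fin d) (Fin d) (MatPoly d) :=
  Matrix.of fun i k => X (i, k)

lemma map_genericMatrix (p : Matrix (Fin d) (Fin d) ℂ) :
    (ev p).mapMatrix (genericMatrix d) = p := by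
  ext i k
  simp [genericMatrix, ev]

lemma map_det_genericMatrix (p : Matrix (Fin d) (Fin d) ℂ) :
    ev p (genericMatrix d).det = p.det := by
  rw [AlgHom.map_det, map_genericMatrix]

/-- A bound for the degrees of the determinant and the adjugate of the generic matrix. -/
noncomputable def degreeBound (d : ℕ) : ℕ :=
  1 + (genericMatrix d).det.totalDegree + ∑ i, ∑ k, ((genericMatrix d).adjugate i k).totalDegree

lemma totalDegree_adjugate_le (i k : Fin d) :
    ((genericMatrix d).adjugate i k).totalDegree ≤ degreeBound d := by
  have h1 := Finset.single_le_sum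
    (f := fun k => ((genericMatrix d).adjugate i k).totalDegree)
    (fun _ _ => Nat.zero_le _) (Finset.mem_univ k)
  have h2 := Finset.single_le_sum
    (f := fun i => ∑ k, ((genericMatrix d).adjugate i k).totalDegree)
    (fun _ _ => Nat.zero_le _) (Finset.mem_univ i)
  simp only [degreeBound] at *
  omega

variable {Γ : Subgroup (GL (Fin d) ℂ)}

/-- Up to a power of the determinant, the matrix `M` of polynomials represents the word `w`. -/
def Represents (w : MixedWordGroup Γ) (m : ℕ) (M : Matrix (Fin d) (Fin d) (MatPoly d)) : Prop :=
  ∀ γ : Γ, (ev γ.1.1).mapMatrix M = γ.1.1.det ^ m • (evalWord γ w).1.1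

lemma exists_represents_of_mem {T : Set Γ} {a : MixedWordGroup Γ} (ha : a ∈ mixedGenSet T) :
    ∃ m ≤ 1, ∃ M, Represents a m M ∧ ∀ i k, (M i k).totalDegree ≤ degreeBound d := by
  rcases ha with ⟨b, -, rfl⟩ | rfl | rfl
  · refine ⟨0, zero_le_one, b.1.1.map C, fun γ => ?_, fun i k => ?_⟩
    · ext i k
      simp [ev]
    · simp
  · refine ⟨0, zero_le_one, genericMatrix d, fun γ => ?_, fun i k => ?_⟩
    · rw [map_genericMatrix, evalWord_xGen, pow_zero, one_smul]
    · simp only [genericMatrix, Matrix.of_apply, totalDegree_X, degreeBound]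
      omega
  · refine ⟨1, le_rfl, (genericMatrix d).adjugate, fun γ => ?_, totalDegree_adjugate_le⟩
    have hdet : IsUnit γ.1.1.det := (Matrix.isUnit_iff_isUnit_det _).1 γ.1.isUnit
    rw [AlgHom.map_adjugate, map_genericMatrix, map_inv, evalWord_xGen, pow_one,
      Subgroup.coe_inv, Matrix.coe_units_inv, Matrix.inv_def, smul_smul,
      Ring.mul_inverse_cancel _ hdet, one_smul]

lemma exists_represents_prod {T : Set Γ} (l : List (MixedWordGroup Γ))
    (hl : ∀ a ∈ l, a ∈ mixedGenSet T) :
    ∃ m ≤ l.length, ∃ M, Represents l.prod m M ∧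
      ∀ i k, (M i k).totalDegree ≤ degreeBound d * l.length := by
  induction l with
  | nil =>
    refine ⟨0, le_rfl, 1, fun γ => ?_, fun i k => ?_⟩
    · simp
    · rw [Matrix.one_apply]
      split_ifs <;> simp
  | cons a l ih =>
    obtain ⟨m, hm, M, hM, hdeg⟩ := ih fun b hb => hl b (List.mem_cons_of_mem a hb)
    obtain ⟨n, hn, N, hN, hdegN⟩ := exists_represents_of_mem (hl a List.mem_cons_self)
    refine ⟨n + m, by simp; omega, N * M, fun γ => ?_, fun i k => ?_⟩
    · rw [map_mul, hM, hN, List.prod_cons, map_mul, Subgroup.coe_mul, Units.val_mul, pow_add,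
        smul_mul_smul_comm]
    · rw [Matrix.mul_apply]
      refine totalDegree_finsetSum_le fun j _ => (totalDegree_mul _ _).trans ?_
      rw [List.length_cons, mul_add, mul_one, add_comm]
      exact add_le_add (hdeg j k) (hdegN i j)

/-- The elements at which a word of length `n` is trivial form, within `Γ`, the zero locus of a
set of polynomials of degree `O(n)`. -/
lemma exists_equations {T : Set Γ} (l : List (MixedWordGroup Γ))
    (hl : ∀ a ∈ l, a ∈ mixedGenSet T) :
    ∃ E : Set (MatPoly d), (∀ f ∈ E, f.totalDegree ≤ degreeBound d * l.length) ∧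
      ∀ γ : Γ, (∀ f ∈ E, ev γ.1.1 f = 0) ↔ evalWord γ l.prod = 1 := by
  obtain ⟨m, hm, M, hM, hdeg⟩ := exists_represents_prod l hl
  let N := M - (genericMatrix d).det ^ m • (1 : Matrix (Fin d) (Fin d) (MatPoly d))
  refine ⟨Set.range fun ik : Fin d × Fin d => N ik.1 ik.2, ?_, fun γ => ?_⟩
  · rintro _ ⟨⟨i, k⟩, rfl⟩
    refine (totalDegree_sub _ _).trans (max_le (hdeg i k) ?_)
    rw [Matrix.smul_apply, smul_eq_mul, Matrix.one_apply]
    split_ifs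
    · rw [mul_one]
      refine (totalDegree_pow _ _).trans ?_
      rw [mul_comm]
      exact Nat.mul_le_mul (by simp only [degreeBound]; omega) hm
    · simp
  · have hdet : γ.1.1.det ^ m ≠ 0 :=
      pow_ne_zero _ ((Matrix.isUnit_iff_isUnit_det _).1 γ.1.isUnit).ne_zero
    have hN : (ev γ.1.1).mapMatrix N = γ.1.1.det ^ m • ((evalWord γ l.prod).1.1 - 1) := by
      rw [smul_sub, ← hM, map_sub]
      congr 1
      ext i k
      simp [Matrix.one_apply, map_det_genericMatrix, apply_ite (ev γ.1.1)]
    have hzero : (∀ f ∈ Set.range fun ik : Fin d × Fin d => N ik.1 ik.2, ev γ.1.1 f = 0) ↔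
        (ev γ.1.1).mapMatrix N = 0 := by
      simp only [Set.forall_mem_range, Prod.forall, ← Matrix.ext_iff]
      rfl
    rw [hzero, hN, smul_eq_zero_iff_right hdet, sub_eq_zero, Units.val_eq_one,
      OneMemClass.coe_eq_one]

end WordPolynomials

section Main

lemma Escapes.exists_log_bound {d : ℕ} {Γ : Subgroup (GL (Fin d) ℂ)} {T : Set Γ}
    {L : GL (Fin d) ℂ → ℕ} {S : Set (GL (Fin d) ℂ)} (hS : Escapes L S) (hSΓ : S ⊆ Γ) :
    ∃ C : ℝ, 0 < C ∧ ∀ l : List (MixedWordGroup Γ), (∀ a ∈ l, a ∈ mixedGenSet T) → l ≠ [] →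
      (∀ γ : Γ, (L γ : ℝ) ≤ C * Real.log (l.length + 1) → evalWord γ l.prod = 1) →
      ∀ γ : Γ, (∀ f ∈ vanIdeal S, ev γ.1.1 f = 0) → evalWord γ l.prod = 1 := by
  obtain ⟨c, hc, hE⟩ := hS
  refine ⟨c * degreeBound d + 1, by positivity, fun l hl hne hshort γ hγ => ?_⟩
  obtain ⟨E, hdeg, heq⟩ := exists_equations l hl
  have hlen : 1 ≤ l.length := List.length_pos_iff.2 hne
  have hD : 1 ≤ degreeBound d := by simp only [degreeBound]; omega
  have hlog : Real.log ((degreeBound d * l.length : ℕ) + 1)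
      ≤ degreeBound d * Real.log (l.length + 1) := by
    rw [← Real.log_pow]
    refine Real.log_le_log (by positivity) ?_
    have := one_add_mul_le_pow (a := (l.length : ℝ)) (by linarith [l.length.cast_nonneg (α := ℝ)])
      (degreeBound d)
    push_cast
    rw [add_comm, add_comm (l.length : ℝ)]
    exact this
  have hlog0 : 0 ≤ Real.log ((l.length : ℝ) + 1) := Real.log_nonneg (by simp)
  have key := hE (degreeBound d * l.length) (Nat.mul_pos hD hlen) E hdeg 1 fun g hg hLg => by
    have h := hshort ⟨g, hSΓ hg⟩ (hLg.trans (by nlinarith [mul_le_mul_of_nonneg_left hlog hc]))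
    rw [mul_one]
    exact (heq ⟨g, hSΓ hg⟩).2 h
  refine (heq γ).1 fun f hf => hγ f (mem_vanIdeal.2 fun s hs => ?_)
  have h := key s hs f hf
  rwa [mul_one] at h

/-- The tautological representation of a linear group. -/
noncomputable def linearRep {d : ℕ} (Γ : Subgroup (GL (Fin d) ℂ)) :
    Representation ℂ Γ (Fin d → ℂ) :=
  ((Matrix.toLinAlgEquiv' : Matrix (Fin d) (Fin d) ℂ ≃ₐ[ℂ] _) : _ →* _).comp
    ((Units.coeHom _).comp Γ.subtype)

lemma linearRep_injective {d : ℕ} (Γ : Subgroup (GL (Fin d) ℂ)) :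
    Function.Injective (linearRep Γ) :=
  (Matrix.toLinAlgEquiv' : Matrix (Fin d) (Fin d) ℂ ≃ₐ[ℂ] _).injective.comp
    (Units.val_injective.comp Γ.subtype_injective)

end Main

end MixedIdentity

open MixedIdentity in
theorem stmt0 (d : ℕ) (hd : 1 ≤ d) (Γ : Subgroup (GL (Fin d) ℂ))
    (X : Finset Γ) (hXsymm : ∀ a ∈ X, a⁻¹ ∈ X)
    (hXgen : Subgroup.closure (X : Set Γ) = ⊤)
    (hMIF : ∀ w : MixedWordGroup Γ, w ≠ 1 → ∃ γ : Γ, evalWord γ w ≠ 1) :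
    ∃ C : ℝ, 0 < C ∧
      ∀ w : MixedWordGroup Γ, w ≠ 1 →
        ∃ γ : Γ, (wordLength (X : Set Γ) γ : ℝ) ≤
            C * Real.log ((wordLength (mixedGenSet (X : Set Γ)) w : ℝ) + 1) ∧
          evalWord γ w ≠ 1 := by
  classical
  have hamen : ¬ Amenable Γ := IsMIF.not_amenable hMIF
    (Group.fg_iff.2 ⟨X, hXgen, X.finite_toSet⟩) (linearRep Γ) (linearRep_injective Γ)
  let L : GL (Fin d) ℂ → ℕ := fun g => if h : g ∈ Γ then wordLength (X : Set Γ) ⟨g, h⟩ else 0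
  have hL (γ : Γ) : L γ = wordLength (X : Set Γ) γ := dif_pos γ.2
  have hL1 : L 1 = 0 := (hL 1).trans wordLength_one
  have hLmul : ∀ a ∈ Γ, ∀ b ∈ Γ, L (a * b) ≤ L a + L b := fun a ha b hb => by
    have h := wordLength_mul_le (S := (X : Set Γ)) hXsymm hXgen ⟨a, ha⟩ ⟨b, hb⟩
    rwa [← hL, ← hL, ← hL] at h
  obtain ⟨S, F, hSΓ, hS, hFΓ, hF, hvan⟩ := exists_escapes hamen hL1 hLmul
  obtain ⟨C, hC, hbound⟩ := hS.exists_log_bound (T := (X : Set Γ)) hSΓ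
  refine ⟨C, hC, fun w hw => ?_⟩
  by_contra! hcon
  obtain ⟨l, hl, hlen, rfl⟩ := exists_list_length_eq_wordLength
    (inv_mem_mixedGenSet (S := (X : Set Γ)) hXsymm) (closure_mixedGenSet hXgen) w
  rw [← hlen] at hcon
  have key := hbound l hl (by rintro rfl; exact hw rfl) fun γ hγ => hcon γ (by rwa [← hL])
  obtain ⟨⟨b, hb⟩, hbne⟩ := Subgroup.ne_bot_iff_exists_ne_one.1 hF
  have hb1 : b ≠ 1 := fun h => hbne (Subtype.ext h)
  have hb1' : (⟨b, hFΓ hb⟩ : Γ) ≠ 1 := fun h => hb1 (congrArg Subtype.val h)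
  obtain ⟨γ, hγ⟩ := IsMIF.exists_substitution hMIF hb1' hb1' hw
  refine hγ (key _ fun f hf => ?_)
  have h := hvan f hf γ γ.2 (γ.1 ^ 2) (pow_mem γ.2 2) b hb b hb
  have he : γ.1 * b * γ.1⁻¹ * (γ.1 ^ 2 * b * (γ.1 ^ 2)⁻¹) = γ.1 * b * γ.1 * b * (γ.1 ^ 2)⁻¹ := by
    group
  rw [he] at h
  simpa only [Subgroup.coe_mul, Subgroup.coe_inv, Subgroup.coe_pow] using h
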